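/- Let k be a positive integer (so 2k ≥ 1 is a fixed integer), let a_1, ..., a_{2k}, A be fixed positive real numbers, let 2 ≤ y ≤ q, and suppose every Dirichlet L-function modulo q satisfies the Riemann Hypothesis. Let t_1, ..., t_{2k} be real numbers with |t_j| ≤ q^A. Then there is a constant C depending only on k, A and the a_j such that ∑_{χ ∈ X_q^*} |L(1/2 + 1/log y + it_1, χ)|^{a_1} ⋯ |L(1/2 + 1/log y + it_{2k}, χ)|^{a_{2k}} ≤ C · φ(q) · (log y)^{(a_1²+⋯+a_{2k}²)/4} · ∏_{1≤i<j≤2k} g*(|t_i − t_j|)^{a_i a_j/2}. -/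

import Mathlib

open Complex Real Finset

def dirichletRH {q : ℕ} [NeZero q] (χ : DirichletCharacter ℂ q) : Prop :=
  ∀ s : ℂ, 0 < s.re → s.re < 1 → DirichletCharacter.LFunction χ s = 0 → s.re = 1 / 2

/-- The correlation function `g*`, depending on the parameter `y`. -/
noncomputable def gstar (y : ℝ) (x : ℝ) : ℝ :=
  if x ≤ 1 / Real.log y ∨ Real.exp y ≤ x then Real.log y
  else if x ≤ 10 then 1 / x
  else Real.log (Real.log x)

namespace Stmt13

/-! ### Part A1: ratio of Gamma values -/

lemma gam_sum_lower (α h w b : ℝ) (hα : 0 < α) (hh : 0 ≤ h) (hb : b = α + h + |w| + 1) (n : ℕ) :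
    Real.log (n + b) - Real.log b - b * (1 / (b - 1/2) - 1 / (n + b - 1/2)) ≤
      ∑ j ∈ Finset.range n, (α + j) / ((α + j + h)^2 + w^2) := by
  have hw := abs_nonneg w
  induction n with
  | zero => simp
  | succ n ih =>
    rw [Finset.sum_range_succ]
    have hn : (0:ℝ) ≤ n := n.cast_nonneg
    set x : ℝ := n + b with hx
    have hb1 : 1 < b := by linarith
    have hx1 : 1 < x := by linarith
    have h1 : Real.log (x + 1) - Real.log x ≤ 1 / x := by
      rw [← Real.log_div (by linarith) (by linarith)]
      have := Real.log_le_sub_one_of_pos (x := (x+1)/x) (by positivity)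
      have e : (x + 1)/x - 1 = 1/x := by field_simp; ring
      linarith
    have h2 : 1 / x - b / x^2 ≤ (α + n) / ((α + n + h)^2 + w^2) := by
      have e : 1 / x - b / x^2 = n / x^2 := by field_simp; rw [hx]; ring
      rw [e]
      have : (α + n + h)^2 + w^2 ≤ x^2 := by
        rw [← sq_abs w, hx, hb]; nlinarith [mul_nonneg hw hn, mul_nonneg hw hα.le, mul_nonneg hw hh]
      have hpos : 0 < (α + n + h)^2 + w^2 := by positivity
      gcongr
      linarith
    have h3 : 1 / x^2 ≤ 1 / (x - 1/2) - 1/(x + 1/2) := by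
      rw [div_sub_div _ _ (by linarith) (by linarith), div_le_div_iff₀ (by positivity) (by nlinarith)]
      nlinarith
    have h4 : b / x^2 ≤ b * (1 / (x - 1/2) - 1/(x + 1/2)) := by
      rw [div_eq_mul_one_div]; gcongr
    push_cast
    have e1 : (n:ℝ) + 1 + b = x + 1 := by rw [hx]; ring
    have e2 : x + 1 - 1/2 = x + 1/2 := by ring
    rw [e1, e2]
    nlinarith

lemma norm_shift_le (α h w : ℝ) (hα : 0 < α) (hh : 0 ≤ h) (j : ℕ) :
    ‖((α - h : ℝ) + w * I + j : ℂ)‖ ≤ ‖((α + h : ℝ) + w * I + j : ℂ)‖ *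
      Real.exp (-(2 * h * ((α + j) / ((α + j + h)^2 + w^2)))) := by
  have hj : (0:ℝ) ≤ j := j.cast_nonneg
  have e1 : ∀ x : ℝ, ‖((x : ℝ) + w * I + j : ℂ)‖ = Real.sqrt ((x + j)^2 + w^2) := by
    intro x
    rw [Complex.norm_eq_sqrt_sq_add_sq]; simp
  rw [e1, e1]
  have hpos : 0 < (α + j + h)^2 + w^2 := by positivity
  set y := (α + j) / ((α + j + h)^2 + w^2) with hy
  apply Real.sqrt_le_iff.2
  constructor
  · positivity
  · rw [mul_pow, Real.sq_sqrt (by positivity), ← Real.exp_nat_mul]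
    have h1 := Real.add_one_le_exp (((2:ℕ):ℝ) * -(2 * h * y))
    have e : (α - h + j)^2 + w^2 = ((α + h + j)^2 + w^2) * (((2:ℕ):ℝ) * -(2 * h * y) + 1) := by
      rw [hy]; push_cast; field_simp; ring
    rw [e]
    gcongr

lemma gamma_ratio (α h w : ℝ) (hα : 0 < α) (hh : 0 ≤ h)
    (hne : ∀ m : ℕ, ((α - h : ℝ) + w * I : ℂ) ≠ -m) :
    ‖Complex.Gamma ((α + h : ℝ) + w * I)‖ ≤
      ‖Complex.Gamma ((α - h : ℝ) + w * I)‖ * (Real.exp 2 * (α + h + |w| + 1)) ^ (2 * h) := by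
  have hw := abs_nonneg w
  set b := α + h + |w| + 1 with hb
  have t1 := (Complex.GammaSeq_tendsto_Gamma ((α + h : ℝ) + w * I)).norm
  have t2 := ((Complex.GammaSeq_tendsto_Gamma ((α - h : ℝ) + w * I)).norm).mul_const
    ((Real.exp 2 * b) ^ (2 * h))
  refine le_of_tendsto_of_tendsto t1 t2 ?_
  filter_upwards [Filter.eventually_gt_atTop 0] with n hn
  have hn0 : (0:ℝ) < n := by exact_mod_cast hn
  unfold Complex.GammaSeq
  simp only [norm_mul, norm_div, norm_prod]
  have hc : ∀ x : ℝ, ‖(n:ℂ) ^ ((x:ℝ) + w * I : ℂ)‖ = (n:ℝ) ^ x := by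
    intro x
    rw [Complex.norm_natCast_cpow_of_pos hn]; simp
  rw [hc, hc]
  have hp1 : ∀ j ∈ Finset.range (n+1), 0 < ‖((α - h : ℝ) + w * I + j : ℂ)‖ := by
    intro j _
    rw [norm_pos_iff]
    intro h0
    exact hne j (eq_neg_of_add_eq_zero_left h0)
  have hP1 := Finset.prod_pos hp1
  set S := ∑ j ∈ Finset.range (n+1), (α + j) / ((α + j + h)^2 + w^2) with hS
  have hprod : ∏ j ∈ Finset.range (n+1), ‖((α - h : ℝ) + w * I + j : ℂ)‖ ≤
      (∏ j ∈ Finset.range (n+1), ‖((α + h : ℝ) + w * I + j : ℂ)‖) * Real.exp (-(2 * h * S)) := by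
    rw [hS, Finset.mul_sum, ← Finset.sum_neg_distrib, Real.exp_sum, ← Finset.prod_mul_distrib]
    exact Finset.prod_le_prod (fun j _ => norm_nonneg _) (fun j _ => norm_shift_le α h w hα hh j)
  set P1 := ∏ j ∈ Finset.range (n+1), ‖((α - h : ℝ) + w * I + j : ℂ)‖
  set P2 := ∏ j ∈ Finset.range (n+1), ‖((α + h : ℝ) + w * I + j : ℂ)‖
  have hP2 : 0 < P2 := by
    by_contra hcon
    have : P2 * Real.exp (-(2 * h * S)) ≤ 0 := mul_nonpos_of_nonpos_of_nonneg (not_lt.1 hcon) (Real.exp_pos _).le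
    linarith
  have hSl : Real.log n - Real.log b - 2 ≤ S := by
    have := gam_sum_lower α h w b hα hh hb (n+1)
    have hb1 : 1 < b := by linarith
    have h1 : Real.log n ≤ Real.log ((n+1 : ℕ) + b) := by
      apply Real.log_le_log hn0; push_cast; linarith
    have h2 : b * (1 / (b - 1/2) - 1 / (((n+1:ℕ):ℝ) + b - 1/2)) ≤ 2 := by
      have : b * (1/(b-1/2)) ≤ 2 := by
        rw [mul_one_div, div_le_iff₀ (by linarith)]; linarith
      have h3 : 0 ≤ b * (1 / (((n+1:ℕ):ℝ) + b - 1/2)) := by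
        apply mul_nonneg (by linarith)
        apply one_div_nonneg.2; push_cast; linarith
      linarith [mul_sub b (1 / (b - 1/2)) (1 / (((n+1:ℕ):ℝ) + b - 1/2))]
    linarith
  have hb0 : 0 < b := by linarith
  have key : (n:ℝ)^(α + h) * Real.exp (-(2 * h * S)) ≤ (n:ℝ)^(α - h) * (Real.exp 2 * b)^(2*h) := by
    rw [Real.rpow_def_of_pos hn0, Real.rpow_def_of_pos hn0, Real.rpow_def_of_pos (by positivity),
      Real.log_mul (by positivity) (by positivity), Real.log_exp, ← Real.exp_add, ← Real.exp_add]
    apply Real.exp_le_exp.2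
    nlinarith
  have hnf : (0:ℝ) < ‖(n.factorial : ℂ)‖ := by
    simp [Nat.factorial_pos]
  rw [div_mul_eq_mul_div, div_le_div_iff₀ hP2 hP1]
  calc (n:ℝ)^(α + h) * ‖(n.factorial : ℂ)‖ * P1 ≤ (n:ℝ)^(α + h) * ‖(n.factorial : ℂ)‖ * (P2 * Real.exp (-(2 * h * S))) := by
        gcongr
    _ = ((n:ℝ)^(α + h) * Real.exp (-(2 * h * S))) * ‖(n.factorial : ℂ)‖ * P2 := by ring
    _ ≤ ((n:ℝ)^(α - h) * (Real.exp 2 * b)^(2*h)) * ‖(n.factorial : ℂ)‖ * P2 := by gcongr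
    _ = _ := by ring

end Stmt13

namespace Stmt13

/-! ### Part A2: functional equation -/

open DirichletCharacter ComplexConjugate

variable {q : ℕ} [NeZero q]

lemma star_char (χ : DirichletCharacter ℂ q) (n : ZMod q) : χ⁻¹ n = conj (χ n) := by
  exact (MulChar.star_apply' χ n).symm

lemma LFunction_conj_aux (χ : DirichletCharacter ℂ q) (s : ℂ) (hs : 1 < s.re) :
    LFunction χ⁻¹ (conj s) = conj (LFunction χ s) := by
  rw [LFunction_eq_LSeries _ (by simpa using hs), LFunction_eq_LSeries _ hs, LSeries, LSeries,
    Complex.conj_tsum]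
  congr 1
  ext n
  rcases eq_or_ne n 0 with rfl | hn
  · simp
  rw [LSeries.term_of_ne_zero hn, LSeries.term_of_ne_zero hn, map_div₀, star_char]
  congr 1
  rw [Complex.cpow_conj _ _ (by rw [Complex.natCast_arg]; exact Real.pi_pos.ne), Complex.conj_natCast]

lemma LFunction_conj {χ : DirichletCharacter ℂ q} (hχ : χ ≠ 1) (s : ℂ) :
    LFunction χ⁻¹ (conj s) = conj (LFunction χ s) := by
  have hχ' : χ⁻¹ ≠ 1 := by simpa using hχ
  have h1 : AnalyticOnNhd ℂ (LFunction χ⁻¹) Set.univ :=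
    (differentiable_LFunction hχ').differentiableOn.analyticOnNhd isOpen_univ
  have h2 : AnalyticOnNhd ℂ (conj ∘ LFunction χ ∘ conj) Set.univ := by
    apply DifferentiableOn.analyticOnNhd _ isOpen_univ
    intro z _
    exact (differentiableAt_conj_conj_iff.2 (differentiable_LFunction hχ (conj z))).differentiableWithinAt
  have := h1.eq_of_eventuallyEq h2 (z₀ := 2) ?_
  · have h3 := congrFun this (conj s)
    simpa using h3
  · have : {z : ℂ | 1 < z.re} ∈ nhds (2:ℂ) :=
      (isOpen_lt continuous_const Complex.continuous_re).mem_nhds (by simp)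
    filter_upwards [this] with z hz
    have := LFunction_conj_aux χ (conj z) (by simpa using hz)
    simpa using this

lemma norm_LFunction_inv_conj {χ : DirichletCharacter ℂ q} (hχ : χ ≠ 1) (s : ℂ) :
    ‖LFunction χ⁻¹ (conj s)‖ = ‖LFunction χ s‖ := by
  rw [LFunction_conj hχ, Complex.norm_conj]

lemma gammaFactor_inv (χ : DirichletCharacter ℂ q) (s : ℂ) :
    gammaFactor χ⁻¹ s = gammaFactor χ s := by
  rcases χ.even_or_odd with h | h
  · have h' : χ⁻¹.Even := by
      rw [DirichletCharacter.Even, star_char, h]; simp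
    rw [h.gammaFactor_def, h'.gammaFactor_def]
  · have h' : χ⁻¹.Odd := by
      rw [DirichletCharacter.Odd, star_char, h]; simp
    rw [h.gammaFactor_def, h'.gammaFactor_def]

lemma gammaFactor_ne_zero (χ : DirichletCharacter ℂ q) (s : ℂ) (hs : 0 < s.re) :
    gammaFactor χ s ≠ 0 := by
  rcases χ.even_or_odd with h | h
  · rw [h.gammaFactor_def]; exact Complex.Gammaℝ_ne_zero_of_re_pos hs
  · rw [h.gammaFactor_def]; exact Complex.Gammaℝ_ne_zero_of_re_pos (by simp; linarith)

lemma norm_Gammaℝ (s : ℂ) : ‖Complex.Gammaℝ s‖ = π ^ (-s.re / 2) * ‖Complex.Gamma (s/2)‖ := by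
  rw [Complex.Gammaℝ_def, norm_mul, Complex.norm_cpow_eq_rpow_re_of_pos Real.pi_pos]
  congr 2
  simp

lemma norm_Gamma_conj (s : ℂ) : ‖Complex.Gamma (conj s)‖ = ‖Complex.Gamma s‖ := by
  rw [Complex.Gamma_conj, Complex.norm_conj]

lemma Gammaℝ_ratio (a v u : ℝ) (ha : 0 ≤ a) (ha1 : a ≤ 1) (hv : 0 ≤ v)
    (h0 : Complex.Gammaℝ ((1/2 + a - v : ℝ) + u * I) ≠ 0) :
    ‖Complex.Gammaℝ ((1/2 + a + v : ℝ) - u * I)‖ ≤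
      ‖Complex.Gammaℝ ((1/2 + a - v : ℝ) + u * I)‖ * (Real.exp 2 * (2 + v + |u|)) ^ v := by
  rw [norm_Gammaℝ, norm_Gammaℝ]
  have hu := abs_nonneg u
  have e1 : ‖Complex.Gamma (((1/2 + a + v : ℝ) - u * I) / 2)‖ =
      ‖Complex.Gamma (((1/2+a)/2 + v/2 : ℝ) + (u/2 : ℝ) * I)‖ := by
    rw [← norm_Gamma_conj]
    congr 2
    simp [Complex.ext_iff, map_ofNat]
    ring
  have e2 : (((1/2 + a - v : ℝ) + u * I) / 2 : ℂ) = (((1/2+a)/2 - v/2 : ℝ) + (u/2 : ℝ) * I) := by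
    push_cast; ring
  have hne : ∀ m : ℕ, ((((1/2+a)/2 - v/2 : ℝ) + (u/2 : ℝ) * I) : ℂ) ≠ -m := by
    intro m hm
    apply h0
    rw [Complex.Gammaℝ_eq_zero_iff]
    refine ⟨m, ?_⟩
    rw [← e2] at hm
    linear_combination 2 * hm
  have := gamma_ratio ((1/2+a)/2) (v/2) (u/2) (by linarith) (by linarith) hne
  rw [e1, e2]
  have hpi : π ^ (-(((1/2 + a + v : ℝ) - u * I) : ℂ).re / 2) ≤ π ^ (-(((1/2 + a - v : ℝ) + u * I) : ℂ).re / 2) := by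
    apply Real.rpow_le_rpow_of_exponent_le (by linarith [Real.pi_gt_three])
    simp; linarith
  have h3 : (Real.exp 2 * ((1/2+a)/2 + v/2 + |u/2| + 1)) ^ (2 * (v/2)) ≤ (Real.exp 2 * (2 + v + |u|)) ^ v := by
    rw [mul_div_cancel₀ _ (two_ne_zero)]
    have : |u/2| = |u|/2 := by rw [abs_div]; norm_num
    rw [this]
    have h5 : (1/2+a)/2+v/2+|u|/2+1 ≤ 2+v+|u| := by linarith
    exact Real.rpow_le_rpow (by positivity) (mul_le_mul_of_nonneg_left h5 (by positivity)) hv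
  calc _ ≤ π ^ (-(((1/2 + a - v : ℝ) + u * I) : ℂ).re / 2) * (‖Complex.Gamma (((1/2+a)/2 - v/2 : ℝ) + (u/2 : ℝ) * I)‖ * (Real.exp 2 * (2 + v + |u|)) ^ v) := by
        gcongr
        exact this.trans (by gcongr)
    _ = _ := by ring

lemma gammaFactor_ratio (χ : DirichletCharacter ℂ q) (v u : ℝ) (hv : 0 ≤ v)
    (h0 : gammaFactor χ ((1/2 - v : ℝ) + u * I) ≠ 0) :
    ‖gammaFactor χ ((1/2 + v : ℝ) - u * I)‖ ≤
      ‖gammaFactor χ ((1/2 - v : ℝ) + u * I)‖ * (Real.exp 2 * (2 + v + |u|)) ^ v := by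
  rcases χ.even_or_odd with h | h
  · rw [h.gammaFactor_def] at h0 ⊢
    rw [h.gammaFactor_def]
    have := Gammaℝ_ratio 0 v u le_rfl (by norm_num) hv (by simpa using h0)
    simpa using this
  · rw [h.gammaFactor_def] at h0 ⊢
    rw [h.gammaFactor_def]
    have e1 : (((1/2 - v : ℝ) + u * I) + 1 : ℂ) = (1/2 + 1 - v : ℝ) + u * I := by push_cast; ring
    have e2 : (((1/2 + v : ℝ) - u * I) + 1 : ℂ) = (1/2 + 1 + v : ℝ) - u * I := by push_cast; ring
    rw [e1] at h0 ⊢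
    rw [e2]
    exact Gammaℝ_ratio 1 v u (by norm_num) le_rfl hv h0

lemma prim_ne_one {χ : DirichletCharacter ℂ q} (hq : 1 < q) (hχ : χ.IsPrimitive) : χ ≠ 1 := by
  rintro rfl
  rw [IsPrimitive, conductor_one] at hχ
  · omega

lemma norm_rootNumber_le {χ : DirichletCharacter ℂ q} (hq : 1 < q) (hχ : χ.IsPrimitive) :
    ‖rootNumber χ‖ = 1 := by
  have h1 := prim_ne_one hq hχ
  -- find u with L(1/2+iu) ≠ 0
  obtain ⟨u, hu⟩ : ∃ u : ℝ, LFunction χ (1/2 + u * I) ≠ 0 := by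
    by_contra hcon
    push Not at hcon
    have hA : AnalyticOnNhd ℂ (LFunction χ) Set.univ :=
      (differentiable_LFunction h1).differentiableOn.analyticOnNhd isOpen_univ
    have hz : LFunction χ = 0 := by
      apply hA.eq_of_frequently_eq (g := 0) (fun _ _ => analyticAt_const) (z₀ := 1/2)
      have : Filter.Tendsto (fun u : ℝ => (1/2 + u * I : ℂ)) (nhdsWithin 0 {0}ᶜ) (nhdsWithin (1/2) {1/2}ᶜ) := by
        apply tendsto_nhdsWithin_iff.2
        constructor
        · have : Continuous (fun u : ℝ => (1/2 + u * I : ℂ)) := by fun_prop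
          have := (this.tendsto 0).mono_left (nhdsWithin_le_nhds (s := {0}ᶜ))
          simpa using this
        · filter_upwards [self_mem_nhdsWithin] with u hu
          simpa using hu
      apply this.frequently
      exact Filter.Frequently.of_forall (fun u => by simpa using hcon u)
    have := DirichletCharacter.LFunction_ne_zero_of_one_le_re χ (s := 2) (Or.inl h1) (by simp)
    exact this (by rw [hz]; rfl)
  have hN : (q:ℕ) ≠ 1 := by omega
  have e1 : ∀ (ψ : DirichletCharacter ℂ q) (s : ℂ), 0 < s.re → completedLFunction ψ s = LFunction ψ s * gammaFactor ψ s := by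
    intro ψ s hs
    rw [LFunction_eq_completed_div_gammaFactor ψ s (Or.inr hN), div_mul_cancel₀ _ (gammaFactor_ne_zero ψ s hs)]
  have fe := hχ.completedLFunction_one_sub (1/2 - u * I)
  have e2 : (1 - (1/2 - u * I) : ℂ) = 1/2 + u * I := by ring
  have e3 : (1/2 - u * I : ℂ) = conj (1/2 + u * I) := by
    simp [Complex.ext_iff]
  rw [e2, e1 _ _ (by simp), e1 _ _ (by simp), gammaFactor_inv] at fe
  have := congrArg norm fe
  simp only [norm_mul] at this
  rw [Complex.norm_natCast_cpow_of_pos (by omega)] at this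
  have e4 : ‖gammaFactor χ (1/2 - u * I)‖ = ‖gammaFactor χ (1/2 + u * I)‖ := by
    have : ∀ s, ‖gammaFactor χ (conj s)‖ = ‖gammaFactor χ s‖ := by
      intro s
      rcases χ.even_or_odd with h | h
      · rw [h.gammaFactor_def, h.gammaFactor_def, norm_Gammaℝ, norm_Gammaℝ, ← norm_Gamma_conj (s/2)]
        simp [map_ofNat]
      · rw [h.gammaFactor_def, h.gammaFactor_def, norm_Gammaℝ, norm_Gammaℝ, ← norm_Gamma_conj ((s+1)/2)]
        simp [map_ofNat]
    rw [e3, this]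
  have e5 : ‖LFunction χ⁻¹ (1/2 - u * I)‖ = ‖LFunction χ (1/2 + u * I)‖ := by
    rw [e3, norm_LFunction_inv_conj h1]
  rw [e4, e5] at this
  have p1 : ‖LFunction χ (1/2 + u * I)‖ ≠ 0 := by simpa using hu
  have p2 : ‖gammaFactor χ (1/2 + u * I)‖ ≠ 0 := by
    simpa using gammaFactor_ne_zero χ (1/2 + u * I) (by simp)
  have e6 : (((1/2 - u * I) - 1/2 : ℂ)).re = 0 := by simp
  rw [e6, Real.rpow_zero, one_mul] at this
  have p3 := mul_ne_zero p1 p2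
  have : (‖rootNumber χ‖ - 1) * (‖LFunction χ (1/2 + u * I)‖ * ‖gammaFactor χ (1/2 + u * I)‖) = 0 := by
    linear_combination -this
  rcases mul_eq_zero.1 this with h | h
  · linarith
  · exact absurd h p3

theorem L_reflect {χ : DirichletCharacter ℂ q} (hq : 1 < q) (hχ : χ.IsPrimitive) (v u : ℝ) (hv : 0 ≤ v) :
    ‖LFunction χ ((1/2 - v : ℝ) + u * I)‖ ≤ ‖LFunction χ ((1/2 + v : ℝ) + u * I)‖ *
      (q * (Real.exp 2 * (2 + v + |u|))) ^ v := by
  have h1 := prim_ne_one hq hχ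
  have hN : (q:ℕ) ≠ 1 := by omega
  rcases eq_or_ne (gammaFactor χ ((1/2 - v : ℝ) + u * I)) 0 with h0 | h0
  · rw [LFunction_eq_completed_div_gammaFactor χ _ (Or.inr hN), h0, div_zero, norm_zero]
    positivity
  · have fe := hχ.completedLFunction_one_sub ((1/2 + v : ℝ) - u * I)
    have e2 : (1 - ((1/2 + v : ℝ) - u * I) : ℂ) = (1/2 - v : ℝ) + u * I := by push_cast; ring
    have e3 : ((1/2 + v : ℝ) - u * I : ℂ) = conj ((1/2 + v : ℝ) + u * I) := by
      simp [Complex.ext_iff]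
    have g0 := gammaFactor_ne_zero χ⁻¹ ((1/2 + v : ℝ) - u * I) (by simp; linarith)
    have hL : completedLFunction χ⁻¹ ((1/2 + v : ℝ) - u * I) =
        LFunction χ⁻¹ ((1/2 + v : ℝ) - u * I) * gammaFactor χ ((1/2 + v : ℝ) - u * I) := by
      rw [LFunction_eq_completed_div_gammaFactor χ⁻¹ _ (Or.inr hN), ← gammaFactor_inv χ, div_mul_cancel₀ _ g0]
    rw [e2, hL] at fe
    rw [LFunction_eq_completed_div_gammaFactor χ _ (Or.inr hN), norm_div, fe]
    simp only [norm_mul]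
    rw [norm_rootNumber_le hq hχ, Complex.norm_natCast_cpow_of_pos (by omega)]
    have e6 : (((1/2 + v : ℝ) - u * I) - 1/2 : ℂ).re = v := by simp
    have e7 : ‖LFunction χ⁻¹ ((1/2 + v : ℝ) - u * I)‖ = ‖LFunction χ ((1/2 + v : ℝ) + u * I)‖ := by
      rw [e3, norm_LFunction_inv_conj h1]
    rw [e6, e7, div_le_iff₀ (norm_pos_iff.2 h0), Real.mul_rpow (by positivity) (by positivity)]
    have := gammaFactor_ratio χ v u hv h0
    calc _ ≤ (q:ℝ)^v * 1 * (‖LFunction χ ((1/2 + v : ℝ) + u * I)‖ * (‖gammaFactor χ ((1/2 - v : ℝ) + u * I)‖ * (Real.exp 2 * (2 + v + |u|)) ^ v)) := by gcongr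
      _ = _ := by ring

end Stmt13

namespace Stmt13

/-! ### Part A5: the kernel -/

/-- the entire function with `z * Sk (z^2) = sin z` -/
noncomputable def Sk (w : ℂ) : ℂ := ∑' k : ℕ, (-w) ^ k / ((2 * k + 1).factorial : ℂ)

lemma Sk_term_bound (w : ℂ) (k : ℕ) : ‖(-w) ^ k / ((2 * k + 1).factorial : ℂ)‖ ≤ ‖w‖ ^ k / k.factorial := by
  rw [norm_div, norm_pow, norm_neg, Complex.norm_natCast]
  gcongr
  omega

lemma Sk_summable (w : ℂ) : Summable (fun k : ℕ => (-w) ^ k / ((2 * k + 1).factorial : ℂ)) :=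
  Summable.of_norm_bounded (Real.summable_pow_div_factorial ‖w‖) (Sk_term_bound w)

lemma Sk_sq (z : ℂ) : z * Sk (z ^ 2) = Complex.sin z := by
  rw [Sk, ← tsum_mul_left, ← (Complex.hasSum_sin z).tsum_eq]
  congr 1
  ext k
  rw [neg_pow, ← pow_mul, pow_succ]
  ring

lemma Sk_differentiable : Differentiable ℂ Sk := by
  intro w
  have h : DifferentiableOn ℂ Sk (Metric.ball 0 (‖w‖ + 1)) := by
    apply differentiableOn_tsum_of_summable_norm (u := fun k : ℕ => (‖w‖ + 1) ^ k / k.factorial)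
      (Real.summable_pow_div_factorial _)
    · intro k
      fun_prop
    · exact Metric.isOpen_ball
    · intro k z hz
      refine (Sk_term_bound z k).trans ?_
      have : ‖z‖ ≤ ‖w‖ + 1 := by simpa using (le_of_lt (mem_ball_zero_iff.1 hz))
      gcongr
  exact h.differentiableAt (Metric.isOpen_ball.mem_nhds (by simp))

lemma Sk_small (w : ℂ) (hw : ‖w‖ ≤ 1) : ‖Sk w‖ ≤ 3 := by
  have h1 : ‖Sk w‖ ≤ Real.exp ‖w‖ := by
    rw [Real.exp_eq_exp_ℝ, NormedSpace.exp_eq_tsum_div]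
    exact tsum_of_norm_bounded (Real.summable_pow_div_factorial ‖w‖).hasSum (Sk_term_bound w)
  have h2 : Real.exp ‖w‖ ≤ Real.exp 1 := Real.exp_le_exp.2 hw
  linarith [Real.exp_one_lt_d9]

lemma norm_sin_le (z : ℂ) : ‖Complex.sin z‖ ≤ Real.exp |z.im| := by
  rw [Complex.sin]
  have h1 : ‖Complex.exp (-z * I)‖ ≤ Real.exp |z.im| := by
    rw [Complex.norm_exp]; apply Real.exp_le_exp.2; simp [le_abs_self]
  have h2 : ‖Complex.exp (z * I)‖ ≤ Real.exp |z.im| := by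
    rw [Complex.norm_exp]; apply Real.exp_le_exp.2; simp [neg_le_abs]
  rw [norm_div, norm_mul, Complex.norm_I, mul_one]
  have := norm_sub_le (Complex.exp (-z * I)) (Complex.exp (z * I))
  simp only [Complex.norm_ofNat]
  linarith

lemma Sk_bound (z : ℂ) : ‖Sk (z ^ 2)‖ ^ 2 * max 1 (‖z‖ ^ 2) ≤ 9 * Real.exp |z.im| ^ 2 := by
  have he : 1 ≤ Real.exp |z.im| := Real.one_le_exp (abs_nonneg _)
  rcases le_total ‖z‖ 1 with h | h
  · have h2 : ‖z‖ ^ 2 ≤ 1 := by nlinarith [norm_nonneg z]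
    rw [max_eq_left h2]
    have := Sk_small (z ^ 2) (by rw [norm_pow]; exact h2)
    nlinarith [norm_nonneg (Sk (z ^ 2))]
  · have h2 : 1 ≤ ‖z‖ ^ 2 := by nlinarith [norm_nonneg z]
    rw [max_eq_right h2]
    have h3 : ‖z‖ * ‖Sk (z ^ 2)‖ ≤ Real.exp |z.im| := by
      rw [← norm_mul, Sk_sq]; exact norm_sin_le z
    have h4 : 0 ≤ ‖z‖ * ‖Sk (z ^ 2)‖ := by positivity
    nlinarith

lemma Sk_line (v η u : ℝ) :
    ‖Sk ((v ^ 2 : ℝ) - ((η : ℂ) + u * I) ^ 2)‖ ^ 8 ≤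
      9 ^ 4 * Real.exp |η| ^ 8 * (2 + η ^ 2) ^ 4 / (1 + u ^ 2) ^ 4 := by
  obtain ⟨z, hz⟩ := IsAlgClosed.exists_pow_nat_eq ((v ^ 2 : ℝ) - ((η : ℂ) + u * I) ^ 2) (n := 2) (by norm_num)
  rw [← hz]
  have hre := congrArg Complex.re hz
  have him := congrArg Complex.im hz
  simp [pow_two] at hre him
  have hy : z.im ^ 2 ≤ η ^ 2 := by
    by_contra hcon
    push Not at hcon
    have hx : u ^ 2 < z.re ^ 2 := by nlinarith [sq_nonneg v]
    have h1 : (z.re * z.im) = -(η * u) := by linarith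
    have h2 : z.re ^ 2 * z.im ^ 2 = u ^ 2 * η ^ 2 := by
      rw [← mul_pow, h1]; ring
    nlinarith [sq_nonneg u, sq_nonneg η]
  have hy' : |z.im| ≤ |η| := sq_le_sq.1 hy
  have hn : u ^ 2 - η ^ 2 ≤ ‖z‖ ^ 2 := by
    rw [← Complex.normSq_eq_norm_sq, Complex.normSq_apply]
    nlinarith [sq_nonneg v, sq_nonneg z.im]
  have hb := Sk_bound z
  set M := max 1 (‖z‖ ^ 2) with hM
  have hM1 : 1 ≤ M := le_max_left _ _
  have hM2 : ‖z‖ ^ 2 ≤ M := le_max_right _ _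
  have h3 : 1 + u ^ 2 ≤ M * (2 + η ^ 2) := by nlinarith [sq_nonneg η]
  have h4 : ‖Sk (z ^ 2)‖ ^ 2 * (1 + u ^ 2) ≤ 9 * Real.exp |η| ^ 2 * (2 + η ^ 2) := by
    calc ‖Sk (z ^ 2)‖ ^ 2 * (1 + u ^ 2) ≤ ‖Sk (z ^ 2)‖ ^ 2 * (M * (2 + η ^ 2)) := by gcongr
      _ = (‖Sk (z ^ 2)‖ ^ 2 * M) * (2 + η ^ 2) := by ring
      _ ≤ (9 * Real.exp |z.im| ^ 2) * (2 + η ^ 2) := by gcongr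
      _ ≤ _ := by gcongr
  rw [le_div_iff₀ (by positivity)]
  have h5 := pow_le_pow_left₀ (by positivity) h4 4
  calc _ = (‖Sk (z ^ 2)‖ ^ 2 * (1 + u ^ 2)) ^ 4 := by ring
    _ ≤ _ := h5
    _ = _ := by ring

/-- the kernel on the reals -/
noncomputable def kap (r : ℝ) : ℝ := (Sk ((r ^ 2 : ℝ))).re ^ 8

lemma Sk_real (x : ℝ) : ((Sk x).re : ℂ) = Sk x := by
  rw [Sk, ← Complex.conj_eq_iff_re, Complex.conj_tsum]
  congr 1
  ext k
  simp

lemma kap_eq (r : ℝ) : (kap r : ℂ) = Sk ((r ^ 2 : ℝ)) ^ 8 := by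
  rw [kap, Complex.ofReal_pow, Sk_real]

lemma kap_nonneg (r : ℝ) : 0 ≤ kap r := by
  rw [kap]; positivity

lemma kap_continuous : Continuous kap := by
  unfold kap
  have := Sk_differentiable.continuous
  fun_prop

lemma kap_le (r : ℝ) : kap r ≤ 9 ^ 4 * 16 / (1 + r ^ 2) ^ 4 := by
  have h := Sk_line 0 0 r
  have : ((0 ^ 2 : ℝ) - (((0 : ℝ) : ℂ) + r * I) ^ 2) = ((r ^ 2 : ℝ) : ℂ) := by
    push_cast
    linear_combination - (r:ℂ) ^ 2 * Complex.I_sq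
  rw [this] at h
  have h2 : kap r = ‖Sk ((r ^ 2 : ℝ))‖ ^ 8 := by
    rw [← norm_pow, ← kap_eq, Complex.norm_real, Real.norm_of_nonneg (kap_nonneg r)]
  rw [h2]
  refine h.trans (le_of_eq ?_)
  norm_num

lemma kap_zero : kap 0 = 1 := by
  have : Sk 0 = 1 := by
    rw [Sk, tsum_eq_single 0]
    · simp
    · intro k hk; simp [hk]
  simp [kap, this]

end Stmt13

namespace Stmt13

/-! ### Part A4: logarithms -/

lemma isOpen_halfplane (a : ℝ) : IsOpen {s : ℂ | a < s.re} := isOpen_lt continuous_const Complex.continuous_re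

lemma convex_halfplane (a : ℝ) : Convex ℝ {s : ℂ | a < s.re} := convex_halfSpace_re_gt a

lemma exists_log (a : ℝ) (f : ℂ → ℂ) (hf : DifferentiableOn ℂ f {s : ℂ | a < s.re})
    (nz : ∀ s : ℂ, a < s.re → f s ≠ 0) :
    ∃ l : ℂ → ℂ, DifferentiableOn ℂ l {s : ℂ | a < s.re} ∧ ∀ s : ℂ, a < s.re → Complex.exp (l s) = f s := by
  have hne : ({s : ℂ | a < s.re}).Nonempty := ⟨(a + 1 : ℝ), by simp⟩
  have hsc : IsSimplyConnected {s : ℂ | a < s.re} := by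
    have := (convex_halfplane a).contractibleSpace hne
    have : SimplyConnectedSpace {s : ℂ | a < s.re} := inferInstance
    exact this
  obtain ⟨l, hl, hle⟩ := Complex.exists_continuousOn_eqOn_exp_comp hsc (isOpen_halfplane a) hf.continuousOn
    (by rintro ⟨s, hs, h0⟩; exact nz s hs h0)
  have hle' : ∀ s : ℂ, a < s.re → Complex.exp (l s) = f s := fun s hs => hle hs
  refine ⟨l, ?_, hle'⟩
  intro s hs
  have hU := (isOpen_halfplane a).mem_nhds hs
  have hc : ContinuousAt l s := hl.continuousAt hU
  have hfd : DifferentiableAt ℂ f s := hf.differentiableAt hU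
  have hnear : ∀ᶠ z in nhds s, ‖l z - l s‖ < 1 := by
    have := Metric.tendsto_nhds.1 hc 1 one_pos
    simpa [dist_eq_norm] using this
  have heq : l =ᶠ[nhds s] fun z => l s + Complex.log (f z / f s) := by
    filter_upwards [hnear, hU] with z hz hzU
    have h1 : f z / f s = Complex.exp (l z - l s) := by
      rw [Complex.exp_sub, hle' z hzU, hle' s hs]
    have h2 : |(l z - l s).im| < 1 := (Complex.abs_im_le_norm _).trans_lt hz
    rw [abs_lt] at h2
    rw [h1, Complex.log_exp (by linarith [Real.pi_gt_three]) (by linarith [Real.pi_gt_three])]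
    ring
  have hd : DifferentiableAt ℂ (fun z => l s + Complex.log (f z / f s)) s := by
    apply DifferentiableAt.const_add
    apply DifferentiableAt.clog
    · exact hfd.div_const _
    · rw [div_self (nz s hs)]; exact Complex.one_mem_slitPlane
  exact (heq.differentiableAt_iff.2 hd).differentiableWithinAt

/-- hypotheses for the key inequality -/
structure KH (f : ℂ → ℂ) (Q : ℝ) (c : ℕ → ℂ) : Prop where
  hQ : 2 ≤ Q
  diff : Differentiable ℂ f
  nz : ∀ s : ℂ, 1 / 2 < s.re → f s ≠ 0
  refl : ∀ v u : ℝ, 0 ≤ v → ‖f ((1/2 - v : ℝ) + u * I)‖ ≤ ‖f ((1/2 + v : ℝ) + u * I)‖ *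
      (Q * (Real.exp 2 * (2 + v + |u|))) ^ v
  growth : ∀ s : ℂ, 1 / 2 ≤ s.re → ‖f s‖ ≤ 2 * Q * ‖s‖
  hc : ∀ n, ‖c n‖ ≤ 1
  euler : ∀ s : ℂ, 1 < s.re → f s = Complex.exp (LSeries c s)

lemma abscissa_le {c : ℕ → ℂ} (hc : ∀ n, ‖c n‖ ≤ 1) : LSeries.abscissaOfAbsConv c ≤ 1 :=
  LSeries.abscissaOfAbsConv_le_of_le_const ⟨1, fun n _ => hc n⟩

lemma LSeries_diffOn {c : ℕ → ℂ} (hc : ∀ n, ‖c n‖ ≤ 1) :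
    DifferentiableOn ℂ (LSeries c) {s : ℂ | 1 < s.re} := by
  apply (LSeries_differentiableOn c).mono
  intro s hs
  exact lt_of_le_of_lt (abscissa_le hc) (by exact_mod_cast hs)

lemma exists_log_normalized (f : ℂ → ℂ) (hf : DifferentiableOn ℂ f {s : ℂ | 1 / 2 < s.re})
    (nz : ∀ s : ℂ, 1 / 2 < s.re → f s ≠ 0) (g : ℂ → ℂ) (hg : DifferentiableOn ℂ g {s : ℂ | 1 < s.re})
    (euler : ∀ s : ℂ, 1 < s.re → f s = Complex.exp (g s)) :
    ∃ l : ℂ → ℂ, DifferentiableOn ℂ l {s : ℂ | 1 / 2 < s.re} ∧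
      (∀ s : ℂ, 1 / 2 < s.re → Complex.exp (l s) = f s) ∧ ∀ s : ℂ, 1 < s.re → l s = g s := by
  obtain ⟨l, hl, hle⟩ := exists_log (1/2) f hf nz
  have hld : DifferentiableOn ℂ l {s : ℂ | 1 < s.re} := hl.mono (fun s (hs : 1 < s.re) => by
    show 1 / 2 < s.re; linarith)
  have hexp : ∀ s : ℂ, 1 < s.re → Complex.exp (l s - g s) = 1 := by
    intro s hs
    rw [Complex.exp_sub, hle s (by linarith), euler s hs, div_self (Complex.exp_ne_zero _)]
  have hdd : DifferentiableOn ℂ (fun s => l s - g s) {s : ℂ | 1 < s.re} := hld.sub hg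
  obtain ⟨a, ha⟩ := (isOpen_halfplane 1).exists_is_const_of_deriv_eq_zero
    (convex_halfplane 1).isPreconnected hdd (by
      intro s hs
      have hU := (isOpen_halfplane 1).mem_nhds hs
      have hd : HasDerivAt (fun s => l s - g s) (deriv (fun s => l s - g s) s) s :=
        (hdd.differentiableAt hU).hasDerivAt
      have h1 := hd.cexp
      have h2 : HasDerivAt (fun s => Complex.exp (l s - g s)) 0 s := by
        apply (hasDerivAt_const s (1:ℂ)).congr_of_eventuallyEq
        filter_upwards [hU] with z hz using hexp z hz
      have := h1.unique h2
      rcases mul_eq_zero.1 this with h | h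
      · exact absurd h (Complex.exp_ne_zero _)
      · exact h)
  have ha1 : Complex.exp a = 1 := by
    rw [← ha 2 (by simp), hexp 2 (by simp)]
  refine ⟨fun s => l s - a, hl.sub_const a, ?_, ?_⟩
  · intro s hs
    rw [Complex.exp_sub, ha1, div_one, hle s hs]
  · intro s hs
    rw [← ha s hs]; ring

lemma borelCara (l : ℂ → ℂ) (s₀ s : ℂ) (M r R : ℝ) (hM : 0 < M) (hl : DifferentiableOn ℂ l (Metric.ball s₀ R))
    (hre : ∀ z, ‖z - s₀‖ < R → (l z).re ≤ M) (hr : ‖s - s₀‖ ≤ r) (hrR : r < R) :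
    ‖l s‖ ≤ (2 * M * R + ‖l s₀‖ * (2 * R)) / (R - r) := by
  have hr0 : 0 ≤ r := (norm_nonneg _).trans hr
  have := Complex.borelCaratheodory (f := fun z => l (s₀ + z)) (z := s - s₀) (R := R) hM ?_ ?_ (by linarith) (by
    rw [mem_ball_zero_iff]; linarith)
  · simp only [add_sub_cancel, add_zero] at this
    refine this.trans ?_
    rw [← add_div]
    have h0 := norm_nonneg (s - s₀)
    have hR0 : 0 < R := by linarith
    apply div_le_div₀
    · positivity
    · nlinarith [norm_nonneg (l s₀)]
    · linarith
    · linarith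
  · intro z hz
    have : DifferentiableWithinAt ℂ l (Metric.ball s₀ R) (s₀ + z) := hl _ (by simpa using hz)
    apply DifferentiableWithinAt.comp z this (t := Metric.ball s₀ R) (by fun_prop)
    intro w hw
    simpa using hw
  · intro z hz
    have : ‖z‖ < R := by simpa using hz
    simpa using hre (s₀ + z) (by simpa using this)

lemma natCast_rpow_sum : ∑' n : ℕ, (1 : ℝ) / (n : ℝ) ^ 2 ≤ 2 := by
  rw [hasSum_zeta_two.tsum_eq]
  have := Real.pi_lt_d2
  nlinarith [Real.pi_pos]

/-- Dirichlet series tail. -/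
lemma LSeries_tail {c : ℕ → ℂ} (hc : ∀ n, ‖c n‖ ≤ 1) (N : ℕ) (hN : 0 < N) (s : ℂ) (hs : 2 ≤ s.re) :
    ‖LSeries c s - ∑ n ∈ range N, LSeries.term c s n‖ ≤ 2 * (N:ℝ) ^ (2 - s.re) := by
  have hsum : LSeriesSummable c s := LSeriesSummable_of_abscissaOfAbsConv_lt_re
    (lt_of_le_of_lt (abscissa_le hc) (by exact_mod_cast (by linarith : (1:ℝ) < s.re)))
  have h1 : LSeries c s - ∑ n ∈ range N, LSeries.term c s n = ∑' n, LSeries.term c s (n + N) := by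
    rw [LSeries, ← hsum.sum_add_tsum_nat_add N]; ring
  rw [h1]
  have hs2 : Summable (fun n : ℕ => (1:ℝ) / (n:ℝ) ^ 2) := hasSum_zeta_two.summable
  have hb : ∀ n : ℕ, ‖LSeries.term c s (n + N)‖ ≤ (1 / ((n + N : ℕ) : ℝ) ^ 2) * (N:ℝ) ^ (2 - s.re) := by
    intro n
    rcases Nat.eq_zero_or_pos (n + N) with h0 | h0
    · rw [h0]; simp
    rw [LSeries.norm_term_eq, if_neg h0.ne']
    have hn0 : (0:ℝ) < ((n + N : ℕ) : ℝ) := by exact_mod_cast h0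
    have hN0 : (0:ℝ) < (N : ℝ) := by exact_mod_cast hN
    have e1 : ((n + N : ℕ) : ℝ) ^ s.re = ((n + N : ℕ) : ℝ) ^ 2 * ((n + N : ℕ) : ℝ) ^ (s.re - 2) := by
      rw [← Real.rpow_natCast, ← Real.rpow_add hn0]; norm_num
    have e2 : (N:ℝ) ^ (2 - s.re) = ((N:ℝ) ^ (s.re - 2))⁻¹ := by
      rw [← Real.rpow_neg hN0.le]; ring_nf
    rw [e1, e2, one_div, ← mul_inv, ← one_div]
    apply div_le_div₀ zero_le_one (hc _) (by positivity)
    gcongr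
    · linarith
  calc _ ≤ ∑' n : ℕ, (1 / ((n + N : ℕ) : ℝ) ^ 2) * (N:ℝ) ^ (2 - s.re) := by
        apply tsum_of_norm_bounded _ hb
        exact (((summable_nat_add_iff N).2 hs2).mul_right _).hasSum
    _ = (∑' n : ℕ, (1 / ((n + N : ℕ) : ℝ) ^ 2)) * (N:ℝ) ^ (2 - s.re) := tsum_mul_right
    _ ≤ 2 * (N:ℝ) ^ (2 - s.re) := by
        gcongr
        refine le_trans ?_ natCast_rpow_sum
        rw [← hs2.sum_add_tsum_nat_add N]
        have : 0 ≤ ∑ i ∈ range N, (1:ℝ) / (i:ℝ) ^ 2 := Finset.sum_nonneg (fun i _ => by positivity)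
        linarith

end Stmt13

namespace Stmt13

/-! ### Part A6: contour shift -/

open MeasureTheory Filter Topology

lemma line_integrable {H : ℂ → ℂ} (hH : DifferentiableOn ℂ H {z : ℂ | 0 < z.re}) {a C : ℝ} (ha : 0 < a)
    (hb : ∀ τ : ℝ, ‖H (a + τ * I)‖ ≤ C / (1 + τ ^ 2)) : Integrable (fun τ : ℝ => H (a + τ * I)) := by
  have hcont : Continuous (fun τ : ℝ => H (a + τ * I)) := by
    rw [continuous_iff_continuousAt]
    intro τ
    have h1 : ContinuousAt H (a + τ * I) :=
      (hH.differentiableAt ((isOpen_halfplane 0).mem_nhds (by simpa using ha))).continuousAt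
    exact ContinuousAt.comp (f := fun τ : ℝ => (a + τ * I : ℂ)) h1 (by fun_prop)
  refine Integrable.mono' ((integrable_inv_one_add_sq).const_mul C) hcont.aestronglyMeasurable ?_
  filter_upwards with τ
  have := hb τ
  rwa [div_eq_mul_inv] at this

lemma vshift {H : ℂ → ℂ} (hH : DifferentiableOn ℂ H {z : ℂ | 0 < z.re}) {a b C : ℝ} (ha : 0 < a) (hab : a ≤ b)
    (hb : ∀ x τ : ℝ, a ≤ x → x ≤ b → ‖H (x + τ * I)‖ ≤ C / (1 + τ ^ 2)) :
    ∫ τ : ℝ, H (a + τ * I) = ∫ τ : ℝ, H (b + τ * I) := by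
  have ia := line_integrable hH ha (fun τ => hb a τ le_rfl hab)
  have ib := line_integrable hH (ha.trans_le hab) (fun τ => hb b τ hab le_rfl)
  have hT1 : Tendsto (fun T : ℝ => -T) atTop atBot := tendsto_neg_atTop_atBot
  have ta := intervalIntegral_tendsto_integral ia hT1 tendsto_id
  have tb := intervalIntegral_tendsto_integral ib hT1 tendsto_id
  have hC : 0 ≤ C := by
    have := (norm_nonneg _).trans (hb a 0 le_rfl hab); simpa using this
  -- horizontal parts
  have hh : ∀ T : ℝ, ‖(∫ x : ℝ in a..b, H (x + T * I))‖ ≤ C / (1 + T ^ 2) * (b - a) := by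
    intro T
    have := intervalIntegral.norm_integral_le_of_norm_le_const (a := a) (b := b) (C := C / (1 + T ^ 2))
      (f := fun x : ℝ => H (x + T * I)) (by
        intro x hx
        rw [Set.uIoc_of_le hab] at hx
        exact hb x T hx.1.le hx.2)
    rwa [abs_of_nonneg (by linarith)] at this
  have hrect : ∀ T : ℝ, ‖(∫ τ in (-T)..T, H (b + τ * I)) - ∫ τ in (-T)..T, H (a + τ * I)‖ ≤
      2 * (C / (1 + T ^ 2) * (b - a)) := by
    intro T
    have hr := Complex.integral_boundary_rect_eq_zero_of_differentiableOn H (a + (-T : ℝ) * I) (b + T * I) (by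
      apply hH.mono
      intro z hz
      have := hz.1
      simp only [Complex.add_re, Complex.ofReal_re, Complex.mul_re, Complex.I_re, mul_zero, Complex.I_im,
        Complex.ofReal_im, Set.mem_preimage, sub_zero, add_zero, zero_mul] at this
      rw [Set.uIcc_of_le hab] at this
      exact lt_of_lt_of_le ha this.1)
    simp only [Complex.add_re, Complex.ofReal_re, Complex.mul_re, Complex.I_re, mul_zero, Complex.I_im,
        Complex.ofReal_im, sub_zero, add_zero, Complex.add_im, Complex.mul_im, mul_one, zero_add, zero_mul, sub_self] at hr
    have e : I * ((∫ τ in (-T)..T, H (b + τ * I)) - ∫ τ in (-T)..T, H (a + τ * I)) =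
      (∫ x : ℝ in a..b, H (x + T * I)) - (∫ x : ℝ in a..b, H (x + (-T : ℝ) * I)) := by
      simp only [smul_eq_mul] at hr
      linear_combination hr
    have e2 := congrArg norm e
    rw [norm_mul, Complex.norm_I, one_mul] at e2
    rw [e2]
    refine (norm_sub_le _ _).trans ?_
    have h1 := hh T
    have h2 := hh (-T)
    rw [neg_sq] at h2
    linarith
  have hlim : Tendsto (fun T : ℝ => 2 * (C / (1 + T ^ 2) * (b - a))) atTop (𝓝 0) := by
    have : Tendsto (fun T : ℝ => 1 + T ^ 2) atTop atTop :=
      tendsto_atTop_add_const_left _ _ (tendsto_pow_atTop two_ne_zero)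
    have := (this.const_div_atTop C).mul_const (b - a) |>.const_mul 2
    simpa using this
  have hz : Tendsto (fun T : ℝ => (∫ τ in (-T)..T, H (b + τ * I)) - ∫ τ in (-T)..T, H (a + τ * I)) atTop (𝓝 0) :=
    squeeze_zero_norm hrect hlim
  have := tendsto_nhds_unique hz (tb.sub ta)
  exact (sub_eq_zero.1 this.symm).symm

lemma l_growth {f : ℂ → ℂ} {Q : ℝ} {c : ℕ → ℂ} (h : KH f Q c) {l : ℂ → ℂ}
    (hl : DifferentiableOn ℂ l {s : ℂ | 1 / 2 < s.re})
    (hle : ∀ s : ℂ, 1 / 2 < s.re → Complex.exp (l s) = f s) (hls : ∀ s : ℂ, 1 < s.re → l s = LSeries c s)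
    (δ R : ℝ) (hδ : 0 < δ) (hδ1 : δ ≤ 1) (hR : 1 ≤ R) :
    ∃ C, 0 ≤ C ∧ ∀ s : ℂ, 1 / 2 + δ ≤ s.re → s.re ≤ R → ‖l s‖ ≤ C * (1 + |s.im|) := by
  have hQ := h.hQ
  refine ⟨(2 * (2 * Q * (2 * R + 4)) * (R + 3/2) + 2 * (2 * (R + 3/2))) / δ, by positivity, ?_⟩
  intro s hs1 hs2
  set s₀ : ℂ := (R + 2 : ℝ) + s.im * I with hs0
  have hs0re : s₀.re = R + 2 := by simp [hs0]
  have him : s₀.im = s.im := by simp [hs0]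
  have hls0 : ‖l s₀‖ ≤ 2 := by
    rw [hls s₀ (by rw [hs0re]; linarith)]
    have := LSeries_tail h.hc 1 one_pos s₀ (by rw [hs0re]; linarith)
    simpa using this
  have hball : ∀ z : ℂ, ‖z - s₀‖ < R + 3/2 → 1 / 2 < z.re := by
    intro z hz
    have := (Complex.abs_re_le_norm (z - s₀)).trans_lt hz
    rw [Complex.sub_re, hs0re, abs_lt] at this
    linarith
  have hab := abs_nonneg s.im
  have hM : 0 < 2 * Q * (2 * R + 4) * (1 + |s.im|) := by positivity
  have := borelCara l s₀ s (2 * Q * (2 * R + 4) * (1 + |s.im|)) (R + 3/2 - δ) (R + 3/2) hM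
    (hl.mono (fun z hz => hball z (by simpa [dist_eq_norm] using hz))) ?_ ?_ (by linarith)
  · refine this.trans ?_
    rw [sub_sub_cancel, div_mul_eq_mul_div]
    gcongr
    nlinarith
  · intro z hz
    have hz' := hball z hz
    have e1 : ‖f z‖ = Real.exp (l z).re := by rw [← hle z hz', Complex.norm_exp]
    have e2 := h.growth z hz'.le
    have e3 : (l z).re ≤ ‖f z‖ := by rw [e1]; linarith [Real.add_one_le_exp (l z).re]
    have e4 : ‖z‖ ≤ (2 * R + 4) * (1 + |s.im|) := by
      have a1 : ‖z‖ ≤ ‖z - s₀‖ + ‖s₀‖ := by simpa using norm_add_le (z - s₀) s₀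
      have a2 : ‖s₀‖ ≤ R + 2 + |s.im| := by
        refine (Complex.norm_le_abs_re_add_abs_im s₀).trans ?_
        rw [hs0re, him, abs_of_nonneg (by linarith)]
      nlinarith
    calc (l z).re ≤ 2 * Q * ‖z‖ := e3.trans e2
      _ ≤ 2 * Q * ((2 * R + 4) * (1 + |s.im|)) := by gcongr
      _ = _ := by ring
  · have : s - s₀ = ((s.re - (R + 2) : ℝ) : ℂ) := by
      apply Complex.ext <;> simp [hs0]
    rw [this, Complex.norm_real, Real.norm_eq_abs, abs_le]
    constructor <;> linarith

end Stmt13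

namespace Stmt13

open MeasureTheory Filter Topology

/-- kernel in the plane -/
noncomputable def kk (v u : ℝ) : ℝ := kap (Real.sqrt (v ^ 2 + u ^ 2))

lemma kk_eq (v u : ℝ) : (kk v u : ℂ) = Sk ((v ^ 2 : ℝ) - (((0 : ℝ) : ℂ) + u * I) ^ 2) ^ 8 := by
  rw [kk, kap_eq, Real.sq_sqrt (by positivity)]
  congr 2
  push_cast
  linear_combination (u:ℂ) ^ 2 * Complex.I_sq

lemma kk_nonneg (v u : ℝ) : 0 ≤ kk v u := kap_nonneg _

lemma kk_le (v u : ℝ) : kk v u ≤ 9 ^ 4 * 16 / (1 + v ^ 2 + u ^ 2) ^ 4 := by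
  have := kap_le (Real.sqrt (v ^ 2 + u ^ 2))
  rwa [Real.sq_sqrt (by positivity), ← add_assoc] at this

lemma norm_term_le_one {c : ℕ → ℂ} (hc : ∀ n, ‖c n‖ ≤ 1) (s : ℂ) (hs : 0 ≤ s.re) (n : ℕ) :
    ‖LSeries.term c s n‖ ≤ 1 := by
  rw [LSeries.norm_term_eq]
  split_ifs with h
  · norm_num
  · have h1 : (1:ℝ) ≤ (n:ℝ) := by exact_mod_cast Nat.one_le_iff_ne_zero.2 h
    have h2 : 1 ≤ (n:ℝ) ^ s.re := Real.one_le_rpow h1 hs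
    exact (div_le_one (by linarith)).2 ((hc n).trans h2)

lemma term_differentiable (c : ℕ → ℂ) (n : ℕ) : Differentiable ℂ (fun s => LSeries.term c s n) := by
  rcases eq_or_ne n 0 with rfl | hn
  · simp
  · have : (fun s => LSeries.term c s n) = fun s => c n * (n:ℂ) ^ (-s) := by
      ext s; rw [LSeries.term_of_ne_zero hn, Complex.cpow_neg, div_eq_mul_inv]
    rw [this]
    have hn' : (n:ℂ) ≠ 0 := by exact_mod_cast hn
    intro s
    exact ((differentiableAt_id.neg).const_cpow (Or.inl hn')).const_mul _

lemma bandlimit {f : ℂ → ℂ} {Q : ℝ} {c : ℕ → ℂ} (h : KH f Q c) {l : ℂ → ℂ}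
    (hl : DifferentiableOn ℂ l {s : ℂ | 1 / 2 < s.re})
    (hle : ∀ s : ℂ, 1 / 2 < s.re → Complex.exp (l s) = f s) (hls : ∀ s : ℂ, 1 < s.re → l s = LSeries c s)
    (N : ℕ) (hN : 2 ≤ N) (lam : ℝ) (hlam0 : 0 < lam) (hlam : 8 * lam = Real.log (N - 1/2)) (t v : ℝ) (hv : 0 < v) :
    Integrable (fun τ : ℝ => (kk v τ : ℂ) * (l (1/2 + t * I + (v + τ * I) / lam)
      - ∑ n ∈ range N, LSeries.term c (1/2 + t * I + (v + τ * I) / lam) n)) ∧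
    ∫ τ : ℝ, (kk v τ : ℂ) * (l (1/2 + t * I + (v + τ * I) / lam)
      - ∑ n ∈ range N, LSeries.term c (1/2 + t * I + (v + τ * I) / lam) n) = 0 := by
  set D : ℂ → ℂ := fun s => ∑ n ∈ range N, LSeries.term c s n with hD
  set H : ℂ → ℂ := fun z => Sk ((v ^ 2 : ℝ) - (z - v) ^ 2) ^ 8 * (l (1/2 + t * I + z / lam) - D (1/2 + t * I + z / lam)) with hHdef
  have hre : ∀ z : ℂ, (1/2 + t * I + z / lam).re = 1/2 + z.re / lam := by
    intro z; simp [Complex.div_ofReal_re]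
  have him : ∀ z : ℂ, (1/2 + t * I + z / lam).im = t + z.im / lam := by
    intro z; simp [Complex.div_ofReal_im]
  have hDd : Differentiable ℂ D := by
    apply Differentiable.fun_sum
    intro n _
    exact term_differentiable c n
  have hH : DifferentiableOn ℂ H {z : ℂ | 0 < z.re} := by
    apply DifferentiableOn.mul
    · apply Differentiable.differentiableOn
      have := Sk_differentiable
      fun_prop
    · apply DifferentiableOn.sub
      · apply hl.comp (t := {s : ℂ | 1 / 2 < s.re})
        · fun_prop
        · intro z hz
          show (1/2 : ℝ) < (1/2 + t * I + z / lam).re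
          rw [hre]
          have : 0 < z.re / lam := div_pos hz hlam0
          linarith
      · apply Differentiable.differentiableOn
        fun_prop
  have hSkline : ∀ x τ : ℝ, v ≤ x → ‖Sk ((v ^ 2 : ℝ) - ((x + τ * I : ℂ) - v) ^ 2) ^ 8‖ ≤
      9 ^ 4 * Real.exp (x - v) ^ 8 * (2 + (x - v) ^ 2) ^ 4 / (1 + τ ^ 2) ^ 4 := by
    intro x τ hx
    have := Sk_line v (x - v) τ
    rw [abs_of_nonneg (by linarith)] at this
    rw [norm_pow]
    have e : (x + τ * I : ℂ) - v = ((x - v : ℝ) : ℂ) + τ * I := by push_cast; ring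
    rw [e]; exact this
  -- strip bounds
  have hstrip : ∀ R : ℝ, v ≤ R → ∃ C, ∀ x τ : ℝ, v ≤ x → x ≤ R → ‖H (x + τ * I)‖ ≤ C / (1 + τ ^ 2) := by
    intro R hR
    obtain ⟨C, hC0, hC⟩ := l_growth h hl hle hls (min (v / lam) 1) (1 + R / lam)
      (lt_min (by positivity) one_pos) (min_le_right _ _) (by
        have : 0 ≤ R / lam := div_nonneg (by linarith) hlam0.le
        linarith)
    set B := C * (1 + |t| + 1 / lam) + N with hB
    have hB0 : 0 ≤ B := by positivity
    refine ⟨9 ^ 4 * Real.exp (R - v) ^ 8 * (2 + (R - v) ^ 2) ^ 4 * (B * 2), ?_⟩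
    intro x τ hx1 hx2
    have h1 := hSkline x τ hx1
    have hzre : ((x + τ * I : ℂ)).re = x := by simp
    have hzim : ((x + τ * I : ℂ)).im = τ := by simp
    have hx0 : 0 < x := by linarith
    have h2 : ‖l (1/2 + t * I + (x + τ * I) / lam)‖ ≤ C * (1 + |t + τ / lam|) := by
      have := hC (1/2 + t * I + (x + τ * I) / lam) (by
        rw [hre, hzre]
        have : min (v / lam) 1 ≤ v / lam := min_le_left _ _
        have : v / lam ≤ x / lam := by gcongr
        linarith) (by
        rw [hre, hzre]
        have : x / lam ≤ R / lam := by gcongr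
        linarith)
      rwa [him, hzim] at this
    have h3 : ‖D (1/2 + t * I + (x + τ * I) / lam)‖ ≤ N := by
      refine (norm_sum_le _ _).trans ?_
      have : ∀ n ∈ range N, ‖LSeries.term c (1/2 + t * I + (x + τ * I) / lam) n‖ ≤ 1 := by
        intro n _
        apply norm_term_le_one h.hc
        rw [hre, hzre]; positivity
      simpa using Finset.sum_le_sum this
    have h4 : ‖l (1/2 + t * I + (x + τ * I) / lam) - D (1/2 + t * I + (x + τ * I) / lam)‖ ≤ B * (1 + |τ|) := by
      refine (norm_sub_le _ _).trans ?_
      have : |t + τ / lam| ≤ |t| + |τ| / lam := by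
        refine (abs_add_le _ _).trans ?_
        rw [abs_div, abs_of_pos hlam0]
      have a0 := abs_nonneg τ
      have a1 := abs_nonneg t
      have a2 : 0 ≤ |τ| / lam := by positivity
      have a3 : 0 ≤ 1 / lam := by positivity
      calc _ ≤ C * (1 + (|t| + |τ| / lam)) + N := by
            have : C * (1 + |t + τ / lam|) ≤ C * (1 + (|t| + |τ| / lam)) := by gcongr
            linarith
        _ ≤ _ := by
            rw [hB]
            have e : |τ| / lam = 1 / lam * |τ| := by ring
            rw [e]
            have : C * (1 + (|t| + 1 / lam * |τ|)) ≤ C * ((1 + |t| + 1 / lam) * (1 + |τ|)) := by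
              gcongr; nlinarith [mul_nonneg a1 a0]
            nlinarith [mul_nonneg (Nat.cast_nonneg (α := ℝ) N) a0]
    have h5 : (1 + |τ|) ≤ 2 * (1 + τ ^ 2) := by
      nlinarith [sq_abs τ, sq_nonneg (|τ| - 1), abs_nonneg τ]
    rw [hHdef]
    simp only
    rw [norm_mul]
    have hpos : (0:ℝ) < 1 + τ ^ 2 := by positivity
    calc _ ≤ (9 ^ 4 * Real.exp (x - v) ^ 8 * (2 + (x - v) ^ 2) ^ 4 / (1 + τ ^ 2) ^ 4) * (B * (1 + |τ|)) := by gcongr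
      _ ≤ (9 ^ 4 * Real.exp (R - v) ^ 8 * (2 + (R - v) ^ 2) ^ 4 / (1 + τ ^ 2) ^ 2) * (B * (2 * (1 + τ ^ 2))) := by
          have : (2 + (x - v) ^ 2) ≤ (2 + (R - v) ^ 2) := by nlinarith
          gcongr
          · nlinarith
          · norm_num
      _ = _ := by field_simp
  have hrw : ∀ τ : ℝ, (kk v τ : ℂ) * (l (1/2 + t * I + (v + τ * I) / lam) - D (1/2 + t * I + (v + τ * I) / lam)) = H (v + τ * I) := by
    intro τ
    rw [hHdef, kk_eq]
    simp
  have hrw' : (fun τ : ℝ => (kk v τ : ℂ) * (l (1/2 + t * I + (v + τ * I) / lam) - ∑ n ∈ range N, LSeries.term c (1/2 + t * I + (v + τ * I) / lam) n)) = fun τ : ℝ => H (v + τ * I) := funext hrw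
  rw [hrw']
  obtain ⟨C0, hC0⟩ := hstrip v le_rfl
  refine ⟨line_integrable hH hv (fun τ => hC0 v τ le_rfl le_rfl), ?_⟩
  -- bound for large R
  have hNr : (2:ℝ) ≤ N := by exact_mod_cast hN
  set δ := (Real.log N - 8 * lam) / lam with hδ
  have hδ0 : 0 < δ := by
    apply div_pos _ hlam0
    rw [hlam, sub_pos]
    apply Real.log_lt_log <;> linarith
  have hbound : ∀ R : ℝ, max v (max 1 (2 * lam)) ≤ R → ‖∫ τ : ℝ, H (v + τ * I)‖ ≤
      (9 ^ 4 * (2 * (N:ℝ) ^ ((3:ℝ)/2)) * π * 3 ^ 4) * (R ^ 8 * Real.exp (- (δ * R))) := by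
    intro R hR
    have hR1 : v ≤ R := (le_max_left _ _).trans hR
    have hR2 : 1 ≤ R := ((le_max_left _ _).trans (le_max_right _ _)).trans hR
    have hR3 : 2 * lam ≤ R := ((le_max_right _ _).trans (le_max_right _ _)).trans hR
    obtain ⟨C, hC⟩ := hstrip R hR1
    rw [vshift hH hv hR1 (fun x τ h1 h2 => hC x τ h1 h2)]
    have hRl : 2 ≤ R / lam := by rw [le_div_iff₀ hlam0]; exact hR3
    have hpt : ∀ τ : ℝ, ‖H (R + τ * I)‖ ≤ (9 ^ 4 * Real.exp R ^ 8 * (3 ^ 4 * R ^ 8) * (2 * (N:ℝ) ^ (3/2 - R / lam))) * (1 + τ ^ 2)⁻¹ := by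
      intro τ
      have h1 := hSkline R τ hR1
      have hs : 2 ≤ (1/2 + t * I + (R + τ * I) / lam : ℂ).re := by rw [hre]; simp; linarith
      have h2 := LSeries_tail h.hc N (by omega) (1/2 + t * I + (R + τ * I) / lam) hs
      rw [← hls _ (by linarith), hre] at h2
      have e : (2 - (1/2 + ((R + τ * I : ℂ)).re / lam)) = 3/2 - R / lam := by simp; ring
      rw [e] at h2
      rw [hHdef]
      simp only
      rw [norm_mul]
      calc _ ≤ (9 ^ 4 * Real.exp (R - v) ^ 8 * (2 + (R - v) ^ 2) ^ 4 / (1 + τ ^ 2) ^ 4) * (2 * (N:ℝ) ^ (3/2 - R / lam)) := by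
            gcongr
        _ ≤ (9 ^ 4 * Real.exp R ^ 8 * (3 ^ 4 * R ^ 8) / (1 + τ ^ 2) ^ 1) * (2 * (N:ℝ) ^ (3/2 - R / lam)) := by
            have a1 : (2 + (R - v) ^ 2) ^ 4 ≤ 3 ^ 4 * R ^ 8 := by
              have : 2 + (R - v) ^ 2 ≤ 3 * R ^ 2 := by nlinarith
              calc _ ≤ (3 * R ^ 2) ^ 4 := by gcongr
                _ = _ := by ring
            gcongr
            · linarith
            · nlinarith [sq_nonneg τ]
            · norm_num
        _ = _ := by rw [pow_one, div_eq_mul_inv]; ring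
    refine (norm_integral_le_of_norm_le (integrable_inv_one_add_sq.const_mul _) (Eventually.of_forall hpt)).trans ?_
    rw [integral_const_mul, integral_univ_inv_one_add_sq]
    apply le_of_eq
    have hN0 : (0:ℝ) < N := by linarith
    have e1 : Real.exp R ^ 8 * (N:ℝ) ^ (3/2 - R / lam) = (N:ℝ) ^ ((3:ℝ)/2) * Real.exp (-(δ * R)) := by
      rw [Real.rpow_sub hN0, Real.rpow_def_of_pos hN0 (R / lam), ← Real.exp_nat_mul, mul_div_assoc',
        div_eq_iff (Real.exp_ne_zero _), mul_assoc ((N:ℝ) ^ ((3:ℝ)/2)), ← Real.exp_add, mul_comm]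
      congr 2
      rw [hδ]
      field_simp
      push_cast
      ring
    calc _ = 9 ^ 4 * (3 ^ 4 * R ^ 8) * 2 * π * (Real.exp R ^ 8 * (N:ℝ) ^ (3/2 - R / lam)) := by ring
      _ = _ := by rw [e1]; ring
  have hlim : Tendsto (fun R : ℝ => (9 ^ 4 * (2 * (N:ℝ) ^ ((3:ℝ)/2)) * π * 3 ^ 4) * (R ^ 8 * Real.exp (- (δ * R)))) atTop (𝓝 0) := by
    have h1 := (Real.tendsto_pow_mul_exp_neg_atTop_nhds_zero 8).comp (tendsto_id.const_mul_atTop hδ0)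
    have h2 := h1.const_mul ((9 ^ 4 * (2 * (N:ℝ) ^ ((3:ℝ)/2)) * π * 3 ^ 4) / δ ^ 8)
    rw [mul_zero] at h2
    refine h2.congr ?_
    intro R
    simp only [Function.comp, id]
    field_simp
  have : ‖∫ τ : ℝ, H (v + τ * I)‖ ≤ 0 :=
    ge_of_tendsto hlim (eventually_atTop.2 ⟨_, hbound⟩)
  exact norm_le_zero_iff.1 this

end Stmt13

namespace Stmt13

open MeasureTheory Filter Topology

lemma circle_facts {g : ℂ → ℂ} (hg : Differentiable ℂ g) (h0 : g 0 ≠ 0) (r : ℝ) (hr : 0 < r) :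
    IntegrableOn (fun θ => Real.log ‖g (r * Real.cos θ + (r * Real.sin θ) * I)‖) (Set.Ioo (-π) π) ∧
    2 * π * Real.log ‖g 0‖ ≤ ∫ θ in Set.Ioo (-π) π, Real.log ‖g (r * Real.cos θ + (r * Real.sin θ) * I)‖ := by
  have hA : AnalyticOnNhd ℂ g (Metric.closedBall 0 |r|) :=
    fun z _ => hg.analyticAt z
  have hci : CircleIntegrable (fun z => Real.log ‖g z‖) 0 r :=
    MeromorphicOn.circleIntegrable_log_norm (fun z _ => (hg.analyticAt z).meromorphicAt)
  have hpt : ∀ θ : ℝ, circleMap 0 r θ = r * Real.cos θ + (r * Real.sin θ) * I := by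
    intro θ
    rw [circleMap, Complex.exp_mul_I]; push_cast; ring
  have hper : Function.Periodic (fun θ => Real.log ‖g (circleMap 0 r θ)‖) (2 * π) := by
    intro θ; simp [periodic_circleMap 0 r θ]
  have hIntg : IntervalIntegrable (fun θ => Real.log ‖g (circleMap 0 r θ)‖) volume (-π) π := by
    have h1 : IntervalIntegrable (fun θ => Real.log ‖g (circleMap 0 r θ)‖) volume 0 (0 + 2 * π) := by
      rw [zero_add]; exact hci
    exact hper.intervalIntegrable (by positivity) h1 _ _
  have hle : -π ≤ π := by linarith [Real.pi_pos]
  have hJ : Real.log ‖g 0‖ ≤ circleAverage (fun z => Real.log ‖g z‖) 0 r := by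
    rw [AnalyticOnNhd.circleAverage_log_norm hr.ne' hA h0]
    have : 0 ≤ ∑ᶠ u, (MeromorphicOn.divisor g (Metric.closedBall 0 |r|) u : ℝ) * Real.log (r * ‖0 - u‖⁻¹) := by
      apply finsum_nonneg
      intro u
      by_cases hu : u ∈ Metric.closedBall (0:ℂ) |r|
      · apply mul_nonneg
        · exact_mod_cast (MeromorphicOn.AnalyticOnNhd.divisor_nonneg hA) u
        · rw [zero_sub, norm_neg]
          rcases eq_or_ne u 0 with rfl | hu0
          · simp
          · apply Real.log_nonneg
            rw [← div_eq_mul_inv, le_div_iff₀ (norm_pos_iff.2 hu0), one_mul]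
            simpa [abs_of_pos hr] using hu
      · rw [Function.locallyFinsuppWithin.apply_eq_zero_of_notMem _ hu]; simp
    linarith
  have e3 : ∫ θ in (0:ℝ)..(2*π), Real.log ‖g (circleMap 0 r θ)‖ = ∫ θ in (-π)..π, Real.log ‖g (circleMap 0 r θ)‖ := by
    have := hper.intervalIntegral_add_eq 0 (-π)
    rw [zero_add] at this
    rw [this]; congr 1; ring
  rw [circleAverage_def, e3, smul_eq_mul] at hJ
  simp only [hpt] at hIntg hJ
  constructor
  · rw [intervalIntegrable_iff_integrableOn_Ioo_of_le hle] at hIntg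
    exact hIntg
  · rw [intervalIntegral.integral_of_le hle, integral_Ioc_eq_integral_Ioo] at hJ
    have hpi : 0 < 2 * π := by positivity
    calc _ ≤ 2 * π * ((2 * π)⁻¹ * ∫ θ in Set.Ioo (-π) π, Real.log ‖g (r * Real.cos θ + (r * Real.sin θ) * I)‖) := by
          gcongr
      _ = _ := by rw [← mul_assoc, mul_inv_cancel₀ hpi.ne', one_mul]

lemma kk_continuous : Continuous (fun p : ℝ × ℝ => kk p.1 p.2) := by
  unfold kk
  have := kap_continuous
  fun_prop

lemma kk_integrable (k : ℕ) (hk : k ≤ 4) : Integrable (fun p : ℝ × ℝ => kk p.1 p.2 * (1 + p.1 ^ 2 + p.2 ^ 2) ^ (k / 2)) := by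
  have h := (integrable_inv_one_add_sq).mul_prod (integrable_inv_one_add_sq)
  refine Integrable.mono' (h.const_mul (9 ^ 4 * 16)) ?_ ?_
  · have := kk_continuous
    exact Continuous.aestronglyMeasurable (by fun_prop)
  · filter_upwards with p
    have h1 := kk_le p.1 p.2
    have h0 := kk_nonneg p.1 p.2
    rw [Real.norm_of_nonneg (by positivity)]
    have h2 : k / 2 ≤ 2 := by omega
    have h3 : 1 ≤ 1 + p.1 ^ 2 + p.2 ^ 2 := by nlinarith [sq_nonneg p.1, sq_nonneg p.2]
    calc _ ≤ (9 ^ 4 * 16 / (1 + p.1 ^ 2 + p.2 ^ 2) ^ 4) * (1 + p.1 ^ 2 + p.2 ^ 2) ^ 2 := by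
          gcongr
      _ = 9 ^ 4 * 16 * ((1 + p.1 ^ 2 + p.2 ^ 2) ^ 2)⁻¹ := by field_simp
      _ ≤ 9 ^ 4 * 16 * ((1 + p.1 ^ 2) * (1 + p.2 ^ 2))⁻¹ := by
          gcongr
          nlinarith [sq_nonneg p.1, sq_nonneg p.2, mul_nonneg (sq_nonneg p.1) (sq_nonneg p.2), sq_nonneg (p.1^2), sq_nonneg (p.2^2)]
      _ = _ := by rw [mul_inv]

lemma jensen_plane {g : ℂ → ℂ} (hg : Differentiable ℂ g) (h0 : g 0 ≠ 0) (B : ℝ) (hB0 : 0 ≤ B)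
    (hB : ∀ z, Real.log ‖g z‖ ≤ B * (1 + ‖z‖) ^ 2) :
    Integrable (fun p : ℝ × ℝ => kk p.1 p.2 * Real.log ‖g (p.1 + p.2 * I)‖) ∧
    Real.log ‖g 0‖ * (∫ p : ℝ × ℝ, kk p.1 p.2) ≤ ∫ p : ℝ × ℝ, kk p.1 p.2 * Real.log ‖g (p.1 + p.2 * I)‖ := by
  set V : ℝ × ℝ → ℝ := fun p => kk p.1 p.2 * Real.log ‖g (p.1 + p.2 * I)‖ with hV
  set W : ℝ → ℝ → ℝ := fun r θ => Real.log ‖g (r * Real.cos θ + (r * Real.sin θ) * I)‖ with hW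
  set G : ℝ × ℝ → ℝ := fun p => p.1 * (kap p.1 * W p.1 p.2) with hG
  set μ := (volume.restrict (Set.Ioi (0:ℝ))).prod (volume.restrict (Set.Ioo (-π) π)) with hμ
  have hμ' : (volume : Measure (ℝ × ℝ)).restrict polarCoord.target = μ := by
    rw [polarCoord_target, hμ, Measure.prod_restrict]; rfl
  have hgc := hg.continuous
  have hVm : Measurable V := by
    apply Measurable.mul kk_continuous.measurable
    apply Measurable.log
    apply Continuous.measurable; fun_prop
  have hGm : Measurable G := by
    apply Measurable.mul measurable_fst
    apply Measurable.mul (kap_continuous.measurable.comp measurable_fst)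
    apply Measurable.log
    apply Continuous.measurable; fun_prop
  have hGV : ∀ p ∈ polarCoord.target, p.1 * V (polarCoord.symm p) = G p := by
    rintro ⟨r, θ⟩ hp
    have hr : 0 < r := hp.1
    simp only [hG, hV, hW, polarCoord_symm_apply, kk]
    have : (r * Real.cos θ) ^ 2 + (r * Real.sin θ) ^ 2 = r ^ 2 := by
      linear_combination r ^ 2 * Real.sin_sq_add_cos_sq θ
    rw [this, Real.sqrt_sq hr.le]
    push_cast
    rfl
  -- inner bounds
  set L0 := Real.log ‖g 0‖ with hL0
  have hWle : ∀ r θ : ℝ, 0 < r → W r θ ≤ B * (1 + r) ^ 2 := by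
    intro r θ hr
    have := hB (r * Real.cos θ + (r * Real.sin θ) * I)
    have e : ‖(r * Real.cos θ + (r * Real.sin θ) * I : ℂ)‖ = r := by
      have : (r * Real.cos θ + (r * Real.sin θ) * I : ℂ) = circleMap 0 r θ := by
        rw [circleMap, Complex.exp_mul_I]; push_cast; ring
      rw [this, norm_circleMap_zero, abs_of_pos hr]
    rwa [e] at this
  have hinner : ∀ r : ℝ, 0 < r → ∫ θ in Set.Ioo (-π) π, ‖W r θ‖ ≤ 2 * π * (2 * (B * (1 + r) ^ 2) + |L0|) := by
    intro r hr
    obtain ⟨hi, hj⟩ := circle_facts hg h0 r hr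
    have h1 : ∫ θ in Set.Ioo (-π) π, ‖W r θ‖ ≤ ∫ θ in Set.Ioo (-π) π, (2 * (B * (1 + r) ^ 2) - W r θ) := by
      apply integral_mono_of_nonneg
      · exact Eventually.of_forall (fun θ => norm_nonneg _)
      · exact (integrable_const _).sub hi
      · filter_upwards with θ
        have := hWle r θ hr
        have hb : 0 ≤ B * (1 + r) ^ 2 := by positivity
        rw [Real.norm_eq_abs]
        rcases abs_cases (W r θ) with h | h <;> linarith
    rw [integral_sub (integrable_const _) hi] at h1
    have h2 : ∫ θ in Set.Ioo (-π) π, (2 * (B * (1 + r) ^ 2)) = 2 * π * (2 * (B * (1 + r) ^ 2)) := by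
      have e5 : (volume : Measure ℝ).real (Set.Ioo (-π) π) = 2 * π := by
        simp [Measure.real]
        rw [ENNReal.toReal_ofReal (by linarith [Real.pi_pos])]; ring
      rw [setIntegral_const, e5, smul_eq_mul]
    rw [h2] at h1
    have h3 : -|L0| ≤ L0 := neg_abs_le _
    have : 2 * π * (-|L0|) ≤ 2 * π * L0 := by gcongr
    have h4 : 2 * π * L0 ≤ ∫ θ in Set.Ioo (-π) π, W r θ := hj
    linarith
  have hGint : Integrable G μ := by
    rw [hμ, integrable_prod_iff hGm.aestronglyMeasurable]
    constructor
    · filter_upwards [self_mem_ae_restrict measurableSet_Ioi] with r hr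
      have hi : Integrable (fun θ => W r θ) (volume.restrict (Set.Ioo (-π) π)) := (circle_facts hg h0 r hr).1
      show Integrable (fun θ => r * (kap r * W r θ)) _
      exact (hi.const_mul (kap r)).const_mul r
    · have hI : Integrable (fun r : ℝ => (9 ^ 4 * 16 * 2 * π * (4 * B + |L0|)) * (1 + r ^ 2)⁻¹) (volume.restrict (Set.Ioi 0)) :=
        (integrable_inv_one_add_sq.const_mul _).integrableOn
      refine Integrable.mono' hI ?_ ?_
      · exact hGm.aestronglyMeasurable.norm.integral_prod_right'
      · filter_upwards [self_mem_ae_restrict measurableSet_Ioi] with r hr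
        have hr : 0 < r := hr
        have hk := kap_nonneg r
        have e : ∫ θ in Set.Ioo (-π) π, ‖G (r, θ)‖ = r * kap r * ∫ θ in Set.Ioo (-π) π, ‖W r θ‖ := by
          rw [← integral_const_mul]
          congr 1
          ext θ
          simp only [hG, norm_mul]
          rw [Real.norm_of_nonneg hr.le, Real.norm_of_nonneg hk]; ring
        rw [e, Real.norm_of_nonneg (mul_nonneg (by positivity) (MeasureTheory.integral_nonneg (fun θ => norm_nonneg (W r θ))))]
        have hkl := kap_le r
        have hL := abs_nonneg L0
        calc _ ≤ r * (9 ^ 4 * 16 / (1 + r ^ 2) ^ 4) * (2 * π * (2 * (B * (1 + r) ^ 2) + |L0|)) := by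
              gcongr
              exact hinner r hr
          _ = 9 ^ 4 * 16 * 2 * π * ((r * (2 * (B * (1 + r) ^ 2) + |L0|)) / (1 + r ^ 2) ^ 4) := by ring
          _ ≤ 9 ^ 4 * 16 * 2 * π * (((1 + r ^ 2) * ((4 * B + |L0|) * (1 + r ^ 2))) / (1 + r ^ 2) ^ 4) := by
              have a1 : r ≤ 1 + r ^ 2 := by nlinarith [sq_nonneg (r - 1)]
              have a2 : 2 * (B * (1 + r) ^ 2) + |L0| ≤ (4 * B + |L0|) * (1 + r ^ 2) := by
                have : (1 + r) ^ 2 ≤ 2 * (1 + r ^ 2) := by nlinarith [sq_nonneg (r - 1)]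
                nlinarith [mul_le_mul_of_nonneg_left this hB0, mul_nonneg hL (sq_nonneg r)]
              gcongr
          _ = 9 ^ 4 * 16 * 2 * π * (4 * B + |L0|) * ((1 + r ^ 2) ^ 2)⁻¹ := by field_simp
          _ ≤ _ := by
              have a3 : 1 + r ^ 2 ≤ (1 + r ^ 2) ^ 2 := by nlinarith [sq_nonneg r, sq_nonneg (r ^ 2)]
              gcongr
  have hVint : Integrable V := by
    refine ⟨hVm.aestronglyMeasurable, ?_⟩
    rw [hasFiniteIntegral_iff_enorm, ← lintegral_comp_polarCoord_symm]
    have := hGint.2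
    rw [hasFiniteIntegral_iff_enorm, ← hμ'] at this
    refine lt_of_le_of_lt (le_of_eq ?_) this
    apply setLIntegral_congr_fun polarCoord.open_target.measurableSet
    intro p hp
    have hr : 0 < p.1 := hp.1
    show ENNReal.ofReal p.1 • ‖V (polarCoord.symm p)‖ₑ = ‖G p‖ₑ
    rw [← hGV p hp, enorm_mul p.1 (V (polarCoord.symm p)), Real.enorm_of_nonneg hr.le, smul_eq_mul]
  refine ⟨hVint, ?_⟩
  -- the comparison
  have e1 : ∫ p, V p = ∫ p, G p ∂μ := by
    rw [← integral_comp_polarCoord_symm, ← hμ']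
    apply setIntegral_congr_fun polarCoord.open_target.measurableSet
    intro p hp
    exact hGV p hp
  have e2 : ∫ p : ℝ × ℝ, kk p.1 p.2 = ∫ p : ℝ × ℝ, p.1 * kap p.1 ∂μ := by
    rw [← integral_comp_polarCoord_symm, ← hμ']
    apply setIntegral_congr_fun polarCoord.open_target.measurableSet
    rintro ⟨r, θ⟩ hp
    have hr : 0 < r := hp.1
    simp only [polarCoord_symm_apply, kk, smul_eq_mul]
    have : (r * Real.cos θ) ^ 2 + (r * Real.sin θ) ^ 2 = r ^ 2 := by
      linear_combination r ^ 2 * Real.sin_sq_add_cos_sq θ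
    rw [this, Real.sqrt_sq hr.le]
  have hkint : Integrable (fun p : ℝ × ℝ => p.1 * kap p.1) μ := by
    have hI : Integrable (fun r : ℝ => (9 ^ 4 * 16) * (1 + r ^ 2)⁻¹) (volume.restrict (Set.Ioi 0)) :=
        (integrable_inv_one_add_sq.const_mul _).integrableOn
    have : Integrable (fun r : ℝ => r * kap r) (volume.restrict (Set.Ioi 0)) := by
      refine Integrable.mono' hI ?_ ?_
      · have := kap_continuous
        exact Continuous.aestronglyMeasurable (by fun_prop)
      · filter_upwards [self_mem_ae_restrict measurableSet_Ioi] with r hr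
        have hr : 0 < r := hr
        have hk := kap_nonneg r
        rw [Real.norm_of_nonneg (by positivity)]
        have a1 : r ≤ 1 + r ^ 2 := by nlinarith [sq_nonneg (r - 1)]
        calc _ ≤ (1 + r ^ 2) * (9 ^ 4 * 16 / (1 + r ^ 2) ^ 4) := by gcongr; exact kap_le r
          _ = 9 ^ 4 * 16 * ((1 + r ^ 2) ^ 3)⁻¹ := by field_simp
          _ ≤ _ := by
            have a3 : 1 + r ^ 2 ≤ (1 + r ^ 2) ^ 3 := by
              nlinarith [sq_nonneg r, sq_nonneg (r ^ 2), mul_nonneg (sq_nonneg r) (sq_nonneg (r^2))]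
            gcongr
    exact this.comp_fst _
  have e3 : Real.log ‖g 0‖ * (∫ p : ℝ × ℝ, p.1 * kap p.1 ∂μ) = ∫ p : ℝ × ℝ, L0 * (p.1 * kap p.1) ∂μ := by
    rw [integral_const_mul]
  rw [e1, e2, e3, hμ, integral_prod _ hGint, integral_prod _ (hkint.const_mul L0)]
  apply integral_mono_ae (hkint.const_mul L0).integral_prod_left hGint.integral_prod_left
  filter_upwards [self_mem_ae_restrict measurableSet_Ioi] with r hr
  have hr : 0 < r := hr
  simp only [hG]
  have e6 : ∫ θ in Set.Ioo (-π) π, r * (kap r * W r θ) = r * (kap r * ∫ θ in Set.Ioo (-π) π, W r θ) := by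
    rw [integral_const_mul, integral_const_mul]
  rw [e6, setIntegral_const]
  have hj := (circle_facts hg h0 r hr).2
  have e5 : (volume : Measure ℝ).real (Set.Ioo (-π) π) = 2 * π := by
    simp [Measure.real]
    rw [ENNReal.toReal_ofReal (by linarith [Real.pi_pos])]; ring
  rw [e5, smul_eq_mul]
  have hk := kap_nonneg r
  calc _ = r * (kap r * (2 * π * L0)) := by ring
    _ ≤ _ := mul_le_mul_of_nonneg_left (mul_le_mul_of_nonneg_left hj hk) hr.le

end Stmt13

namespace Stmt13

open MeasureTheory Filter Topology

/-- total mass of the kernel -/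
noncomputable def m0 : ℝ := ∫ p : ℝ × ℝ, kk p.1 p.2

noncomputable def m2 : ℝ := ∫ p : ℝ × ℝ, kk p.1 p.2 * (1 + p.1 ^ 2 + p.2 ^ 2)

/-- the right half plane -/
def HP : Set (ℝ × ℝ) := Set.Ioi (0:ℝ) ×ˢ Set.univ

lemma measHP : MeasurableSet HP := measurableSet_Ioi.prod MeasurableSet.univ

/-- smoothing weights -/
noncomputable def Fw (lam : ℝ) (n : ℕ) : ℂ :=
  (2 / m0 : ℝ) * ∫ p in HP, (kk p.1 p.2 : ℂ) * Complex.exp (-(((p.1 + p.2 * I) / lam) * Real.log n))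

lemma kk_int0 : Integrable (fun p : ℝ × ℝ => kk p.1 p.2) := by
  have := kk_integrable 0 (by norm_num)
  simpa using this

lemma kk_int2 : Integrable (fun p : ℝ × ℝ => kk p.1 p.2 * (1 + p.1 ^ 2 + p.2 ^ 2)) := by
  have := kk_integrable 2 (by norm_num)
  simpa using this

lemma m0_pos : 0 < m0 := by
  have hk := kk_continuous
  unfold m0
  have hnn : (0 : ℝ × ℝ → ℝ) ≤ fun p => kk p.1 p.2 := by
    intro p; exact kk_nonneg p.1 p.2
  rw [integral_pos_iff_support_of_nonneg hnn kk_int0]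
  apply IsOpen.measure_pos
  · exact hk.isOpen_support
  · refine ⟨(0, 0), ?_⟩
    simp [kk, kap_zero]

lemma m2_nonneg : 0 ≤ m2 := by
  apply MeasureTheory.integral_nonneg
  intro p
  have := kk_nonneg p.1 p.2
  show 0 ≤ kk p.1 p.2 * (1 + p.1 ^ 2 + p.2 ^ 2)
  positivity

lemma kk_neg (v u : ℝ) : kk (-v) u = kk v u := by simp [kk]

/-- reflection formula for integrals -/
lemma int_fold {V : ℝ × ℝ → ℝ} (hV : Integrable V) :
    IntegrableOn (fun p : ℝ × ℝ => V (-p.1, p.2)) HP ∧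
    ∫ p, V p = ∫ p in HP, V p + V (-p.1, p.2) := by
  set e : ℝ × ℝ ≃ᵐ ℝ × ℝ := (MeasurableEquiv.neg ℝ).prodCongr (MeasurableEquiv.refl ℝ) with he
  have hmp : MeasurePreserving e := by
    have := (Measure.measurePreserving_neg (volume : Measure ℝ)).prod (MeasurePreserving.id (volume : Measure ℝ))
    exact this
  have hcomp : Integrable (fun p : ℝ × ℝ => V (-p.1, p.2)) :=
    (hmp.integrable_comp_emb e.measurableEmbedding).2 hV
  refine ⟨hcomp.integrableOn, ?_⟩
  have h1 : ∫ p in HP, V (-p.1, p.2) = ∫ p in HPᶜ, V p := by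
    have h2 : ∫ p in e ⁻¹' (e ⁻¹' HP), V (e p) = ∫ p in e ⁻¹' HP, V p :=
      hmp.setIntegral_preimage_emb e.measurableEmbedding V _
    have h3 : e ⁻¹' (e ⁻¹' HP) = HP := by
      ext p
      show 0 < - - p.1 ∧ True ↔ 0 < p.1 ∧ True
      rw [neg_neg]
    rw [h3] at h2
    have h4 : ∫ p in HP, V (-p.1, p.2) = ∫ p in HP, V (e p) := rfl
    rw [h4, h2]
    apply setIntegral_congr_set
    have hz : ∀ᵐ p : ℝ × ℝ, p.1 ≠ 0 := by
      have : (volume : Measure (ℝ × ℝ)) (({0} : Set ℝ) ×ˢ Set.univ) = 0 := by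
        rw [Measure.volume_eq_prod, Measure.prod_prod]; simp
      rw [ae_iff]
      convert this using 2
      ext p; simp
    filter_upwards [hz] with p hp
    apply propext
    show (e p ∈ HP) ↔ ¬ (p ∈ HP)
    simp only [HP, Set.mem_prod, Set.mem_Ioi, Set.mem_univ, and_true, not_lt]
    show 0 < -p.1 ↔ _
    constructor
    · intro h; linarith
    · intro h; exact neg_pos.2 (lt_of_le_of_ne h hp)
  rw [integral_add hV.integrableOn hcomp.integrableOn, h1, integral_add_compl measHP hV]

lemma kk_half : ∫ p in HP, kk p.1 p.2 = m0 / 2 := by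
  have h := (int_fold kk_int0).2
  simp only [kk_neg] at h
  rw [integral_add kk_int0.integrableOn kk_int0.integrableOn] at h
  rw [m0, h]; ring

lemma exp_weight_norm_le (lam : ℝ) (hl : 0 < lam) (n : ℕ) (p : ℝ × ℝ) (hp : p ∈ HP) :
    ‖Complex.exp (-(((p.1 + p.2 * I) / lam) * Real.log n))‖ ≤ 1 := by
  rw [Complex.norm_exp]
  apply Real.exp_le_one_iff.2
  have : (-(((p.1 + p.2 * I) / lam) * Real.log n) : ℂ).re = - (p.1 / lam * Real.log n) := by
    rw [Complex.neg_re, Complex.re_mul_ofReal, Complex.div_ofReal_re]; simp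
  rw [this]
  have h1 : 0 < p.1 := hp.1
  have h2 := Real.log_natCast_nonneg n
  have : 0 ≤ p.1 / lam * Real.log n := by positivity
  linarith

lemma weight_int (lam : ℝ) (hl : 0 < lam) (n : ℕ) :
    IntegrableOn (fun p : ℝ × ℝ => (kk p.1 p.2 : ℂ) * Complex.exp (-(((p.1 + p.2 * I) / lam) * Real.log n))) HP := by
  refine Integrable.mono' kk_int0.integrableOn ?_ ?_
  · have := kk_continuous
    exact Continuous.aestronglyMeasurable (by fun_prop)
  · filter_upwards [self_mem_ae_restrict measHP] with p hp
    rw [norm_mul, Complex.norm_real, Real.norm_of_nonneg (kk_nonneg _ _)]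
    exact mul_le_of_le_one_right (kk_nonneg _ _) (exp_weight_norm_le lam hl n p hp)

lemma Fw_norm_le (lam : ℝ) (hl : 0 < lam) (n : ℕ) : ‖Fw lam n‖ ≤ 1 := by
  have hm := m0_pos
  rw [Fw, norm_mul, Complex.norm_real, Real.norm_of_nonneg (by positivity)]
  have : ‖∫ p in HP, (kk p.1 p.2 : ℂ) * Complex.exp (-(((p.1 + p.2 * I) / lam) * Real.log n))‖ ≤ m0 / 2 := by
    rw [← kk_half]
    apply norm_integral_le_of_norm_le kk_int0.integrableOn
    filter_upwards [self_mem_ae_restrict measHP] with p hp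
    rw [norm_mul, Complex.norm_real, Real.norm_of_nonneg (kk_nonneg _ _)]
    exact mul_le_of_le_one_right (kk_nonneg _ _) (exp_weight_norm_le lam hl n p hp)
  calc _ ≤ 2 / m0 * (m0 / 2) := by gcongr
    _ = 1 := by field_simp

lemma ae_ne_zero {g : ℂ → ℂ} (hg : Differentiable ℂ g) (h0 : g 0 ≠ 0) :
    ∀ᵐ p : ℝ × ℝ, g (p.1 + p.2 * I) ≠ 0 := by
  have hA : AnalyticOnNhd ℂ g Set.univ := fun z _ => hg.analyticAt z
  have h1 := hA.preimage_zero_mem_codiscrete h0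
  have h2 : ∀ᵐ z : ℂ, g z ≠ 0 := by
    have := ae_restrict_le_codiscreteWithin (μ := (volume : Measure ℂ)) MeasurableSet.univ h1
    rw [Measure.restrict_univ] at this
    filter_upwards [this] with z hz
    exact hz
  have h3 := Complex.volume_preserving_equiv_real_prod.symm.quasiMeasurePreserving.ae h2
  filter_upwards [h3] with p hp
  convert hp using 2
  simp [Complex.measurableEquivRealProd]
  apply Complex.ext <;> simp

end Stmt13

namespace Stmt13

open MeasureTheory Filter Topology

lemma logQ_ge {Q t : ℝ} (hQ : 2 ≤ Q) : 1 ≤ Real.log (Q * (2 + |t|)) := by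
  have h4 : Real.exp 1 ≤ Q * (2 + |t|) := by
    have := Real.exp_one_lt_d9
    nlinarith [abs_nonneg t]
  rw [Real.le_log_iff_exp_le (by nlinarith [abs_nonneg t])]
  exact h4

lemma lam_ge {N : ℕ} (hN : 2 ≤ N) {lam : ℝ} (hlam : 8 * lam = Real.log (N - 1/2)) : 1 / 24 ≤ lam := by
  have h2 : (2:ℝ) ≤ N := by exact_mod_cast hN
  have : Real.log (3/2) ≤ Real.log (N - 1/2) := Real.log_le_log (by norm_num) (by linarith)
  have h3 : 1 / 3 ≤ Real.log (3/2) := by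
    have := Real.one_sub_inv_le_log_of_pos (show (0:ℝ) < 3/2 by norm_num)
    norm_num at this ⊢
    linarith
  linarith

lemma refl_log {f : ℂ → ℂ} {Q : ℝ} {c : ℕ → ℂ} (h : KH f Q c) (t lam v u : ℝ) (hlam : 1 / 24 ≤ lam) (hv : 0 ≤ v)
    (hne : f (1/2 + t * I + (((-v:ℝ):ℂ) + u * I) / lam) ≠ 0) :
    Real.log ‖f (1/2 + t * I + (((-v:ℝ):ℂ) + u * I) / lam)‖ ≤ Real.log ‖f (1/2 + t * I + ((v:ℂ) + u * I) / lam)‖ +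
      v / lam * (Real.log (Q * (2 + |t|)) * (3 + 24 * (v + |u|))) := by
  have hQ := h.hQ
  have hl0 : 0 < lam := by linarith
  have hr := h.refl (v / lam) (t + u / lam) (by positivity)
  have e1 : (((1/2 - v / lam : ℝ) : ℂ) + ((t + u / lam : ℝ) : ℂ) * I) = 1/2 + t * I + (((-v:ℝ):ℂ) + u * I) / lam := by
    push_cast; ring
  have e2 : (((1/2 + v / lam : ℝ) : ℂ) + ((t + u / lam : ℝ) : ℂ) * I) = 1/2 + t * I + ((v:ℂ) + u * I) / lam := by
    push_cast; ring
  rw [e1, e2] at hr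
  have hpos := norm_pos_iff.2 hne
  have hb : 0 < Q * (Real.exp 2 * (2 + v / lam + |t + u / lam|)) := by positivity
  have hne2 : ‖f (1/2 + t * I + ((v:ℂ) + u * I) / lam)‖ ≠ 0 := by
    intro h0
    rw [h0, zero_mul] at hr; linarith
  have h1 := Real.log_le_log hpos hr
  rw [Real.log_mul hne2 (Real.rpow_pos_of_pos hb _).ne', Real.log_rpow hb] at h1
  have h2 : Real.log (Q * (Real.exp 2 * (2 + v / lam + |t + u / lam|))) ≤
      Real.log (Q * (2 + |t|)) * (3 + 24 * (v + |u|)) := by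
    have hL := logQ_ge (t := t) hQ
    have hi : 1 / lam ≤ 24 := by rw [div_le_iff₀ hl0]; linarith
    have a1 : v / lam ≤ 24 * v := by
      rw [div_eq_mul_one_div, mul_comm]; gcongr
    have a2 : |t + u / lam| ≤ |t| + 24 * |u| := by
      calc _ ≤ |t| + |u / lam| := abs_add_le _ _
        _ = |t| + 1 / lam * |u| := by rw [abs_div, abs_of_pos hl0]; ring
        _ ≤ _ := by gcongr
    have a3 : 2 + v / lam + |t + u / lam| ≤ (2 + |t|) * Real.exp (24 * (v + |u|)) := by
      have := Real.add_one_le_exp (24 * (v + |u|))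
      have hu := abs_nonneg u
      have ht := abs_nonneg t
      calc _ ≤ 2 + |t| + 24 * (v + |u|) := by linarith
        _ ≤ (2 + |t|) * (24 * (v + |u|) + 1) := by nlinarith [mul_nonneg ht (add_nonneg hv hu)]
        _ ≤ _ := by gcongr
    calc _ ≤ Real.log (Q * (Real.exp 2 * ((2 + |t|) * Real.exp (24 * (v + |u|))))) := by
          apply Real.log_le_log hb; gcongr
      _ = Real.log (Q * (2 + |t|)) + (2 + 24 * (v + |u|)) := by
          rw [show Q * (Real.exp 2 * ((2 + |t|) * Real.exp (24 * (v + |u|)))) = (Q * (2 + |t|)) * Real.exp (2 + 24 * (v + |u|)) by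
            rw [Real.exp_add]; ring]
          rw [Real.log_mul (by positivity) (by positivity), Real.log_exp]
      _ ≤ _ := by
          have : 0 ≤ 2 + 24 * (v + |u|) := by positivity
          nlinarith [mul_le_mul_of_nonneg_right hL this]
  have : v / lam * Real.log (Q * (Real.exp 2 * (2 + v / lam + |t + u / lam|))) ≤
     v / lam * (Real.log (Q * (2 + |t|)) * (3 + 24 * (v + |u|))) := by gcongr
  linarith

lemma log_upper {f : ℂ → ℂ} {Q : ℝ} {c : ℕ → ℂ} (h : KH f Q c) (t lam : ℝ) (hlam : 1 / 24 ≤ lam) :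
    ∃ B, 0 ≤ B ∧ ∀ z : ℂ, Real.log ‖f (1/2 + t * I + z / lam)‖ ≤ B * (1 + ‖z‖) ^ 2 := by
  have hQ := h.hQ
  have hl0 : 0 < lam := by linarith
  have hL := logQ_ge (t := t) hQ
  have hi : 1 / lam ≤ 24 := by rw [div_le_iff₀ hl0]; linarith
  have pos : ∀ z : ℂ, 0 ≤ z.re → Real.log ‖f (1/2 + t * I + z / lam)‖ ≤ 2 * Q * (1 + |t| + 24) * (1 + ‖z‖) := by
    intro z hz
    have hre : (1/2 + t * I + z / lam).re = 1/2 + z.re / lam := by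
      simp [Complex.div_ofReal_re]
    have h1 := h.growth (1/2 + t * I + z / lam) (by rw [hre]; have : 0 ≤ z.re / lam := by positivity
                                                    linarith)
    have h2 : ‖(1/2 + t * I + z / lam : ℂ)‖ ≤ 1 + |t| + 24 * ‖z‖ := by
      calc _ ≤ ‖(1/2 : ℂ)‖ + ‖(t * I : ℂ)‖ + ‖z / lam‖ := norm_add₃_le
        _ = 1/2 + |t| + 1 / lam * ‖z‖ := by
            rw [norm_div z, Complex.norm_real, Real.norm_of_nonneg hl0.le]
            simp; ring
        _ ≤ 1 + |t| + 24 * ‖z‖ := by gcongr; norm_num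
    have h3 := Real.log_le_self (norm_nonneg (f (1/2 + t * I + z / lam)))
    have hz0 := norm_nonneg z
    calc _ ≤ 2 * Q * (1 + |t| + 24 * ‖z‖) := h3.trans (h1.trans (by gcongr))
      _ ≤ 2 * Q * ((1 + |t| + 24) * (1 + ‖z‖)) := by
          gcongr
          nlinarith [mul_nonneg (abs_nonneg t) hz0]
      _ = _ := by ring
  refine ⟨2 * Q * (1 + |t| + 24) + 24 * (Real.log (Q * (2 + |t|)) * 48), by positivity, ?_⟩
  intro z
  have hz0 := norm_nonneg z
  have hsq : 1 + ‖z‖ ≤ (1 + ‖z‖) ^ 2 := by nlinarith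
  rcases le_or_gt 0 z.re with hz | hz
  · calc _ ≤ 2 * Q * (1 + |t| + 24) * (1 + ‖z‖) := pos z hz
      _ ≤ (2 * Q * (1 + |t| + 24) + 24 * (Real.log (Q * (2 + |t|)) * 48)) * (1 + ‖z‖) ^ 2 := by
          gcongr
          have : 0 ≤ 24 * (Real.log (Q * (2 + |t|)) * 48) := by positivity
          linarith
  · by_cases hne : f (1/2 + t * I + z / lam) = 0
    · rw [hne]; simp; positivity
    · have ez : z = (((-(-z.re) : ℝ) : ℂ) + z.im * I) := by
        rw [neg_neg]; exact (Complex.re_add_im z).symm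
      have hne' := hne
      rw [ez] at hne'
      have h1 := refl_log h t lam (-z.re) z.im hlam (by linarith) hne'
      rw [← ez] at h1
      have h2 := pos (((-z.re : ℝ) : ℂ) + z.im * I) (by simp; linarith)
      have e3 : ‖(((-z.re : ℝ) : ℂ) + z.im * I)‖ = ‖z‖ := by
        rw [Complex.norm_eq_sqrt_sq_add_sq, Complex.norm_eq_sqrt_sq_add_sq]; simp
      rw [e3] at h2
      have a1 : -z.re ≤ ‖z‖ := (neg_le_abs _).trans (Complex.abs_re_le_norm z)
      have a2 : |z.im| ≤ ‖z‖ := Complex.abs_im_le_norm z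
      have h3 : -z.re / lam * (Real.log (Q * (2 + |t|)) * (3 + 24 * (-z.re + |z.im|))) ≤
          24 * (Real.log (Q * (2 + |t|)) * 48) * (1 + ‖z‖) ^ 2 := by
        calc _ = (1 / lam * -z.re) * (Real.log (Q * (2 + |t|)) * (3 + 24 * (-z.re + |z.im|))) := by ring
          _ ≤ (24 * (1 + ‖z‖)) * (Real.log (Q * (2 + |t|)) * (48 * (1 + ‖z‖))) := by
              have : 0 ≤ -z.re + |z.im| := by have := abs_nonneg z.im; linarith
              gcongr
              · linarith
              · linarith
              · linarith
          _ = _ := by ring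
      calc _ ≤ _ := h1
        _ ≤ 2 * Q * (1 + |t| + 24) * (1 + ‖z‖) ^ 2 + 24 * (Real.log (Q * (2 + |t|)) * 48) * (1 + ‖z‖) ^ 2 := by
            refine add_le_add (h2.trans ?_) h3
            gcongr
        _ = _ := by ring

lemma term_shift (c : ℕ → ℂ) (s w : ℂ) (n : ℕ) :
    LSeries.term c (s + w) n = LSeries.term c s n * Complex.exp (-(w * Real.log n)) := by
  rcases eq_or_ne n 0 with rfl | hn
  · simp
  · have hn' : (n:ℂ) ≠ 0 := by exact_mod_cast hn
    rw [LSeries.term_of_ne_zero hn, LSeries.term_of_ne_zero hn, Complex.cpow_add _ _ hn',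
      Complex.exp_neg, Complex.cpow_def_of_ne_zero hn' w, Complex.ofReal_log (by positivity), Complex.ofReal_natCast,
      mul_comm w, ← div_div, div_eq_mul_inv (c n / _)]

lemma half_line {f : ℂ → ℂ} {Q : ℝ} {c : ℕ → ℂ} (h : KH f Q c) {l : ℂ → ℂ}
    (hl : DifferentiableOn ℂ l {s : ℂ | 1 / 2 < s.re})
    (hle : ∀ s : ℂ, 1 / 2 < s.re → Complex.exp (l s) = f s) (hls : ∀ s : ℂ, 1 < s.re → l s = LSeries c s)
    (N : ℕ) (hN : 2 ≤ N) (lam : ℝ) (hlam : 8 * lam = Real.log (N - 1/2)) (t : ℝ) :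
    ‖f (1/2 + t * I)‖ ≤ Real.exp ((∑ n ∈ range N, Fw lam n * LSeries.term c (1/2 + t * I) n).re +
      (51 * m2 / m0) * (Real.log (Q * (2 + |t|)) / lam)) := by
  have hQ := h.hQ
  have hlam' := lam_ge hN hlam
  have hl0 : 0 < lam := by linarith
  have hm0 := m0_pos
  have hL := logQ_ge (t := t) hQ
  set Lq := Real.log (Q * (2 + |t|)) with hLq
  by_cases hne : f (1/2 + t * I) = 0
  · rw [hne, norm_zero]; positivity
  set g : ℂ → ℂ := fun z => f (1/2 + t * I + z / lam) with hg
  have hgd : Differentiable ℂ g := by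
    have := h.diff
    exact this.comp (by fun_prop)
  have hg0 : g 0 = f (1/2 + t * I) := by simp [hg]
  have hg0' : g 0 ≠ 0 := by rw [hg0]; exact hne
  obtain ⟨B, hB0, hB⟩ := log_upper h t lam hlam'
  obtain ⟨hVi, hJ⟩ := jensen_plane hgd hg0' B hB0 hB
  set V : ℝ × ℝ → ℝ := fun p => kk p.1 p.2 * Real.log ‖g (p.1 + p.2 * I)‖ with hV
  obtain ⟨hVr, hVf⟩ := int_fold hVi
  set T0 : ℂ := ∑ n ∈ range N, Fw lam n * LSeries.term c (1/2 + t * I) n with hT0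
  set D : ℝ × ℝ → ℂ := fun p => ∑ n ∈ range N, LSeries.term c (1/2 + t * I + (p.1 + p.2 * I) / lam) n with hD
  -- the folded bound
  have hfold : ∫ p in HP, V p + V (-p.1, p.2) ≤ ∫ p in HP, (2 * V p + (51 * (Lq / lam)) * (kk p.1 p.2 * (1 + p.1 ^ 2 + p.2 ^ 2))) := by
    apply integral_mono_ae (hVi.integrableOn.add hVr)
    · exact (hVi.integrableOn.const_mul 2).add (kk_int2.integrableOn.const_mul _)
    · have hz := ae_ne_zero (g := fun z => g (- z)) (hgd.comp differentiable_neg) (by simpa using hg0')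
      have hz2 : ∀ᵐ p : ℝ × ℝ, g (((-p.1 : ℝ) : ℂ) + p.2 * I) ≠ 0 := by
        have hmp : MeasurePreserving (fun p : ℝ × ℝ => (p.1, -p.2)) := by
          exact (MeasurePreserving.id (volume : Measure ℝ)).prod (Measure.measurePreserving_neg (volume : Measure ℝ))
        have := hmp.quasiMeasurePreserving.ae hz
        filter_upwards [this] with p hp
        convert hp using 2
        push_cast; ring
      filter_upwards [self_mem_ae_restrict measHP, ae_restrict_of_ae hz2] with p hp hp2
      have hp1 : 0 < p.1 := hp.1
      have h1 := refl_log h t lam p.1 p.2 hlam' hp1.le hp2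
      have h2 : V (-p.1, p.2) ≤ V p + kk p.1 p.2 * (p.1 / lam * (Lq * (3 + 24 * (p.1 + |p.2|)))) := by
        simp only [hV, kk_neg]
        rw [← mul_add]
        exact mul_le_mul_of_nonneg_left h1 (kk_nonneg _ _)
      have h3 : p.1 / lam * (Lq * (3 + 24 * (p.1 + |p.2|))) ≤ 51 * (Lq / lam) * (1 + p.1 ^ 2 + p.2 ^ 2) := by
        have : p.1 * (3 + 24 * (p.1 + |p.2|)) ≤ 51 * (1 + p.1 ^ 2 + p.2 ^ 2) := by
          rw [← sq_abs p.2]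
          nlinarith [sq_nonneg (p.1 - |p.2|), sq_nonneg (p.1 - 1), abs_nonneg p.2]
        calc _ = (Lq / lam) * (p.1 * (3 + 24 * (p.1 + |p.2|))) := by ring
          _ ≤ (Lq / lam) * (51 * (1 + p.1 ^ 2 + p.2 ^ 2)) := by gcongr
          _ = _ := by ring
      have h4 := mul_le_mul_of_nonneg_left h3 (kk_nonneg p.1 p.2)
      show V p + V (-p.1, p.2) ≤ 2 * V p + (51 * (Lq / lam)) * (kk p.1 p.2 * (1 + p.1 ^ 2 + p.2 ^ 2))
      nlinarith
  have hm2 : ∫ p in HP, kk p.1 p.2 * (1 + p.1 ^ 2 + p.2 ^ 2) ≤ m2 := by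
    apply setIntegral_le_integral kk_int2
    filter_upwards with p
    have := kk_nonneg p.1 p.2
    show 0 ≤ kk p.1 p.2 * (1 + p.1 ^ 2 + p.2 ^ 2)
    positivity
  -- replace by the Dirichlet polynomial
  have hDc : Continuous D := by
    apply continuous_finsetSum
    intro n _
    exact (term_differentiable c n).continuous.comp (by fun_prop)
  have hDb : ∀ p ∈ HP, ‖D p‖ ≤ N := by
    intro p hp
    calc _ ≤ ∑ n ∈ range N, (1:ℝ) := by
          apply norm_sum_le_of_le
          intro n _
          apply norm_term_le_one h.hc
          have hp1 : 0 < p.1 := hp.1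
          have : ((1/2 + t * I + (p.1 + p.2 * I) / lam) : ℂ).re = 1/2 + p.1 / lam := by
            simp [Complex.div_ofReal_re]
          rw [this]; positivity
      _ = N := by simp
  have hkDi : IntegrableOn (fun p : ℝ × ℝ => (kk p.1 p.2 : ℂ) * D p) HP := by
    refine Integrable.mono' (kk_int0.integrableOn.mul_const (N:ℝ)) ?_ ?_
    · have := kk_continuous
      exact Continuous.aestronglyMeasurable (by fun_prop)
    · filter_upwards [self_mem_ae_restrict measHP] with p hp
      rw [norm_mul, Complex.norm_real, Real.norm_of_nonneg (kk_nonneg _ _)]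
      exact mul_le_mul_of_nonneg_left (hDb p hp) (kk_nonneg _ _)
  have hkDr : IntegrableOn (fun p : ℝ × ℝ => ((kk p.1 p.2 : ℂ) * D p).re) HP := hkDi.re
  have hsub : ∫ p in HP, (V p - ((kk p.1 p.2 : ℂ) * D p).re) = 0 := by
    have hi : IntegrableOn (fun p : ℝ × ℝ => V p - ((kk p.1 p.2 : ℂ) * D p).re) HP := hVi.integrableOn.sub hkDr
    rw [HP, Measure.volume_eq_prod, setIntegral_prod _ hi]
    rw [setIntegral_congr_fun (g := fun _ => (0:ℝ)) measurableSet_Ioi]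
    · simp
    intro v hv
    have hv : 0 < v := hv
    obtain ⟨b1, b2⟩ := bandlimit h hl hle hls N hN lam hl0 hlam t v hv
    simp only [Measure.restrict_univ]
    have := congrArg Complex.re b2
    rw [← RCLike.re_eq_complex_re, ← integral_re b1] at this
    simp only [map_zero] at this
    rw [← this]
    congr 1
    ext u
    have hre : 1 / 2 < (1/2 + t * I + ((v:ℂ) + u * I) / lam).re := by
      have : (1/2 + t * I + ((v:ℂ) + u * I) / lam).re = 1/2 + v / lam := by simp [Complex.div_ofReal_re]
      rw [this]
      have : 0 < v / lam := by positivity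
      linarith
    have e1 : Real.log ‖g ((v:ℂ) + u * I)‖ = (l (1/2 + t * I + ((v:ℂ) + u * I) / lam)).re := by
      simp only [hg]
      rw [← hle _ hre, Complex.norm_exp, Real.log_exp]
    simp only [hV, hD]
    rw [e1, RCLike.re_eq_complex_re, Complex.re_ofReal_mul, Complex.re_ofReal_mul, Complex.sub_re]
    ring
  have hVD : ∫ p in HP, V p = (∫ p in HP, (kk p.1 p.2 : ℂ) * D p).re := by
    rw [integral_sub hVi.integrableOn hkDr] at hsub
    have : (∫ p in HP, (kk p.1 p.2 : ℂ) * D p).re = ∫ p in HP, ((kk p.1 p.2 : ℂ) * D p).re := by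
      rw [← RCLike.re_eq_complex_re, ← integral_re hkDi]
    rw [this]; linarith
  have hDT : ((2 / m0 : ℝ) : ℂ) * ∫ p in HP, (kk p.1 p.2 : ℂ) * D p = T0 := by
    have e1 : ∀ p : ℝ × ℝ, (kk p.1 p.2 : ℂ) * D p = ∑ n ∈ range N, LSeries.term c (1/2 + t * I) n *
        ((kk p.1 p.2 : ℂ) * Complex.exp (-(((p.1 + p.2 * I) / lam) * Real.log n))) := by
      intro p
      simp only [hD, mul_sum]
      apply sum_congr rfl
      intro n _
      rw [term_shift]; ring
    simp only [e1]
    rw [integral_finsetSum _ (fun n _ => (weight_int lam hl0 n).const_mul _), hT0, mul_sum]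
    apply sum_congr rfl
    intro n _
    rw [integral_const_mul, Fw]; ring
  have hT0re : T0.re = 2 / m0 * ∫ p in HP, V p := by
    rw [← hDT, Complex.re_ofReal_mul, hVD]
  have hfin : Real.log ‖g 0‖ * m0 ≤ 2 * (∫ p in HP, V p) + 51 * (Lq / lam) * m2 := by
    rw [integral_add (hVi.integrableOn.const_mul 2) (kk_int2.integrableOn.const_mul _), integral_const_mul, integral_const_mul] at hfold
    have : 51 * (Lq / lam) * (∫ p in HP, kk p.1 p.2 * (1 + p.1 ^ 2 + p.2 ^ 2)) ≤ 51 * (Lq / lam) * m2 := by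
      gcongr
    have h5 : Real.log ‖g 0‖ * m0 ≤ ∫ p, V p := hJ
    linarith
  have hlog : Real.log ‖f (1/2 + t * I)‖ ≤ T0.re + (51 * m2 / m0) * (Lq / lam) := by
    rw [← hg0, hT0re]
    rw [← le_div_iff₀ hm0] at hfin
    calc _ ≤ _ := hfin
      _ = _ := by field_simp
  rw [← Real.log_le_iff_le_exp (norm_pos_iff.2 hne)]
  exact hlog

end Stmt13

namespace Stmt13

open MeasureTheory Filter Topology

lemma pl_step {f : ℂ → ℂ} {Q : ℝ} {c : ℕ → ℂ} (h : KH f Q c) (N : ℕ) (w : ℕ → ℂ) (hw : ∀ n, ‖w n‖ ≤ 1)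
    (e : ℝ) (he : 0 ≤ e)
    (H : ∀ t : ℝ, ‖f (1/2 + t * I)‖ ≤ Real.exp ((∑ n ∈ range N, w n * LSeries.term c (1/2 + t * I) n).re +
      e * Real.log (Q * (2 + |t|))))
    (s : ℂ) (hs : 1 / 2 ≤ s.re) :
    ‖f s‖ ≤ Real.exp ((∑ n ∈ range N, w n * LSeries.term c s n).re + e * Real.log (Q * (2 * ‖s + 3 / 2‖))) := by
  have hQ := h.hQ
  set D : ℂ → ℂ := fun s => ∑ n ∈ range N, w n * LSeries.term c s n with hD
  have hDd : Differentiable ℂ D := by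
    intro z
    apply DifferentiableAt.fun_sum
    intro n _
    exact ((term_differentiable c n) z).const_mul _
  have hDb : ∀ s : ℂ, 0 ≤ s.re → ‖D s‖ ≤ N := by
    intro s hs
    calc _ ≤ ∑ n ∈ range N, (1:ℝ) := by
          apply norm_sum_le_of_le
          intro n _
          rw [norm_mul]
          exact mul_le_one₀ (hw n) (norm_nonneg _) (norm_term_le_one h.hc s hs n)
      _ = N := by simp
  set g : ℂ → ℂ := fun z => f (1/2 + z) * Complex.exp (- D (1/2 + z)) * (Q * (2 * (z + 2)) : ℂ) ^ ((-e : ℝ) : ℂ) with hg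
  have hslit : ∀ z : ℂ, -2 < z.re → (Q * (2 * (z + 2)) : ℂ) ∈ Complex.slitPlane := by
    intro z hz
    left
    have : (Q * (2 * (z + 2)) : ℂ).re = Q * (2 * (z.re + 2)) := by
      rw [Complex.re_ofReal_mul]; simp
    rw [this]
    have : 0 < z.re + 2 := by linarith
    positivity
  have hgd : ∀ z : ℂ, -2 < z.re → DifferentiableAt ℂ g z := by
    intro z hz
    apply DifferentiableAt.mul
    · apply DifferentiableAt.mul
      · exact (h.diff _).comp z (by fun_prop)
      · apply DifferentiableAt.cexp
        apply DifferentiableAt.neg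
        exact (hDd _).comp z (by fun_prop)
    · apply DifferentiableAt.cpow_const (by fun_prop)
      exact hslit z hz
  have hnorm : ∀ z : ℂ, 0 ≤ z.re → ‖g z‖ = ‖f (1/2 + z)‖ * Real.exp (-(D (1/2 + z)).re) * (Q * (2 * ‖z + 2‖)) ^ (-e) := by
    intro z hz
    simp only [hg, norm_mul, Complex.norm_exp, Complex.norm_cpow_real, Complex.neg_re]
    rw [Complex.norm_real, Real.norm_of_nonneg (by linarith)]; simp
  have hz2 : ∀ z : ℂ, 0 ≤ z.re → 2 ≤ ‖z + 2‖ := by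
    intro z hz
    have := Complex.re_le_norm (z + 2)
    simp at this; linarith
  have hpw : ∀ z : ℂ, 0 ≤ z.re → (Q * (2 * ‖z + 2‖)) ^ (-e) ≤ 1 := by
    intro z hz
    apply Real.rpow_le_one_of_one_le_of_nonpos _ (by linarith)
    nlinarith [hz2 z hz]
  have hex : ∀ z : ℂ, 0 ≤ z.re → Real.exp (-(D (1/2 + z)).re) ≤ Real.exp N := by
    intro z hz
    apply Real.exp_le_exp.2
    have h1 := hDb (1/2 + z) (by simp; linarith)
    have := (neg_le_abs _).trans (Complex.abs_re_le_norm (D (1/2+z)))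
    linarith
  have hgb : ∀ z : ℂ, 0 ≤ z.re → ‖g z‖ ≤ ‖f (1/2 + z)‖ * Real.exp N := by
    intro z hz
    rw [hnorm z hz]
    calc _ ≤ ‖f (1/2 + z)‖ * Real.exp N * 1 := by
          gcongr
          · exact Real.exp_le_exp.1 (hex z hz)
          · exact hpw z hz
      _ = _ := mul_one _
  have him : ∀ t : ℝ, ‖g (t * I)‖ ≤ 1 := by
    intro t
    rw [hnorm _ (by simp)]
    have h1 := H t
    have h2 : 2 + |t| ≤ 2 * ‖(t * I + 2 : ℂ)‖ := by
      have a := Complex.abs_re_le_norm (t * I + 2 : ℂ)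
      have b := Complex.abs_im_le_norm (t * I + 2 : ℂ)
      simp at a b
      linarith
    have h3 : 0 < Q * (2 + |t|) := by positivity
    have h4 : (Q * (2 * ‖(t * I + 2 : ℂ)‖)) ^ (-e) ≤ (Q * (2 + |t|)) ^ (-e) :=
      Real.rpow_le_rpow_of_nonpos h3 (by gcongr) (by linarith)
    calc _ ≤ Real.exp ((D (1/2 + t * I)).re + e * Real.log (Q * (2 + |t|))) * Real.exp (-(D (1/2 + t * I)).re) * (Q * (2 + |t|)) ^ (-e) := by
          gcongr
      _ = 1 := by
          rw [Real.rpow_def_of_pos h3, ← Real.exp_add, ← Real.exp_add]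
          rw [Real.exp_eq_one_iff]; ring
  have hmain : ‖g (s - 1/2)‖ ≤ 1 := by
    apply PhragmenLindelof.right_half_plane_of_bounded_on_real (f := g) (C := 1)
    · have hcl : closure {z : ℂ | 0 < z.re} = {z : ℂ | 0 ≤ z.re} := by
        exact Complex.closure_setOfPred_lt_re 0
      refine DifferentiableOn.diffContOnCl ?_
      rw [hcl]
      intro z hz
      have hz : 0 ≤ z.re := hz
      exact (hgd z (by linarith)).differentiableWithinAt
    · refine ⟨1, by norm_num, 1, ?_⟩
      apply Asymptotics.IsBigO.of_bound (2 * Q * Real.exp N)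
      rw [eventually_inf_principal]
      filter_upwards with z hz
      have hz : 0 < z.re := hz
      have h1 := h.growth (1/2 + z) (by simp; linarith)
      have h2 : ‖(1/2 + z : ℂ)‖ ≤ Real.exp (1 * ‖z‖ ^ (1:ℝ)) := by
        rw [Real.rpow_one, one_mul]
        have := Real.add_one_le_exp ‖z‖
        calc _ ≤ ‖(1/2 : ℂ)‖ + ‖z‖ := norm_add_le _ _
          _ ≤ _ := by norm_num; linarith
      rw [Real.norm_of_nonneg (Real.exp_pos _).le]
      calc _ ≤ _ := hgb z hz.le
        _ ≤ (2 * Q * Real.exp (1 * ‖z‖ ^ (1:ℝ))) * Real.exp N := by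
            gcongr
            exact h1.trans (by gcongr)
        _ = _ := by ring
    · refine ⟨Real.exp 2 * Real.exp N, ?_⟩
      rw [eventually_map]
      filter_upwards [eventually_ge_atTop 2] with x hx
      refine (hgb x (by simp; linarith)).trans ?_
      gcongr
      have hre : (1/2 + (x:ℂ)).re = 1/2 + x := by simp
      rw [h.euler _ (by rw [hre]; linarith), Complex.norm_exp]
      apply Real.exp_le_exp.2
      have := LSeries_tail h.hc 1 one_pos (1/2 + x) (by rw [hre]; linarith)
      rw [range_one, sum_singleton, LSeries.term_zero, sub_zero, Nat.cast_one, Real.one_rpow, mul_one] at this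
      exact (Complex.re_le_norm _).trans this
    · exact him
    · simp; linarith
  rw [hnorm _ (by simp; linarith)] at hmain
  have e1 : (1/2 + (s - 1/2) : ℂ) = s := by ring
  have e2 : (s - 1/2 + 2 : ℂ) = s + 3/2 := by ring
  rw [e1, e2] at hmain
  have hp : 0 < Q * (2 * ‖s + 3/2‖) := by
    have := hz2 (s - 1/2) (by simp; linarith)
    rw [e2] at this
    positivity
  rw [Real.rpow_def_of_pos hp, mul_assoc, ← Real.exp_add] at hmain
  rw [← le_div_iff₀ (Real.exp_pos _), one_div, ← Real.exp_neg] at hmain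
  refine hmain.trans (le_of_eq ?_)
  congr 1
  ring

theorem key_ineq : ∃ K : ℝ, 0 < K ∧ ∃ F : ℕ → ℕ → ℂ, (∀ N n, ‖F N n‖ ≤ 1) ∧
    ∀ (f : ℂ → ℂ) (Q : ℝ) (c : ℕ → ℂ), KH f Q c → ∀ N : ℕ, 2 ≤ N → ∀ s : ℂ, 1 / 2 ≤ s.re →
    ‖f s‖ ≤ Real.exp ((∑ n ∈ range N, F N n * LSeries.term c s n).re + K * (Real.log (Q * (2 + ‖s‖)) / Real.log N)) := by
  have hm0 := m0_pos
  have hm2 := m2_nonneg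
  refine ⟨51 * m2 / m0 * 32 + 1, by positivity, fun N n => if 2 ≤ N then Fw (Real.log (N - 1/2) / 8) n else 0, ?_, ?_⟩
  · intro N n
    dsimp only
    split_ifs with hN
    · exact Fw_norm_le _ (by have := lam_ge hN (lam := Real.log (N - 1/2) / 8) (by ring); linarith) n
    · simp
  · intro f Q c h N hN s hs
    simp only [if_pos hN]
    have hQ := h.hQ
    obtain ⟨l, hl, hle, hls⟩ := exists_log_normalized f h.diff.differentiableOn h.nz (LSeries c) (LSeries_diffOn h.hc) h.euler
    set lam := Real.log (N - 1/2) / 8 with hlam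
    have hlam8 : 8 * lam = Real.log (N - 1/2) := by rw [hlam]; ring
    have hl0 : 0 < lam := by have := lam_ge hN hlam8; linarith
    have h2N : (2:ℝ) ≤ N := by exact_mod_cast hN
    have hlogN : 0 < Real.log N := Real.log_pos (by linarith)
    have hll : Real.log N / 16 ≤ lam := by
      have : Real.log N ≤ 2 * Real.log (N - 1/2) := by
        have e : 2 * Real.log ((N:ℝ) - 1/2) = Real.log (((N:ℝ) - 1/2) ^ 2) := by
          rw [Real.log_pow]; norm_num
        rw [e]
        apply Real.log_le_log (by linarith)
        nlinarith
      linarith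
    have := pl_step h N (Fw lam) (Fw_norm_le lam hl0) ((51 * m2 / m0) / lam) (by positivity) (by
      intro t
      have := half_line h hl hle hls N hN lam hlam8 t
      convert this using 3
      ring) s hs
    refine this.trans ?_
    apply Real.exp_le_exp.2
    refine add_le_add le_rfl ?_
    have hsn : 1/2 ≤ ‖s‖ := hs.trans (Complex.re_le_norm s)
    have hA : 0 ≤ Real.log (Q * (2 + ‖s‖)) := Real.log_nonneg (by nlinarith)
    have h32 : 1/2 ≤ ‖s + 3/2‖ := by
      have := Complex.re_le_norm (s + 3/2)
      simp at this; linarith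
    have h5 : Real.log (Q * (2 * ‖s + 3/2‖)) ≤ 2 * Real.log (Q * (2 + ‖s‖)) := by
      have e : 2 * Real.log (Q * (2 + ‖s‖)) = Real.log ((Q * (2 + ‖s‖)) ^ 2) := by
        rw [Real.log_pow]; norm_num
      rw [e]
      apply Real.log_le_log (by positivity)
      have h6 : ‖s + 3/2‖ ≤ 2 + ‖s‖ := by
        calc _ ≤ ‖s‖ + ‖(3/2:ℂ)‖ := norm_add_le _ _
          _ ≤ _ := by norm_num; linarith
      have h7 : 4 ≤ Q * (2 + ‖s‖) := by nlinarith
      have h8 : Q * (2 * ‖s + 3/2‖) ≤ 2 * (Q * (2 + ‖s‖)) := by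
        have : Q * ‖s + 3/2‖ ≤ Q * (2 + ‖s‖) := by gcongr
        linarith
      nlinarith
    have h9 : 1 / lam ≤ 16 / Real.log N := by
      rw [div_le_div_iff₀ hl0 hlogN]; linarith
    calc _ = (51 * m2 / m0) * (1 / lam) * Real.log (Q * (2 * ‖s + 3/2‖)) := by ring
      _ ≤ (51 * m2 / m0) * (1 / lam) * (2 * Real.log (Q * (2 + ‖s‖))) := by gcongr
      _ ≤ (51 * m2 / m0) * (16 / Real.log N) * (2 * Real.log (Q * (2 + ‖s‖))) := by gcongr
      _ = (51 * m2 / m0 * 32) * (Real.log (Q * (2 + ‖s‖)) / Real.log N) := by ring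
      _ ≤ _ := by gcongr; linarith

end Stmt13

namespace Stmt13

open MeasureTheory Filter Topology

lemma char_sum_bound {q : ℕ} [NeZero q] (χ : DirichletCharacter ℂ q) (hχ : χ ≠ 1) (n : ℕ) :
    ‖∑ k ∈ range n, χ (k : ZMod q)‖ ≤ q := by
  have hq : 0 < q := NeZero.pos q
  have h0 : ∑ k ∈ range q, χ (k : ZMod q) = 0 := by
    rw [← MulChar.sum_eq_zero_of_ne_one hχ]
    apply Finset.sum_nbij' (fun i : ℕ => (i : ZMod q)) (ZMod.val (n := q))
    · simp
    · intro a _; simp [ZMod.val_lt]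
    · intro a ha; exact ZMod.val_cast_of_lt (by simpa using ha)
    · intro a _; simp
    · intro a _; rfl
  induction n using Nat.strong_induction_on with
  | _ n ih =>
    rcases lt_or_ge n q with hn | hn
    · calc _ ≤ ∑ k ∈ range n, (1:ℝ) := norm_sum_le_of_le _ (fun k _ => DirichletCharacter.norm_le_one χ _)
        _ = n := by simp
        _ ≤ q := by exact_mod_cast hn.le
    · obtain ⟨m, rfl⟩ := Nat.exists_eq_add_of_le hn
      rw [sum_range_add, h0, zero_add]
      have := ih m (by omega)
      simpa using this

lemma char_sum_bound' {q : ℕ} [NeZero q] (hq : 1 < q) (χ : DirichletCharacter ℂ q) (hχ : χ ≠ 1) (n : ℕ) :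
    ‖∑ k ∈ Icc 1 n, χ (k : ZMod q)‖ ≤ q := by
  have h := char_sum_bound χ hχ (n + 1)
  rw [sum_range_succ'] at h
  have h00 : χ ((0:ℕ) : ZMod q) = 0 := by
    have : Nontrivial (ZMod q) := ZMod.nontrivial_iff.2 (by omega)
    rw [Nat.cast_zero]; exact MulChar.map_zero χ
  rw [h00, add_zero] at h
  rw [← Finset.Ico_add_one_right_eq_Icc, Finset.sum_Ico_eq_sum_range]
  simpa [add_comm] using h

lemma L_growth {q : ℕ} [NeZero q] (hq : 1 < q) (χ : DirichletCharacter ℂ q) (hχ : χ ≠ 1) (s : ℂ) (hs : 1 / 2 ≤ s.re) :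
    ‖DirichletCharacter.LFunction χ s‖ ≤ 2 * q * ‖s‖ := by
  set S : ℝ → ℂ := fun t => Set.indicator (Set.Ioi (1:ℝ)) (fun t => ∑ k ∈ Icc 1 ⌊t⌋₊, χ (k : ZMod q)) t with hS
  have hSb : ∀ t, ‖S t‖ ≤ q := by
    intro t
    simp only [hS]
    refine (norm_indicator_le_norm_self _ _).trans (char_sum_bound' hq χ hχ _)
  have hSm : Measurable S := by
    apply Measurable.indicator _ measurableSet_Ioi
    exact (measurable_of_countable (fun n : ℕ => ∑ k ∈ Icc 1 n, χ (k : ZMod q))).comp Nat.measurable_floor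
  have hSloc : LocallyIntegrableOn S (Set.Ioi 0) := by
    apply LocallyIntegrable.locallyIntegrableOn
    have : LocallyIntegrable (fun _ : ℝ => (q:ℝ)) := locallyIntegrable_const _
    refine this.mono hSm.aestronglyMeasurable ?_
    filter_upwards with t
    rw [Real.norm_of_nonneg (by positivity)]; exact hSb t
  have hStop : S =O[atTop] (fun t : ℝ => t ^ (-(0:ℝ))) := by
    apply Asymptotics.IsBigO.of_bound q
    filter_upwards with t
    simpa using hSb t
  have hSbot : ∀ b : ℝ, S =O[𝓝[>] 0] (fun t : ℝ => t ^ (-b)) := by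
    intro b
    apply Asymptotics.IsBigO.of_bound 0
    have : Set.Ioo (0:ℝ) 1 ∈ 𝓝[>] (0:ℝ) := Ioo_mem_nhdsGT one_pos
    filter_upwards [this] with t ht
    simp only [hS]
    rw [Set.indicator_of_notMem]
    · simp
    · simp [ht.2.le]
  set G : ℂ → ℂ := fun s => s * mellin S (-s) with hG
  have hGd : DifferentiableOn ℂ G {s : ℂ | 0 < s.re} := by
    intro s hs
    have hs : 0 < s.re := hs
    apply DifferentiableAt.differentiableWithinAt
    apply DifferentiableAt.mul differentiableAt_id
    have := mellin_differentiableAt_of_isBigO_rpow (s := -s) hSloc hStop (by simpa using hs) (hSbot (-s.re - 1)) (by simp)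
    exact this.comp s differentiableAt_id.neg
  have hmel : ∀ s : ℂ, mellin S (-s) = ∫ t in Set.Ioi (1:ℝ), (∑ k ∈ Icc 1 ⌊t⌋₊, χ (k : ZMod q)) * (t:ℂ) ^ (-(s+1)) := by
    intro s
    rw [mellin]
    have : ∀ t : ℝ, (t:ℂ) ^ (-s - 1) • S t = Set.indicator (Set.Ioi (1:ℝ)) (fun t : ℝ => (∑ k ∈ Icc 1 ⌊t⌋₊, χ (k : ZMod q)) * (t:ℂ) ^ (-(s+1))) t := by
      intro t
      simp only [hS, Set.indicator]
      split_ifs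
      · rw [smul_eq_mul, mul_comm]; congr 2; ring
      · simp
    simp only [this]
    rw [setIntegral_indicator measurableSet_Ioi]
    congr 2
    ext t
    simp only [Set.mem_inter_iff, Set.mem_Ioi]
    constructor
    · rintro ⟨_, h⟩; exact h
    · intro h; exact ⟨by linarith, h⟩
  have hGb : ∀ s : ℂ, 1/2 ≤ s.re → ‖G s‖ ≤ 2 * q * ‖s‖ := by
    intro s hs
    simp only [hG, norm_mul]
    rw [hmel]
    have hre : -s.re - 1 < -1 := by linarith
    have hb : ‖∫ t in Set.Ioi (1:ℝ), (∑ k ∈ Icc 1 ⌊t⌋₊, χ (k : ZMod q)) * (t:ℂ) ^ (-(s+1))‖ ≤ ∫ t in Set.Ioi (1:ℝ), q * t ^ (-s.re - 1) := by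
      apply norm_integral_le_of_norm_le
      · exact (integrableOn_Ioi_rpow_of_lt hre one_pos).const_mul _
      · filter_upwards [self_mem_ae_restrict measurableSet_Ioi] with t ht
        have ht : 1 < t := ht
        rw [norm_mul, Complex.norm_cpow_eq_rpow_re_of_pos (by linarith)]
        have : (-(s+1)).re = -s.re - 1 := by simp; ring
        rw [this]
        gcongr
        exact char_sum_bound' hq χ hχ _
    rw [integral_const_mul, integral_Ioi_rpow_of_lt hre one_pos] at hb
    have : (q:ℝ) * (-(1:ℝ) ^ (-s.re - 1 + 1) / (-s.re - 1 + 1)) ≤ 2 * q := by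
      rw [Real.one_rpow, show -s.re - 1 + 1 = -s.re by ring, neg_div_neg_eq]
      have : 1 / s.re ≤ 2 := by rw [div_le_iff₀ (by linarith)]; linarith
      nlinarith [Nat.cast_nonneg (α := ℝ) q]
    calc _ ≤ ‖s‖ * (2 * q) := by gcongr; linarith
      _ = _ := by ring
  have hLd : Differentiable ℂ (DirichletCharacter.LFunction χ) := DirichletCharacter.differentiable_LFunction hχ
  have hEq : Set.EqOn (DirichletCharacter.LFunction χ) G {s : ℂ | 0 < s.re} := by
    have ho := isOpen_halfplane 0
    have hA1 : AnalyticOnNhd ℂ (DirichletCharacter.LFunction χ) {s : ℂ | 0 < s.re} := hLd.differentiableOn.analyticOnNhd ho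
    have hA2 : AnalyticOnNhd ℂ G {s : ℂ | 0 < s.re} := hGd.analyticOnNhd ho
    refine hA1.eqOn_of_preconnected_of_eventuallyEq hA2 (convex_halfplane 0).isPreconnected (z₀ := 2) (by simp) ?_
    have : {s : ℂ | 1 < s.re} ∈ 𝓝 (2:ℂ) := (isOpen_halfplane 1).mem_nhds (by simp)
    filter_upwards [this] with s hs
    have hs : 1 < s.re := hs
    rw [DirichletCharacter.LFunction_eq_LSeries χ hs]
    have hsum : LSeriesSummable (fun n => χ (n : ZMod q)) s := DirichletCharacter.LSeriesSummable_of_one_lt_re χ hs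
    rw [LSeries_eq_mul_integral (fun n => χ (n : ZMod q)) le_rfl (by linarith) hsum]
    · simp only [hG]
      rw [hmel]
    · apply Asymptotics.IsBigO.of_bound q
      filter_upwards with n
      simpa using char_sum_bound' hq χ hχ n
  rw [hEq (show 0 < s.re by linarith)]
  exact hGb s hs

/-- coefficients of log L -/
noncomputable def cL {q : ℕ} (χ : DirichletCharacter ℂ q) (n : ℕ) : ℂ :=
  χ (n : ZMod q) * ((ArithmeticFunction.vonMangoldt n / Real.log n : ℝ) : ℂ)

lemma vM_div_le (n : ℕ) : |ArithmeticFunction.vonMangoldt n / Real.log n| ≤ 1 := by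
  have h1 := ArithmeticFunction.vonMangoldt_nonneg (n := n)
  have h2 := Real.log_natCast_nonneg n
  rw [abs_of_nonneg (by positivity)]
  exact div_le_one_of_le₀ ArithmeticFunction.vonMangoldt_le_log h2

lemma cL_norm {q : ℕ} (χ : DirichletCharacter ℂ q) (n : ℕ) : ‖cL χ n‖ ≤ 1 := by
  rw [cL, norm_mul, Complex.norm_real]
  exact mul_le_one₀ (DirichletCharacter.norm_le_one χ _) (norm_nonneg _) (vM_div_le n)

lemma L_euler {q : ℕ} [NeZero q] (χ : DirichletCharacter ℂ q) (s : ℂ) (hs : 1 < s.re) :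
    DirichletCharacter.LFunction χ s = Complex.exp (LSeries (cL χ) s) := by
  rw [DirichletCharacter.LFunction_eq_LSeries χ hs]
  set L : ℂ → ℂ := LSeries (fun n => χ (n : ZMod q)) with hL
  have hcab : ∀ s : ℂ, 1 < s.re → LSeries.abscissaOfAbsConv (cL χ) < s.re := fun s hs =>
    lt_of_le_of_lt (abscissa_le (cL_norm χ)) (by exact_mod_cast hs)
  have hχab : ∀ s : ℂ, 1 < s.re → LSeries.abscissaOfAbsConv (fun n : ℕ => χ (n : ZMod q)) < s.re := fun s hs =>
    lt_of_le_of_lt (abscissa_le (fun n => DirichletCharacter.norm_le_one χ _)) (by exact_mod_cast hs)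
  have hlm : LSeries.logMul (cL χ) = (fun n : ℕ => χ (n : ZMod q)) * (fun n : ℕ => (ArithmeticFunction.vonMangoldt n : ℂ)) := by
    ext n
    simp only [LSeries.logMul, cL, Pi.mul_apply]
    rcases lt_or_ge n 2 with hn | hn
    · interval_cases n <;> simp
    · have : (Real.log n : ℂ) ≠ 0 := by
        have h2 : (1:ℝ) < n := by exact_mod_cast hn
        exact_mod_cast (Real.log_pos h2).ne'
      rw [← Complex.natCast_log, Complex.ofReal_div]
      field_simp
  have hne : ∀ s : ℂ, 1 < s.re → L s ≠ 0 := fun s hs => DirichletCharacter.LSeries_ne_zero_of_one_lt_re χ hs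
  set h : ℂ → ℂ := fun s => L s * Complex.exp (- LSeries (cL χ) s) with hh
  have hd : ∀ s : ℂ, 1 < s.re → HasDerivAt h 0 s := by
    intro s hs
    have h1 := LSeries_hasDerivAt (hcab s hs)
    have h2 : HasDerivAt L (deriv L s) s := (LSeries_hasDerivAt (hχab s hs)).differentiableAt.hasDerivAt
    have h3 := h2.mul (h1.neg.cexp)
    have h4 : LSeries (LSeries.logMul (cL χ)) s = -deriv L s / L s := by
      rw [hlm]
      exact DirichletCharacter.LSeries_twist_vonMangoldt_eq χ hs
    have h5 : deriv L s * Complex.exp ((-LSeries (cL χ)) s) + L s * (Complex.exp ((-LSeries (cL χ)) s) * - -LSeries (LSeries.logMul (cL χ)) s) = 0 := by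
      rw [h4]
      have := hne s hs
      simp only [Pi.neg_apply, neg_neg]
      field_simp
      ring
    rw [h5] at h3
    exact h3
  have hconst : ∀ s₁ ∈ {s : ℂ | 1 < s.re}, ∀ s₂ ∈ {s : ℂ | 1 < s.re}, h s₁ = h s₂ := by
    intro s₁ h1 s₂ h2
    apply (isOpen_halfplane 1).is_const_of_deriv_eq_zero (convex_halfplane 1).isPreconnected _ _ h1 h2
    · intro s hs; exact (hd s hs).differentiableAt.differentiableWithinAt
    · intro s hs; exact (hd s hs).deriv
  have htop : ∀ c : ℕ → ℂ, (∀ n, ‖c n‖ ≤ 1) → LSeries.abscissaOfAbsConv c < ⊤ := fun c hc =>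
    lt_of_le_of_lt (abscissa_le hc) (EReal.coe_lt_top 1)
  have hlim : Tendsto (fun x : ℝ => h x) atTop (𝓝 (1 * Complex.exp (- 0))) := by
    apply Tendsto.mul
    · have := LSeries.tendsto_atTop (htop (fun n : ℕ => χ (n : ZMod q)) (fun n => DirichletCharacter.norm_le_one χ _))
      simpa using this
    · apply (Complex.continuous_exp.tendsto _).comp
      apply Tendsto.neg
      have := LSeries.tendsto_atTop (htop (cL χ) (cL_norm χ))
      simpa [cL] using this
  have h1 : h s = 1 := by
    have : Tendsto (fun x : ℝ => h x) atTop (𝓝 (h s)) := by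
      apply tendsto_const_nhds.congr'
      filter_upwards [eventually_gt_atTop 1] with x hx
      exact hconst s hs x (by simpa using hx)
    have := tendsto_nhds_unique this hlim
    simpa using this
  simp only [hh, Complex.exp_neg] at h1
  exact (mul_inv_eq_one₀ (Complex.exp_ne_zero _)).1 h1

lemma KH_L {q : ℕ} [NeZero q] (hq : 1 < q) (χ : DirichletCharacter ℂ q) (hχ : χ.IsPrimitive)
    (hRH : dirichletRH χ) : KH (DirichletCharacter.LFunction χ) q (cL χ) := by
  have hne := prim_ne_one hq hχ
  refine ⟨by exact_mod_cast hq, DirichletCharacter.differentiable_LFunction hne, ?_, L_reflect hq hχ, L_growth hq χ hne, cL_norm χ, L_euler χ⟩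
  intro s hs h0
  rcases lt_or_ge s.re 1 with h1 | h1
  · have := hRH s (by linarith) h1 h0
    linarith
  · exact DirichletCharacter.LFunction_ne_zero_of_one_le_re χ (Or.inl hne) h1 h0

end Stmt13

namespace Stmt13

open MeasureTheory Filter Topology

/-- the entire function `(s-1) ζ(s)` -/
noncomputable def zf : ℂ → ℂ := Function.update (fun s => (s - 1) * riemannZeta s) 1 1

lemma zf_of_ne {s : ℂ} (h : s ≠ 1) : zf s = (s - 1) * riemannZeta s := by
  simp [zf, Function.update_of_ne h]

lemma zf_one : zf 1 = 1 := by simp [zf]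

lemma zf_diff : Differentiable ℂ zf := by
  intro s
  by_cases h : s = 1
  · subst h
    apply AnalyticAt.differentiableAt
    apply Complex.analyticAt_of_differentiable_on_punctured_nhds_of_continuousAt
    · filter_upwards [self_mem_nhdsWithin] with s hs
      have hs : s ≠ 1 := hs
      have : zf =ᶠ[𝓝 s] (fun s => (s - 1) * riemannZeta s) := by
        filter_upwards [isOpen_ne.mem_nhds hs] with w hw
        exact zf_of_ne hw
      refine DifferentiableAt.congr_of_eventuallyEq ?_ this
      exact (differentiableAt_id.sub_const 1).mul (differentiableAt_riemannZeta hs)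
    · rw [zf, continuousAt_update_same]
      exact riemannZeta_residue_one
  · have : zf =ᶠ[𝓝 s] (fun s => (s - 1) * riemannZeta s) := by
      filter_upwards [isOpen_ne.mem_nhds h] with w hw
      exact zf_of_ne hw
    refine DifferentiableAt.congr_of_eventuallyEq ?_ this
    exact (differentiableAt_id.sub_const 1).mul (differentiableAt_riemannZeta h)

lemma zf_approx (s : ℂ) (hs : 0 < s.re) : ‖zf s - s‖ ≤ ‖s - 1‖ * (‖s‖ / s.re) := by
  set S0 : ℝ → ℂ := fun t => ((⌊t⌋₊ : ℝ) - t : ℝ) with hS0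
  set S : ℝ → ℂ := fun t => Set.indicator (Set.Ioi (1:ℝ)) S0 t with hS
  have hS0b : ∀ t : ℝ, 1 < t → ‖S0 t‖ ≤ 1 := by
    intro t ht
    simp only [hS0, Complex.norm_real, Real.norm_eq_abs]
    have h1 := Nat.floor_le (show 0 ≤ t by linarith)
    have h2 := Nat.lt_floor_add_one t
    rw [abs_le]; constructor <;> linarith
  have hSb : ∀ t, ‖S t‖ ≤ 1 := by
    intro t
    simp only [hS, Set.indicator]
    split_ifs with h
    · exact hS0b t h
    · simp
  have hS0m : Measurable S0 := by
    apply Complex.measurable_ofReal.comp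
    exact ((measurable_of_countable (fun n : ℕ => (n:ℝ))).comp Nat.measurable_floor).sub measurable_id
  have hSm : Measurable S := hS0m.indicator measurableSet_Ioi
  have hSloc : LocallyIntegrableOn S (Set.Ioi 0) := by
    apply LocallyIntegrable.locallyIntegrableOn
    have : LocallyIntegrable (fun _ : ℝ => (1:ℝ)) := locallyIntegrable_const _
    refine this.mono hSm.aestronglyMeasurable ?_
    filter_upwards with t
    simpa using hSb t
  have hStop : S =O[atTop] (fun t : ℝ => t ^ (-(0:ℝ))) := by
    apply Asymptotics.IsBigO.of_bound 1
    filter_upwards with t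
    simpa using hSb t
  have hSbot : ∀ b : ℝ, S =O[𝓝[>] 0] (fun t : ℝ => t ^ (-b)) := by
    intro b
    apply Asymptotics.IsBigO.of_bound 0
    have : Set.Ioo (0:ℝ) 1 ∈ 𝓝[>] (0:ℝ) := Ioo_mem_nhdsGT one_pos
    filter_upwards [this] with t ht
    simp only [hS]
    rw [Set.indicator_of_notMem]
    · simp
    · simp [ht.2.le]
  set G : ℂ → ℂ := fun s => s * mellin S (-s) with hG
  have hGd : DifferentiableOn ℂ G {s : ℂ | 0 < s.re} := by
    intro s hs
    have hs : 0 < s.re := hs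
    apply DifferentiableAt.differentiableWithinAt
    apply DifferentiableAt.mul differentiableAt_id
    have := mellin_differentiableAt_of_isBigO_rpow (s := -s) hSloc hStop (by simpa using hs) (hSbot (-s.re - 1)) (by simp)
    exact this.comp s differentiableAt_id.neg
  have hmel : ∀ s : ℂ, mellin S (-s) = ∫ t in Set.Ioi (1:ℝ), S0 t * (t:ℂ) ^ (-(s+1)) := by
    intro s
    rw [mellin]
    have : ∀ t : ℝ, (t:ℂ) ^ (-s - 1) • S t = Set.indicator (Set.Ioi (1:ℝ)) (fun t : ℝ => S0 t * (t:ℂ) ^ (-(s+1))) t := by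
      intro t
      simp only [hS, Set.indicator]
      split_ifs
      · rw [smul_eq_mul, mul_comm]; congr 2; ring
      · simp
    simp only [this]
    rw [setIntegral_indicator measurableSet_Ioi]
    congr 2
    ext t
    simp only [Set.mem_inter_iff, Set.mem_Ioi]
    constructor
    · rintro ⟨_, h⟩; exact h
    · intro h; exact ⟨by linarith, h⟩
  have hbnd : ∀ s : ℂ, ∀ t : ℝ, 1 < t → ‖S0 t * (t:ℂ) ^ (-(s+1))‖ ≤ t ^ (-s.re - 1) := by
    intro s t ht
    rw [norm_mul, Complex.norm_cpow_eq_rpow_re_of_pos (by linarith)]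
    have : (-(s+1)).re = -s.re - 1 := by simp; ring
    rw [this]
    have := hS0b t ht
    have h2 : 0 ≤ t ^ (-s.re - 1) := by positivity
    nlinarith
  have hIntg : ∀ s : ℂ, 0 < s.re → IntegrableOn (fun t : ℝ => S0 t * (t:ℂ) ^ (-(s+1))) (Set.Ioi 1) := by
    intro s hs
    refine (integrableOn_Ioi_rpow_of_lt (show -s.re - 1 < -1 by linarith) one_pos).mono' ?_ ?_
    · apply AEStronglyMeasurable.mul
      · exact hS0m.aestronglyMeasurable
      · apply Measurable.aestronglyMeasurable
        fun_prop
    · filter_upwards [self_mem_ae_restrict measurableSet_Ioi] with t ht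
      exact hbnd s t ht
  have hGb : ∀ s : ℂ, 0 < s.re → ‖G s‖ ≤ ‖s‖ / s.re := by
    intro s hs
    simp only [hG, norm_mul]
    rw [hmel]
    have hre : -s.re - 1 < -1 := by linarith
    have hb : ‖∫ t in Set.Ioi (1:ℝ), S0 t * (t:ℂ) ^ (-(s+1))‖ ≤ ∫ t in Set.Ioi (1:ℝ), t ^ (-s.re - 1) := by
      apply norm_integral_le_of_norm_le
      · exact (integrableOn_Ioi_rpow_of_lt hre one_pos)
      · filter_upwards [self_mem_ae_restrict measurableSet_Ioi] with t ht
        exact hbnd s t ht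
    rw [integral_Ioi_rpow_of_lt hre one_pos] at hb
    rw [Real.one_rpow, show -s.re - 1 + 1 = -s.re by ring, neg_div_neg_eq] at hb
    calc _ ≤ ‖s‖ * (1 / s.re) := by gcongr
      _ = _ := by ring
  have hEq : Set.EqOn zf (fun s => s + (s - 1) * G s) {s : ℂ | 0 < s.re} := by
    have ho := isOpen_halfplane 0
    have hA1 : AnalyticOnNhd ℂ zf {s : ℂ | 0 < s.re} := zf_diff.differentiableOn.analyticOnNhd ho
    have hA2 : AnalyticOnNhd ℂ (fun s => s + (s - 1) * G s) {s : ℂ | 0 < s.re} := by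
      apply DifferentiableOn.analyticOnNhd _ ho
      exact differentiableOn_id.add ((differentiableOn_id.sub_const 1).mul hGd)
    refine hA1.eqOn_of_preconnected_of_eventuallyEq hA2 (convex_halfplane 0).isPreconnected (z₀ := 2) (by simp) ?_
    have : {s : ℂ | 1 < s.re} ∈ 𝓝 (2:ℂ) := (isOpen_halfplane 1).mem_nhds (by simp)
    filter_upwards [this] with s hs
    have hs : 1 < s.re := hs
    have hs1 : s ≠ 1 := by rintro rfl; simp at hs
    rw [zf_of_ne hs1, ← LSeries_one_eq_riemannZeta hs]
    have hs2 : s - 1 ≠ 0 := sub_ne_zero.2 hs1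
    have hsum : LSeriesSummable 1 s := LSeriesSummable_one_iff.2 hs
    rw [LSeries_eq_mul_integral 1 zero_le_one hs hsum]
    · have hsp : (∫ t in Set.Ioi (1:ℝ), (∑ k ∈ Icc 1 ⌊t⌋₊, (1 : ℕ → ℂ) k) * (t:ℂ) ^ (-(s+1))) = mellin S (-s) + 1 / (s - 1) := by
        rw [hmel]
        have h1 : (1:ℂ) / (s - 1) = ∫ t in Set.Ioi (1:ℝ), (t:ℂ) ^ (-s) := by
          rw [integral_Ioi_cpow_of_lt (by simpa using hs) one_pos]
          simp
          rw [show -s + 1 = -(s-1) by ring, neg_div, div_neg, neg_neg, one_div]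
        have hi2 : IntegrableOn (fun t : ℝ => (t:ℂ) ^ (-s)) (Set.Ioi 1) :=
          integrableOn_Ioi_cpow_of_lt (by simpa using hs) one_pos
        rw [h1, ← integral_add (hIntg s (by linarith)) hi2]
        apply setIntegral_congr_fun measurableSet_Ioi
        intro t ht
        have ht : 1 < t := ht
        have : (t:ℂ) ^ (-s) = t * (t:ℂ) ^ (-(s+1)) := by
          rw [show -s = 1 + -(s+1) by ring, Complex.cpow_add _ _ (by exact_mod_cast (by linarith : t ≠ 0)), Complex.cpow_one]
        simp only [hS0, Pi.one_apply, Finset.sum_const, Nat.card_Icc, this]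
        push_cast
        simp
        ring
      rw [hsp]
      simp only [hG]
      field_simp
      ring
    · apply Asymptotics.IsBigO.of_bound 1
      filter_upwards with n
      simp
  rw [hEq hs]
  simp only [add_sub_cancel_left, norm_mul]
  gcongr
  exact hGb s hs

lemma zeta_real_bounds (d : ℝ) (hd : 0 < d) :
    1 / d ≤ ‖riemannZeta (1 + d : ℝ)‖ ∧ ‖riemannZeta (1 + d : ℝ)‖ ≤ 2 + 1 / d := by
  have h := zf_approx (1 + d : ℝ) (by simp; linarith)
  have hne : ((1 + d : ℝ) : ℂ) ≠ 1 := by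
    intro h; have := congrArg Complex.re h; simp at this; linarith
  rw [zf_of_ne hne] at h
  have e1 : ((1 + d : ℝ) : ℂ) - 1 = (d : ℝ) := by push_cast; ring
  rw [e1, Complex.norm_real, Complex.norm_real, Complex.ofReal_re, Real.norm_of_nonneg hd.le,
    Real.norm_of_nonneg (by linarith), div_self (by linarith), mul_one] at h
  have h1 := norm_sub_norm_le ((1 + d : ℝ) : ℂ) ((d:ℝ) * riemannZeta (1 + d : ℝ))
  have h2 := norm_sub_norm_le ((d:ℝ) * riemannZeta (1 + d : ℝ)) ((1 + d : ℝ) : ℂ)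
  rw [norm_sub_rev] at h1
  rw [norm_mul, Complex.norm_real, Complex.norm_real, Real.norm_of_nonneg hd.le, Real.norm_of_nonneg (by linarith)] at h1 h2
  constructor
  · rw [div_le_iff₀ hd]; linarith
  · rw [← sub_nonneg]
    have : 0 ≤ d * (2 + 1/d - ‖riemannZeta (1 + d : ℝ)‖) := by
      have : d * (1/d) = 1 := by field_simp
      nlinarith
    exact nonneg_of_mul_nonneg_right this hd

lemma zf_growth (s : ℂ) (hs : 1 / 2 ≤ s.re) : ‖zf s‖ ≤ 3 * (1 + ‖s‖) ^ 2 := by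
  have h := zf_approx s (by linarith)
  have h1 : ‖zf s‖ ≤ ‖zf s - s‖ + ‖s‖ := by simpa using norm_add_le (zf s - s) s
  have h2 : ‖s - 1‖ ≤ ‖s‖ + 1 := by simpa using norm_sub_le s 1
  have h3 : ‖s‖ / s.re ≤ 2 * ‖s‖ := by
    rw [div_le_iff₀ (by linarith)]; nlinarith [norm_nonneg s]
  have h4 : ‖s - 1‖ * (‖s‖ / s.re) ≤ (‖s‖ + 1) * (2 * ‖s‖) := by gcongr
  nlinarith [norm_nonneg s]

lemma zf_ne_zero {q : ℕ} [NeZero q] (hRH : dirichletRH (1 : DirichletCharacter ℂ q)) (s : ℂ) (hs : 1 / 2 < s.re) :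
    zf s ≠ 0 := by
  by_cases h1 : s = 1
  · rw [h1, zf_one]; exact one_ne_zero
  rw [zf_of_ne h1]
  apply mul_ne_zero (sub_ne_zero.2 h1)
  by_cases h2 : 1 ≤ s.re
  · exact riemannZeta_ne_zero_of_one_le_re h2
  · push Not at h2
    intro h0
    have := hRH s (by linarith) h2 (by
      have := DirichletCharacter.LFunctionTrivChar_eq_mul_riemannZeta (N := q) h1
      rw [h0, mul_zero] at this
      exact this)
    linarith

/-- coefficients of log ζ -/
noncomputable def cz (n : ℕ) : ℂ := ((ArithmeticFunction.vonMangoldt n / Real.log n : ℝ) : ℂ)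

lemma cz_norm (n : ℕ) : ‖cz n‖ ≤ 1 := by
  rw [cz, Complex.norm_real]; exact vM_div_le n

lemma zeta_euler (s : ℂ) (hs : 1 < s.re) : riemannZeta s = Complex.exp (LSeries cz s) := by
  have h := L_euler (1 : DirichletCharacter ℂ 1) s hs
  rw [DirichletCharacter.LFunction_modOne_eq] at h
  rw [h]
  congr 2
  ext n
  simp [cL, cz, MulChar.one_apply (isUnit_of_subsingleton (n : ZMod 1))]

end Stmt13

namespace Stmt13

open MeasureTheory Filter Topology

lemma cz_summable (s : ℂ) (hs : 1 < s.re) : LSeriesSummable cz s :=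
  LSeriesSummable_of_abscissaOfAbsConv_lt_re
    (lt_of_le_of_lt (abscissa_le cz_norm) (by exact_mod_cast hs))

/-- real terms -/
noncomputable def rz (σ : ℝ) (n : ℕ) : ℝ := (LSeries.term cz σ n).re

lemma cz_term_real (σ : ℝ) (n : ℕ) :
    LSeries.term cz σ n = ((if n = 0 then 0 else (ArithmeticFunction.vonMangoldt n / Real.log n) / (n:ℝ) ^ σ : ℝ) : ℂ) := by
  rcases eq_or_ne n 0 with rfl | hn
  · simp
  · rw [LSeries.term_of_ne_zero hn, if_neg hn, cz, Complex.ofReal_div (_ / _) ((n:ℝ)^σ), Complex.ofReal_cpow (Nat.cast_nonneg n)]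
    simp

lemma rz_nonneg (σ : ℝ) (n : ℕ) : 0 ≤ rz σ n := by
  rw [rz, cz_term_real, Complex.ofReal_re]
  split_ifs
  · exact le_rfl
  · have h1 := ArithmeticFunction.vonMangoldt_nonneg (n := n)
    have h2 := Real.log_natCast_nonneg n
    positivity

lemma cz_term_norm (s : ℂ) (n : ℕ) : ‖LSeries.term cz s n‖ = rz s.re n := by
  have h1 : ‖LSeries.term cz s n‖ = ‖LSeries.term cz s.re n‖ := by
    rw [LSeries.norm_term_eq, LSeries.norm_term_eq]; simp
  rw [h1]
  have := rz_nonneg s.re n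
  rw [rz, cz_term_real] at *
  rw [Complex.ofReal_re] at *
  rw [Complex.norm_real, Real.norm_of_nonneg this]

lemma rz_shift (σ e : ℝ) (n : ℕ) : rz (σ + e) n = rz σ n * Real.exp (-(e * Real.log n)) := by
  have := term_shift cz σ e n
  rw [rz, rz, Complex.ofReal_add, this]
  rw [cz_term_real, show Complex.exp (-((e:ℂ) * (Real.log n : ℂ))) = ((Real.exp (-(e * Real.log n)) : ℝ) : ℂ) by push_cast; rfl]
  rw [← Complex.ofReal_mul, Complex.ofReal_re, Complex.ofReal_re]

lemma rz_summable (σ : ℝ) (hσ : 1 < σ) : Summable (rz σ) := by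
  have h := (cz_summable σ (by simpa using hσ)).norm
  simp only [cz_term_norm] at h
  simpa using h

lemma rz_tsum (σ : ℝ) (hσ : 1 < σ) : ∑' n, rz σ n = Real.log ‖riemannZeta σ‖ := by
  rw [zeta_euler σ (by simpa using hσ), Complex.norm_exp, Real.log_exp, LSeries]
  rw [Complex.re_tsum (cz_summable σ (by simpa using hσ))]
  rfl

lemma LS_le (s : ℂ) (hs : 1 < s.re) : ‖LSeries cz s‖ ≤ Real.log ‖riemannZeta s.re‖ := by
  rw [← rz_tsum _ hs]
  rw [LSeries]
  refine (norm_tsum_le_tsum_norm (cz_summable s hs).norm).trans ?_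
  simp only [cz_term_norm]; exact le_rfl

lemma LS_diff (s : ℂ) (hs : 1 < s.re) (e : ℝ) (he : 0 ≤ e) :
    ‖LSeries cz s - LSeries cz (s + e)‖ ≤ Real.log ‖riemannZeta s.re‖ - Real.log ‖riemannZeta (s.re + e : ℝ)‖ := by
  have hs2 : 1 < (s + e).re := by simp; linarith
  rw [← rz_tsum _ hs, ← rz_tsum _ (by linarith), ← (rz_summable _ hs).tsum_sub (rz_summable _ (by linarith))]
  rw [LSeries, LSeries, ← (cz_summable s hs).tsum_sub (cz_summable _ hs2)]
  refine tsum_of_norm_bounded ((rz_summable _ hs).sub (rz_summable _ (by linarith))).hasSum ?_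
  intro n
  rw [term_shift, rz_shift]
  have : LSeries.term cz s n - LSeries.term cz s n * Complex.exp (-((e:ℂ) * (Real.log n : ℂ)))
    = LSeries.term cz s n * ((1 - Real.exp (-(e * Real.log n)) : ℝ) : ℂ) := by push_cast; ring
  rw [this, norm_mul, cz_term_norm, Complex.norm_real, Real.norm_of_nonneg]
  · apply le_of_eq; ring
  · rw [sub_nonneg]; apply Real.exp_le_one_iff.2
    have := Real.log_natCast_nonneg n
    nlinarith

lemma zeta_le_real (s : ℂ) (hs : 1 < s.re) (d : ℝ) (hd : 0 < d) (h : d ≤ s.re - 1) :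
    ‖riemannZeta s‖ ≤ 2 + 1 / d := by
  have h1 : ‖riemannZeta s‖ ≤ ‖riemannZeta s.re‖ := by
    rw [zeta_euler s hs, Complex.norm_exp]
    have := (Complex.re_le_norm _).trans (LS_le s hs)
    calc _ ≤ Real.exp (Real.log ‖riemannZeta s.re‖) := Real.exp_le_exp.2 this
      _ = _ := Real.exp_log (norm_pos_iff.2 (riemannZeta_ne_zero_of_one_lt_re (by simpa using hs)))
  have h2 := (zeta_real_bounds (s.re - 1) (by linarith)).2
  rw [show (1 + (s.re - 1) : ℝ) = s.re by ring] at h2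
  have : 1 / (s.re - 1) ≤ 1 / d := one_div_le_one_div_of_le hd h
  linarith

/-- data of log ((s-1)ζ) -/
structure ZL (l : ℂ → ℂ) : Prop where
  diff : DifferentiableOn ℂ l {s : ℂ | 1 / 2 < s.re}
  ex : ∀ s : ℂ, 1 / 2 < s.re → Complex.exp (l s) = zf s
  eu : ∀ s : ℂ, 1 < s.re → l s = LSeries cz s + Complex.log (s - 1)

lemma exists_ZL (h : ∀ s : ℂ, 1 / 2 < s.re → zf s ≠ 0) : ∃ l, ZL l := by
  have hsl : ∀ s : ℂ, 1 < s.re → s - 1 ∈ Complex.slitPlane := fun s hs => Or.inl (by simpa using hs)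
  obtain ⟨l, h1, h2, h3⟩ := exists_log_normalized zf zf_diff.differentiableOn h
    (fun s => LSeries cz s + Complex.log (s - 1)) (by
      apply (LSeries_diffOn cz_norm).add
      intro s hs
      exact ((differentiableAt_id.sub_const 1).clog (hsl s hs)).differentiableWithinAt) (by
      intro s hs
      have hne : s - 1 ≠ 0 := Complex.slitPlane_ne_zero (hsl s hs)
      rw [zf_of_ne (sub_ne_zero.1 hne), Complex.exp_add, Complex.exp_log hne, zeta_euler s hs]; ring)
  exact ⟨l, h1, h2, h3⟩

lemma clog_norm_le (w : ℂ) (hw : 1 ≤ ‖w‖) : ‖Complex.log w‖ ≤ Real.log ‖w‖ + 4 := by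
  have h := Complex.norm_le_abs_re_add_abs_im (Complex.log w)
  rw [Complex.log_re, Complex.log_im, abs_of_nonneg (Real.log_nonneg hw)] at h
  have := Complex.abs_arg_le_pi w
  linarith [Real.pi_lt_d2]

lemma log_two_add_ge (u : ℝ) : (1:ℝ)/2 ≤ Real.log (2 + |u|) := by
  have := Real.log_two_gt_d9
  have : Real.log 2 ≤ Real.log (2 + |u|) := Real.log_le_log (by norm_num) (by linarith [abs_nonneg u])
  linarith

lemma zl_ge_two {l : ℂ → ℂ} (h : ZL l) (s : ℂ) (hs : 2 ≤ s.re) (hs4 : s.re ≤ 4) :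
    ‖l s‖ ≤ 17 * Real.log (2 + |s.im|) := by
  rw [h.eu s (by linarith)]
  have h0 := log_two_add_ge s.im
  have h1 : ‖LSeries cz s‖ ≤ 2 := by
    refine (LS_le s (by linarith)).trans ?_
    have h3 : ‖riemannZeta s.re‖ ≤ 3 := by
      have := zeta_le_real (s.re : ℂ) (by simp; linarith) 1 one_pos (by simp; linarith)
      norm_num at this ⊢; exact this
    have : Real.log ‖riemannZeta s.re‖ ≤ ‖riemannZeta s.re‖ - 1 := Real.log_le_sub_one_of_pos
      (norm_pos_iff.2 (riemannZeta_ne_zero_of_one_lt_re (by simp; linarith)))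
    linarith
  have h2 : 1 ≤ ‖s - 1‖ := by
    have := Complex.re_le_norm (s - 1)
    simp at this; linarith
  have h3 : ‖s - 1‖ ≤ (2 + |s.im|) ^ 2 := by
    have := Complex.norm_le_abs_re_add_abs_im (s - 1)
    simp only [sub_re, one_re, sub_im, one_im, sub_zero] at this
    rw [abs_of_nonneg (by linarith)] at this
    nlinarith [abs_nonneg s.im]
  have h4 : Real.log ‖s - 1‖ ≤ 2 * Real.log (2 + |s.im|) := by
    have := Real.log_le_log (by linarith) h3
    rwa [Real.log_pow] at this
  have := clog_norm_le (s - 1) h2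
  have := norm_add_le (LSeries cz s) (Complex.log (s - 1))
  linarith

lemma zl_bound {l : ℂ → ℂ} (h : ZL l) (s : ℂ) (hs : 3 / 4 ≤ s.re) (hs4 : s.re ≤ 4) :
    ‖l s‖ ≤ 1000 * Real.log (2 + |s.im|) := by
  have h0 := log_two_add_ge s.im
  rcases le_or_gt 2 s.re with h2 | h2
  · have := zl_ge_two h s h2 hs4; linarith
  set s₀ : ℂ := ⟨2, s.im⟩ with hs0
  have hn : ∀ z : ℂ, ‖z - s₀‖ < 11/8 → 1 / 2 < z.re ∧ ‖z‖ ≤ 4 + |s.im| := by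
    intro z hz
    have h1 := (abs_le.1 ((Complex.abs_re_le_norm (z - s₀)).trans hz.le)).1
    simp [hs0] at h1
    constructor
    · linarith
    · have h3 : ‖z‖ ≤ ‖z - s₀‖ + ‖s₀‖ := by simpa using norm_add_le (z - s₀) s₀
      have h4 := Complex.norm_le_abs_re_add_abs_im s₀
      simp [hs0] at h4
      simp [hs0] at h3 hz
      linarith
  have hM : Real.log (3 * (5 + |s.im|) ^ 2) ≤ 12 * Real.log (2 + |s.im|) := by
    have : 3 * (5 + |s.im|) ^ 2 ≤ (2 + |s.im|) ^ 12 := by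
      have h1 : (5 + |s.im|) ≤ (2 + |s.im|)^3 := by nlinarith [abs_nonneg s.im, mul_nonneg (abs_nonneg s.im) (abs_nonneg s.im), pow_nonneg (abs_nonneg s.im) 3]
      have h2 : 3 ≤ (2 + |s.im|)^6 := by
        calc (3:ℝ) ≤ 2^6 := by norm_num
          _ ≤ _ := by gcongr; linarith [abs_nonneg s.im]
      calc 3 * (5 + |s.im|) ^ 2 ≤ (2 + |s.im|)^6 * ((2 + |s.im|)^3)^2 := by gcongr
        _ = _ := by ring
    have := Real.log_le_log (by positivity) this
    rwa [Real.log_pow] at this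
  have hb := borelCara l s₀ s (12 * Real.log (2 + |s.im|)) (5/4) (11/8) (by linarith) ?_ ?_ ?_ (by norm_num)
  · have h3 := zl_ge_two h s₀ (by simp [hs0]) (by simp [hs0]; norm_num)
    have h4 : s₀.im = s.im := rfl
    rw [h4] at h3
    refine hb.trans ?_
    rw [div_le_iff₀ (by norm_num)]
    nlinarith
  · apply h.diff.mono
    intro z hz
    exact (hn z (by simpa [dist_eq_norm] using hz)).1
  · intro z hz
    obtain ⟨h1, h3⟩ := hn z hz
    have h4 : Real.exp (l z).re = ‖zf z‖ := by rw [← Complex.norm_exp, h.ex z h1]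
    have h5 : (l z).re = Real.log ‖zf z‖ := by rw [← h4, Real.log_exp]
    rw [h5]
    refine le_trans (Real.log_le_log (by rw [← h4]; positivity) ((zf_growth z h1.le).trans ?_)) hM
    have : (1 + ‖z‖) ≤ 5 + |s.im| := by linarith
    gcongr
  · have : s - s₀ = ((s.re - 2 : ℝ) : ℂ) := by
      apply Complex.ext <;> simp [hs0]
    rw [this, Complex.norm_real, Real.norm_eq_abs, abs_le]
    constructor <;> linarith

end Stmt13

namespace Stmt13

open MeasureTheory Filter Topology

lemma three_lines_zeta : ∃ C : ℝ, 0 < C ∧ ∀ l, ZL l → ∀ e : ℝ, 0 < e → e ≤ 5 / 4 → ∀ x : ℝ, 10 < x → 1 ≤ e * Real.log (Real.log x) →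
    e * Real.log (Real.log x) ≤ 1 → 
    ∀ d : ℝ, 0 < d → d ≤ e → ‖l (⟨1 + d, x⟩ : ℂ) - l (⟨1 + d + e, x⟩ : ℂ)‖ ≤ C := by
  set K : ℝ := 2000 * (Real.exp 9 * 3) * 2 with hK
  have hK1 : 1 ≤ K := by
    have := Real.add_one_le_exp 9
    rw [hK]; linarith
  set M1 : ℝ := 14 * Real.exp 9 with hM1
  have hM11 : 1 ≤ M1 := by
    have := Real.add_one_le_exp 9
    rw [hM1]; linarith
  refine ⟨K ^ (5:ℝ) * Real.exp 4 * M1, by positivity, ?_⟩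
  intro l hl e he he2 x hx hex hex' d hd hde
  set s0 : ℂ := ⟨1 + d, x⟩ with hs0
  set Φ : ℂ → ℂ := fun s => (l s - l (s + e)) * Complex.exp ((s - s0) ^ 2) with hΦ
  have hlogx : 1 ≤ Real.log x := by
    rw [Real.le_log_iff_exp_le (by linarith)]; linarith [Real.exp_one_lt_d9]
  have hgauss : ∀ s : ℂ, 3 / 4 ≤ s.re → s.re ≤ 1 + e →
      ‖Complex.exp ((s - s0) ^ 2)‖ ≤ Real.exp 9 * Real.exp (-(s.im - x)^2) := by
    intro s h1 h2
    rw [Complex.norm_exp, ← Real.exp_add]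
    apply Real.exp_le_exp.2
    have : ((s - s0)^2).re = (s.re - (1 + d))^2 - (s.im - x)^2 := by
      simp [sq, hs0]
    rw [this]
    nlinarith
  have hmain : ∀ s : ℂ, 3 / 4 ≤ s.re → s.re ≤ 1 + e → ‖Φ s‖ ≤ K * Real.log x := by
    intro s h1 h2
    simp only [hΦ, norm_mul]
    have b1 := zl_bound hl s h1 (by linarith)
    have b2 := zl_bound hl (s + e) (by simp; linarith) (by simp; linarith)
    have e1 : (s + e).im = s.im := by simp
    rw [e1] at b2
    have b3 := norm_sub_le (l s) (l (s + e))
    set w : ℝ := |s.im - x| with hw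
    have b4 : Real.log (2 + |s.im|) ≤ 2 * Real.log x + w := by
      have h5 : |s.im| ≤ w + x := by
        have := abs_add_le (s.im - x) x
        rw [abs_of_pos (by linarith : 0 < x)] at this; simpa using this
      have h6 : 2 + |s.im| ≤ x ^ 2 * (1 + w) := by
        have : 0 ≤ w := abs_nonneg _
        have a1 : 10 * x ≤ x ^ 2 := by nlinarith
        have a2 : 1 * w ≤ x ^ 2 * w := by
          apply mul_le_mul_of_nonneg_right _ this; nlinarith
        linarith
      have h7 := Real.log_le_log (by positivity) h6
      have hw0 : 0 ≤ w := abs_nonneg _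
      rw [Real.log_mul (by positivity) (by positivity), Real.log_pow] at h7
      have := Real.log_le_sub_one_of_pos (show 0 < 1 + w by positivity)
      push_cast at h7
      linarith
    have b5 := hgauss s h1 h2
    have b6 : w * Real.exp (-(s.im - x)^2) ≤ 1 := by
      have : (s.im - x)^2 = w^2 := (sq_abs _).symm
      rw [this, Real.exp_neg, ← div_eq_mul_inv, div_le_one (Real.exp_pos _)]
      have := Real.add_one_le_exp (w^2)
      nlinarith [sq_nonneg (w - 1)]
    have b7 : Real.exp (-(s.im - x)^2) ≤ 1 := Real.exp_le_one_iff.2 (by nlinarith [sq_nonneg (s.im - x)])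
    have b8 : 0 < Real.exp (-(s.im - x)^2) := Real.exp_pos _
    calc ‖l s - l (s + e)‖ * ‖Complex.exp ((s - s0) ^ 2)‖
        ≤ (2000 * (2 * Real.log x + w)) * (Real.exp 9 * Real.exp (-(s.im - x)^2)) := by
          apply mul_le_mul _ b5 (norm_nonneg _) (by positivity)
          linarith
      _ = 2000 * Real.exp 9 * (2 * Real.log x * Real.exp (-(s.im - x)^2) + w * Real.exp (-(s.im - x)^2)) := by ring
      _ ≤ 2000 * Real.exp 9 * (2 * Real.log x * 1 + 1) := by gcongr
      _ ≤ 2000 * Real.exp 9 * (6 * Real.log x) := by gcongr; linarith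
      _ = _ := by rw [hK]; ring
  have hright : ∀ s : ℂ, s.re = 1 + e → ‖Φ s‖ ≤ M1 := by
    intro s hs
    have hsb : ‖l s - l (s + e)‖ ≤ 14 := by
      rw [hl.eu s (by linarith), hl.eu (s + e) (by simp; linarith)]
      have h1 := LS_diff s (by linarith) e he.le
      have hz1 := (zeta_real_bounds e he).2
      have hz2 := (zeta_real_bounds (2*e) (by linarith)).1
      have h2 : Real.log ‖riemannZeta s.re‖ - Real.log ‖riemannZeta (s.re + e : ℝ)‖ ≤ 5 := by
        rw [hs, show 1 + e + e = 1 + 2 * e by ring]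
        have hp : 0 < ‖riemannZeta (1 + 2 * e : ℝ)‖ := lt_of_lt_of_le (by positivity) hz2
        have hp1 : 0 < ‖riemannZeta (1 + e : ℝ)‖ := lt_of_lt_of_le (by positivity) (zeta_real_bounds e he).1
        rw [← Real.log_div hp1.ne' hp.ne']
        have : ‖riemannZeta (1 + e : ℝ)‖ / ‖riemannZeta (1 + 2 * e : ℝ)‖ ≤ 7 := by
          rw [div_le_iff₀ hp]
          calc _ ≤ 2 + 1 / e := hz1
            _ ≤ 7 * (1 / (2 * e)) := by
              have i1 : 4 / 5 ≤ 1 / e := by rw [le_div_iff₀ he]; linarith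
              have i2 : 1 / (2 * e) = (1 / e) / 2 := by field_simp
              rw [i2]; linarith
            _ ≤ _ := by gcongr
        have := Real.log_le_log (by positivity) this
        have := Real.log_le_sub_one_of_pos (show (0:ℝ) < 7 / 2 by norm_num)
        have h72 : Real.log 7 = Real.log (7/2) + Real.log 2 := by
          rw [← Real.log_mul (by norm_num) (by norm_num)]; norm_num
        linarith [Real.log_two_lt_d9]
      set w : ℂ := s - 1 with hw
      have hwre : w.re = e := by simp [hw, hs]
      have hw0 : 0 < ‖w‖ := lt_of_lt_of_le (by linarith) (Complex.re_le_norm w)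
      have hwe : e ≤ ‖w‖ := hwre ▸ Complex.re_le_norm w
      have hadd : s + e - 1 = w + e := by rw [hw]; ring
      rw [hadd]
      have hwb : ‖w‖ ≤ ‖w + e‖ := by
        rw [Complex.norm_def, Complex.norm_def]
        apply Real.sqrt_le_sqrt
        simp [Complex.normSq_apply, hwre]
        nlinarith
      have hwb2 : ‖w + e‖ ≤ 2 * ‖w‖ := by
        have := norm_add_le w (e:ℂ)
        rw [Complex.norm_real, Real.norm_of_nonneg he.le] at this
        linarith
      have h3 : ‖Complex.log w - Complex.log (w + e)‖ ≤ 8 := by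
        have h := Complex.norm_le_abs_re_add_abs_im (Complex.log w - Complex.log (w + e))
        rw [Complex.sub_re, Complex.sub_im, Complex.log_re, Complex.log_im, Complex.log_re, Complex.log_im] at h
        have a1 : |Real.log ‖w‖ - Real.log ‖w + e‖| ≤ 1 := by
          have l1 := Real.log_le_log hw0 hwb
          have l2 := Real.log_le_log (by linarith) hwb2
          rw [Real.log_mul (by norm_num) hw0.ne'] at l2
          rw [abs_le]
          constructor <;> linarith [Real.log_two_lt_d9]
        have a2 := abs_sub (Complex.arg w) (Complex.arg (w + e))
        have a3 := Complex.abs_arg_le_pi w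
        have a4 := Complex.abs_arg_le_pi (w + e)
        linarith [Real.pi_lt_d2]
      have : LSeries cz s + Complex.log w - (LSeries cz (s + e) + Complex.log (w + e)) =
        (LSeries cz s - LSeries cz (s + e)) + (Complex.log w - Complex.log (w + e)) := by ring
      rw [this]
      have := norm_add_le (LSeries cz s - LSeries cz (s + e)) (Complex.log w - Complex.log (w + e))
      linarith
    simp only [hΦ, norm_mul]
    have b5 := hgauss s (by linarith) (by linarith)
    have b7 : Real.exp (-(s.im - x)^2) ≤ 1 := Real.exp_le_one_iff.2 (by nlinarith [sq_nonneg (s.im - x)])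
    calc _ ≤ 14 * (Real.exp 9 * 1) := by
          apply mul_le_mul hsb (b5.trans (by gcongr)) (norm_nonneg _) (by norm_num)
      _ = M1 := by rw [hM1]; ring
  have hdiff : DifferentiableOn ℂ Φ {s : ℂ | 1 / 2 < s.re} := by
    apply DifferentiableOn.mul
    · apply hl.diff.sub
      apply hl.diff.comp (differentiableOn_id.add_const _)
      intro s hs
      have hs : 1 / 2 < s.re := hs
      show 1 / 2 < (s + e).re
      simp; linarith
    · fun_prop
  have hsub : Complex.HadamardThreeLines.verticalClosedStrip (3/4) (1 + e) ⊆ {s : ℂ | 1 / 2 < s.re} := by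
    intro s hs
    have := hs.1
    show 1 / 2 < s.re
    linarith
  have hd' : DiffContOnCl ℂ Φ (Complex.HadamardThreeLines.verticalStrip (3/4) (1 + e)) := by
    apply DifferentiableOn.diffContOnCl
    apply hdiff.mono
    have := Complex.closure_preimage_re (Set.Ioo (3/4) (1 + e))
    rw [closure_Ioo (by linarith)] at this
    rw [Complex.HadamardThreeLines.verticalStrip]
    intro s hs
    rw [this] at hs
    exact hsub hs
  have h3 := Complex.HadamardThreeLines.norm_le_interp_of_mem_verticalClosedStrip' (f := Φ) (z := s0)
    (a := K * Real.log x) (b := M1) (l := 3/4) (u := 1 + e) (by linarith) ⟨by simp [hs0]; linarith, by simp [hs0]; linarith⟩ hd'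
    ⟨K * Real.log x, by
      rintro _ ⟨s, hs, rfl⟩
      exact hmain s hs.1 hs.2⟩
    (fun s hs => by
      have hs : s.re = 3/4 := hs
      exact hmain s (by linarith) (by linarith)) (fun s hs => hright s hs)
  have e0 : Φ s0 = l (⟨1 + d, x⟩ : ℂ) - l (⟨1 + d + e, x⟩ : ℂ) := by
    have : s0 + (e:ℂ) = ⟨1 + d + e, x⟩ := by apply Complex.ext <;> simp [hs0]
    simp only [hΦ]
    rw [this]; simp [hs0]
  rw [← e0]
  refine h3.trans ?_
  have hre : s0.re = 1 + d := rfl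
  rw [hre]
  have t1 : (1 + d - 3/4) / (1 + e - 3/4) ≤ 1 := by rw [div_le_one (by linarith)]; linarith
  have t2 : 1 - (1 + d - 3/4) / (1 + e - 3/4) ≤ 4 * e := by
    rw [show 1 - (1 + d - 3/4) / (1 + e - 3/4) = (e - d) / (1 + e - 3/4) by
      rw [eq_div_iff (by linarith), sub_mul, div_mul_cancel₀ _ (by linarith)]; ring]
    rw [div_le_iff₀ (by linarith)]
    nlinarith
  have t3 : 0 ≤ (1 + d - 3/4) / (1 + e - 3/4) := by apply div_nonneg <;> linarith
  have hKl : 1 ≤ K * Real.log x := by nlinarith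
  calc _ ≤ (K * Real.log x) ^ (4 * e) * M1 ^ (1:ℝ) := by
        gcongr
    _ = K ^ (4 * e) * (Real.log x) ^ (4 * e) * M1 := by
        rw [Real.mul_rpow (by positivity) (by positivity), Real.rpow_one]
    _ ≤ K ^ (5:ℝ) * Real.exp 4 * M1 := by
        gcongr
        · linarith
        · rw [Real.rpow_def_of_pos (by linarith)]
          apply Real.exp_le_exp.2
          linarith

end Stmt13

namespace Stmt13

open MeasureTheory Filter Topology

lemma loglog_ge (x : ℝ) (hx : 10 < x) : 4 / 5 ≤ Real.log (Real.log x) := by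
  have h1 : (2.27:ℝ) ≤ Real.log x := by
    have h2 : Real.log 10 ≤ Real.log x := Real.log_le_log (by norm_num) hx.le
    have h3 : Real.log 10 = 3 * Real.log 2 + Real.log (10/8) := by
      rw [show (3:ℝ) = (3:ℕ) by norm_num, ← Real.log_pow, ← Real.log_mul (by norm_num) (by norm_num)]; norm_num
    have h4 := Real.one_sub_inv_le_log_of_pos (show (0:ℝ) < 10/8 by norm_num)
    norm_num at h4
    have := Real.log_two_gt_d9
    norm_num at h3
    norm_num
    linarith
  rw [Real.le_log_iff_exp_le (by linarith)]
  refine le_trans ?_ h1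
  have h5 : (Real.exp (4/5)) ^ 5 ≤ (2.27:ℝ)^5 := by
    rw [← Real.exp_nat_mul]
    have : ((5:ℕ):ℝ) * (4/5) = (4:ℕ) * 1 := by norm_num
    rw [this, Real.exp_nat_mul]
    calc Real.exp 1 ^ 4 ≤ 2.7182818286 ^ 4 := by
          gcongr; exact Real.exp_one_lt_d9.le
      _ ≤ _ := by norm_num
  exact le_of_pow_le_pow_left₀ (by norm_num) (by norm_num) h5

lemma zeta_conj_norm (s : ℂ) (_hs : 1 < s.re) : ‖riemannZeta ((starRingEnd ℂ) s)‖ = ‖riemannZeta s‖ := by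
  rw [riemannZeta_conj, Complex.norm_conj]

lemma log_y_ge (y : ℝ) (hy : 2 ≤ y) : (1:ℝ)/2 ≤ Real.log y := by
  have := Real.log_two_gt_d9
  have := Real.log_le_log (by norm_num) hy
  linarith

lemma gstar_pos (y x : ℝ) (hy : 2 ≤ y) : 0 < gstar y x := by
  have h := log_y_ge y hy
  rw [gstar]
  split_ifs with h1 h2
  · linarith
  · push Not at h1
    have : 0 < x := lt_trans (by positivity) h1.1
    positivity
  · have := loglog_ge x (by linarith)
    linarith

lemma zeta_gstar : ∃ C : ℝ, 0 < C ∧ ((∀ s : ℂ, 1 / 2 < s.re → zf s ≠ 0) → ∀ y : ℝ, 2 ≤ y → ∀ x : ℝ,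
    ‖riemannZeta (⟨1 + 2 / Real.log y, x⟩ : ℂ)‖ ≤ C * gstar y |x|) := by
  obtain ⟨C0, hC0, H⟩ := three_lines_zeta
  refine ⟨1000 + 8 * Real.exp C0, by positivity, ?_⟩
  intro hnz y hy x
  obtain ⟨l, hl⟩ := exists_ZL hnz
  have hlog := log_y_ge y hy
  have hwlog : ‖riemannZeta (⟨1 + 2 / Real.log y, x⟩ : ℂ)‖ = ‖riemannZeta (⟨1 + 2 / Real.log y, |x|⟩ : ℂ)‖ := by
    rcases abs_choice x with h | h
    · rw [h]
    · rw [h, ← zeta_conj_norm (⟨1 + 2 / Real.log y, x⟩ : ℂ) (by show 1 < 1 + 2 / Real.log y; have : 0 < 2 / Real.log y := by positivity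
                                                                linarith)]
      congr 2
  rw [hwlog]
  have hX0 : 0 ≤ |x| := abs_nonneg x
  generalize |x| = X at *
  set d := 2 / Real.log y with hd
  have hd0 : 0 < d := by positivity
  have hd4 : d ≤ 4 := by rw [hd, div_le_iff₀ (by linarith)]; linarith
  set s : ℂ := ⟨1 + d, X⟩ with hs
  have hsre : s.re = 1 + d := rfl
  have hE : 0 < Real.exp C0 := Real.exp_pos _
  rw [gstar]
  split_ifs with h1 h2
  · have := zeta_le_real s (by rw [hsre]; linarith) d hd0 (by rw [hsre]; linarith)
    have e1 : 1 / d = Real.log y / 2 := by rw [hd]; field_simp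
    rw [e1] at this
    nlinarith
  · push Not at h1
    have hXp : 0 < X := lt_trans (by positivity) h1.1
    have hne : s ≠ 1 := by
      intro h; have := congrArg Complex.re h; rw [hsre] at this; simp at this; linarith
    have hg := zf_growth s (by rw [hsre]; linarith)
    rw [zf_of_ne hne, norm_mul] at hg
    have hn1 : ‖s‖ ≤ 15 := by
      have := Complex.norm_le_abs_re_add_abs_im s
      rw [hsre, show s.im = X from rfl, abs_of_pos (by linarith), abs_of_pos hXp] at this
      linarith
    have hn2 : X ≤ ‖s - 1‖ := by
      have := Complex.abs_im_le_norm (s - 1)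
      simp [hs] at this
      rwa [abs_of_pos hXp] at this
    have : X * ‖riemannZeta s‖ ≤ 768 := by
      calc _ ≤ ‖s - 1‖ * ‖riemannZeta s‖ := by gcongr
        _ ≤ 3 * (1 + ‖s‖)^2 := hg
        _ ≤ 3 * (1 + 15)^2 := by gcongr
        _ = _ := by norm_num
    rw [mul_one_div, le_div_iff₀ hXp]
    nlinarith
  · push Not at h2
    have hll := loglog_ge X h2
    set LL := Real.log (Real.log X) with hLL
    have hLLp : 0 < LL := by linarith
    rcases le_or_gt (1 / LL) d with hc | hc
    · have := zeta_le_real s (by rw [hsre]; linarith) (1 / LL) (by positivity) (by rw [hsre]; linarith)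
      rw [one_div_one_div] at this
      nlinarith
    · have h3 := H l hl (1 / LL) (by positivity) (by rw [div_le_iff₀ hLLp]; linarith) X h2
        (by rw [← hLL]; exact le_of_eq (by field_simp)) (by rw [← hLL]; exact le_of_eq (by field_simp)) d hd0 hc.le
      set e := 1 / LL with he
      have he0 : 0 < e := by positivity
      set s' : ℂ := ⟨1 + d + e, X⟩ with hs'
      have hs're : s'.re = 1 + d + e := rfl
      have h4 : ‖zf s‖ ≤ Real.exp C0 * ‖zf s'‖ := by
        rw [← hl.ex s (by rw [hsre]; linarith), ← hl.ex s' (by rw [hs're]; linarith), Complex.norm_exp, Complex.norm_exp,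
          ← Real.exp_add]
        apply Real.exp_le_exp.2
        have := (Complex.re_le_norm (l s - l s')).trans h3
        rw [Complex.sub_re] at this
        linarith
      have hne : s ≠ 1 := by
        intro h; have := congrArg Complex.re h; rw [hsre] at this; simp at this; linarith
      have hne' : s' ≠ 1 := by
        intro h; have := congrArg Complex.re h; rw [hs're] at this; simp at this; linarith
      rw [zf_of_ne hne, zf_of_ne hne', norm_mul, norm_mul] at h4
      have h5 := zeta_le_real s' (by rw [hs're]; linarith) e he0 (by rw [hs're]; linarith)
      have e2 : 1 / e = LL := by rw [he, one_div_one_div]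
      rw [e2] at h5
      have hn2 : X ≤ ‖s - 1‖ := by
        have := Complex.abs_im_le_norm (s - 1)
        simp [hs] at this
        rwa [abs_of_nonneg hX0] at this
      have he54 : e ≤ 2 := by rw [he, div_le_iff₀ hLLp]; linarith
      have hn3 : ‖s' - 1‖ ≤ 2 * ‖s - 1‖ := by
        have : s' - 1 = (s - 1) + (e:ℂ) := by
          apply Complex.ext
          · simp [hs, hs']; ring
          · simp [hs, hs']
        rw [this]
        have := norm_add_le (s - 1) (e:ℂ)
        rw [Complex.norm_real, Real.norm_of_nonneg he0.le] at this
        linarith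
      have hpos : 0 < ‖s - 1‖ := by linarith
      have h6 : ‖s - 1‖ * ‖riemannZeta s‖ ≤ ‖s - 1‖ * (Real.exp C0 * 2 * (2 + LL)) := by
        calc _ ≤ Real.exp C0 * (‖s' - 1‖ * ‖riemannZeta s'‖) := h4
          _ ≤ Real.exp C0 * ((2 * ‖s - 1‖) * (2 + LL)) := by gcongr
          _ = _ := by ring
      have h7 := le_of_mul_le_mul_left h6 hpos
      nlinarith

end Stmt13

namespace Stmt13

open MeasureTheory Filter Topology

lemma prime_cpow_norm (p : Nat.Primes) (s : ℂ) : ‖(p : ℂ) ^ (-s)‖ = (p : ℝ) ^ (-s.re) := by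
  rw [Complex.norm_natCast_cpow_of_pos p.prop.pos]; simp

lemma prime_cpow_summable (s : ℂ) (hs : 1 < s.re) : Summable (fun p : Nat.Primes => (p : ℂ) ^ (-s)) := by
  apply Summable.of_norm
  simp only [prime_cpow_norm]
  exact Nat.Primes.summable_rpow.2 (by linarith)

lemma primes_re_sum_le (s : ℂ) (hs : 1 < s.re) :
    ∑' p : Nat.Primes, ((p : ℂ) ^ (-s)).re ≤ Real.log ‖riemannZeta s‖ + 2 := by
  have hsm := prime_cpow_summable s hs
  have hn : ∀ p : Nat.Primes, ‖(p : ℂ) ^ (-s)‖ ≤ 1 / (p:ℝ) := by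
    intro p
    rw [prime_cpow_norm, Real.rpow_neg (by positivity), one_div]
    have hp : (1:ℝ) ≤ p := by exact_mod_cast p.prop.one_lt.le
    have : (p:ℝ) ^ (1:ℝ) ≤ (p:ℝ) ^ s.re := Real.rpow_le_rpow_of_exponent_le hp hs.le
    rw [Real.rpow_one] at this
    gcongr
  have hb : ∀ p : Nat.Primes, ‖-Complex.log (1 - (p : ℂ) ^ (-s)) - (p : ℂ) ^ (-s)‖ ≤ 1 / (p:ℝ)^2 := by
    intro p
    have hp2 : (2:ℝ) ≤ p := by exact_mod_cast p.prop.two_le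
    have h1 := hn p
    have h2 : (1:ℝ) / p ≤ 1 / 2 := by gcongr
    have hz : ‖-(p : ℂ) ^ (-s)‖ < 1 := by rw [norm_neg]; linarith
    have h3 := Complex.norm_log_one_add_sub_self_le hz
    rw [norm_neg] at h3
    have e1 : -Complex.log (1 - (p : ℂ) ^ (-s)) - (p : ℂ) ^ (-s) = -(Complex.log (1 + -(p : ℂ) ^ (-s)) - -(p : ℂ) ^ (-s)) := by
      rw [← sub_eq_add_neg]; ring
    rw [e1, norm_neg]
    refine h3.trans ?_
    have h4 : (1 - ‖(p : ℂ) ^ (-s)‖)⁻¹ ≤ 2 := by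
      rw [inv_le_comm₀ (by linarith) (by norm_num)]; linarith
    have h5 : 0 ≤ (1 - ‖(p : ℂ) ^ (-s)‖)⁻¹ := inv_nonneg.2 (by linarith)
    have h6 : ‖(p : ℂ) ^ (-s)‖ ^ 2 ≤ (1 / (p:ℝ))^2 := by gcongr
    calc _ ≤ (1 / (p:ℝ))^2 * 2 / 2 := by
          have := mul_le_mul h6 h4 h5 (by positivity)
          linarith
      _ = _ := by rw [one_div, one_div, inv_pow]; ring
  have hs2n : Summable (fun n : ℕ => (1:ℝ) / (n:ℝ) ^ 2) := hasSum_zeta_two.summable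
  have hs2 : Summable (fun p : Nat.Primes => (1:ℝ) / (p:ℝ) ^ 2) := hs2n.subtype _
  have hle2 : ∑' p : Nat.Primes, (1:ℝ) / (p:ℝ) ^ 2 ≤ 2 :=
    (hs2n.tsum_subtype_le (fun n : ℕ => (1:ℝ) / (n:ℝ) ^ 2) {p | p.Prime} (fun n => by positivity)).trans natCast_rpow_sum
  have hsd : Summable (fun p : Nat.Primes => -Complex.log (1 - (p : ℂ) ^ (-s)) - (p : ℂ) ^ (-s)) :=
    Summable.of_norm_bounded hs2 hb
  have hsl : Summable (fun p : Nat.Primes => -Complex.log (1 - (p : ℂ) ^ (-s))) := by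
    have := hsd.add hsm
    simpa using this
  rw [← riemannZeta_eulerProduct_exp_log hs, Complex.norm_exp, Real.log_exp]
  have h5 := tsum_of_norm_bounded hs2.hasSum hb
  rw [hsl.tsum_sub hsm] at h5
  have h6 := Complex.abs_re_le_norm (∑' p : Nat.Primes, -Complex.log (1 - (p : ℂ) ^ (-s)) - ∑' p : Nat.Primes, (p : ℂ) ^ (-s))
  rw [Complex.sub_re] at h6
  have h7 := neg_abs_le ((∑' p : Nat.Primes, -Complex.log (1 - (p : ℂ) ^ (-s))).re - (∑' p : Nat.Primes, (p : ℂ) ^ (-s)).re)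
  rw [← Complex.re_tsum hsm]
  linarith

lemma sum_sq_re {m : ℕ} (z : Fin m → ℂ) : ‖∑ j, z j‖ ^ 2 = ∑ i, ∑ j, (z i * (starRingEnd ℂ) (z j)).re := by
  rw [← Complex.normSq_eq_norm_sq]
  have : ((Complex.normSq (∑ j, z j) : ℝ) : ℂ) = ∑ i, ∑ j, z i * (starRingEnd ℂ) (z j) := by
    rw [← Complex.mul_conj, map_sum, Finset.sum_mul_sum]
  have := congrArg Complex.re this
  rw [Complex.ofReal_re] at this
  rw [this, Complex.re_sum]
  simp [Complex.re_sum]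

/-- weight at prime p -/
noncomputable def wt {m : ℕ} (a : Fin m → ℝ) (y : ℝ) (t : Fin m → ℝ) (p : ℕ) : ℝ :=
  ‖∑ j, (a j : ℂ) * (p : ℂ) ^ (-(1 / 2 + 1 / Real.log y + (t j) * Complex.I : ℂ))‖ ^ 2

lemma wt_eq {m : ℕ} (a : Fin m → ℝ) (y : ℝ) (t : Fin m → ℝ) (p : ℕ) (hp : p.Prime) :
    wt a y t p = ∑ i, ∑ j, a i * a j * ((p : ℂ) ^ (-(⟨1 + 2 / Real.log y, t i - t j⟩ : ℂ))).re := by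
  rw [wt, sum_sq_re]
  apply sum_congr rfl; intro i _; apply sum_congr rfl; intro j _
  have hp0 : (p:ℂ) ≠ 0 := by exact_mod_cast hp.ne_zero
  rw [map_mul, Complex.conj_ofReal]
  have h1 : (starRingEnd ℂ) ((p : ℂ) ^ (-(1 / 2 + 1 / Real.log y + (t j) * Complex.I : ℂ))) =
      (p : ℂ) ^ ((starRingEnd ℂ) (-(1 / 2 + 1 / Real.log y + (t j) * Complex.I : ℂ))) := by
    have := Complex.cpow_conj (p:ℂ) (-(1 / 2 + 1 / Real.log y + (t j) * Complex.I : ℂ)) (by rw [Complex.natCast_arg]; exact Real.pi_pos.ne)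
    rw [this, map_natCast]
  rw [h1]
  have h2 : (a i : ℂ) * (p : ℂ) ^ (-(1 / 2 + 1 / Real.log y + (t i) * Complex.I : ℂ)) * ((a j : ℂ) * (p : ℂ) ^ ((starRingEnd ℂ) (-(1 / 2 + 1 / Real.log y + (t j) * Complex.I : ℂ))))
    = ((a i * a j : ℝ) : ℂ) * (p : ℂ) ^ (-(⟨1 + 2 / Real.log y, t i - t j⟩ : ℂ)) := by
    have h3 : (-(⟨1 + 2 / Real.log y, t i - t j⟩ : ℂ)) = -(1 / 2 + 1 / Real.log y + (t i) * Complex.I : ℂ) + (starRingEnd ℂ) (-(1 / 2 + 1 / Real.log y + (t j) * Complex.I : ℂ)) := by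
      have hc : (1 / 2 + 1 / Real.log y : ℂ) = ((1/2 + 1/Real.log y : ℝ) : ℂ) := by push_cast; ring
      rw [hc]
      apply Complex.ext
      · simp; ring
      · simp; ring
    rw [h3, Complex.cpow_add _ _ hp0]
    push_cast
    ring
  rw [h2, Complex.re_ofReal_mul]

lemma wt_nonneg {m : ℕ} (a : Fin m → ℝ) (y : ℝ) (t : Fin m → ℝ) (p : ℕ) : 0 ≤ wt a y t p := by
  rw [wt]; positivity

lemma wt_sum_le {m : ℕ} (a : Fin m → ℝ) (ha : ∀ j, 0 ≤ a j) (y : ℝ) (hy : 2 ≤ y) (t : Fin m → ℝ) (S : Finset ℕ)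
    (hS : ∀ p ∈ S, p.Prime) :
    ∑ p ∈ S, wt a y t p ≤ ∑ i, ∑ j, a i * a j * (Real.log ‖riemannZeta (⟨1 + 2 / Real.log y, t i - t j⟩ : ℂ)‖ + 2) := by
  have hlog := log_y_ge y hy
  have hre : ∀ i j, 1 < (⟨1 + 2 / Real.log y, t i - t j⟩ : ℂ).re := by
    intro i j
    show 1 < 1 + 2 / Real.log y
    have : 0 < 2 / Real.log y := by positivity
    linarith
  have hsum : ∀ i j, Summable (fun p : Nat.Primes => a i * a j * ((p : ℂ) ^ (-(⟨1 + 2 / Real.log y, t i - t j⟩ : ℂ))).re) := by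
    intro i j
    apply Summable.mul_left
    exact Complex.reCLM.summable (prime_cpow_summable _ (hre i j))
  have hwsum : Summable (fun p : Nat.Primes => wt a y t p) := by
    have : (fun p : Nat.Primes => wt a y t p) = fun p : Nat.Primes => ∑ i, ∑ j, a i * a j * ((p : ℂ) ^ (-(⟨1 + 2 / Real.log y, t i - t j⟩ : ℂ))).re := by
      ext p; exact wt_eq a y t p p.prop
    rw [this]
    exact summable_sum (fun i _ => summable_sum (fun j _ => hsum i j))
  have h1 : ∑ p ∈ S, wt a y t p = ∑ p ∈ S.subtype Nat.Prime, wt a y t p := by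
    symm
    exact Finset.sum_subtype_of_mem (wt a y t) hS
  rw [h1]
  have h2 : ∑ p ∈ S.subtype Nat.Prime, wt a y t p ≤ ∑' p : Nat.Primes, wt a y t p :=
    Summable.sum_le_tsum (f := fun p : Nat.Primes => wt a y t p) (S.subtype Nat.Prime) (fun p _ => wt_nonneg a y t p) hwsum
  refine h2.trans ?_
  have h3 : ∑' p : Nat.Primes, wt a y t p = ∑ i, ∑ j, a i * a j * ∑' p : Nat.Primes, ((p : ℂ) ^ (-(⟨1 + 2 / Real.log y, t i - t j⟩ : ℂ))).re := by
    have : (fun p : Nat.Primes => wt a y t p) = fun p : Nat.Primes => ∑ i, ∑ j, a i * a j * ((p : ℂ) ^ (-(⟨1 + 2 / Real.log y, t i - t j⟩ : ℂ))).re := by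
      ext p; exact wt_eq a y t p p.prop
    rw [this, Summable.tsum_finsetSum (fun i _ => summable_sum (fun j _ => hsum i j))]
    apply sum_congr rfl; intro i _
    rw [Summable.tsum_finsetSum (fun j _ => hsum i j)]
    apply sum_congr rfl; intro j _
    rw [tsum_mul_left]
  rw [h3]
  apply sum_le_sum; intro i _; apply sum_le_sum; intro j _
  apply mul_le_mul_of_nonneg_left (primes_re_sum_le _ (hre i j))
  exact mul_nonneg (ha i) (ha j)

lemma sum_symm_split {m : ℕ} (g : Fin m → Fin m → ℝ) (hg : ∀ i j, g i j = g j i) :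
    ∑ i, ∑ j, g i j = ∑ i, g i i + 2 * ∑ i, ∑ j, (if i < j then g i j else 0) := by
  have h1 : ∀ i j, g i j = (if i = j then g i j else 0) + (if i < j then g i j else 0) + (if j < i then g i j else 0) := by
    intro i j
    rcases lt_trichotomy i j with h | h | h
    · simp [h, h.ne, h.not_gt]
    · simp [h]
    · simp [h, h.ne', h.not_gt]
  have h2 : ∑ i, ∑ j, (if j < i then g i j else 0) = ∑ i, ∑ j, (if i < j then g i j else 0) := by
    rw [sum_comm]
    apply sum_congr rfl; intro i _; apply sum_congr rfl; intro j _
    rw [hg]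
  calc ∑ i, ∑ j, g i j = ∑ i, ∑ j, ((if i = j then g i j else 0) + (if i < j then g i j else 0) + (if j < i then g i j else 0)) := by
        apply sum_congr rfl; intro i _; apply sum_congr rfl; intro j _; exact h1 i j
    _ = _ := by
        simp only [sum_add_distrib]
        rw [h2]
        simp
        ring

lemma W_bound {m : ℕ} (a : Fin m → ℝ) (ha : ∀ j, 0 ≤ a j) : ∃ C : ℝ, 0 < C ∧
    ((∀ s : ℂ, 1 / 2 < s.re → zf s ≠ 0) → ∀ y : ℝ, 2 ≤ y → ∀ t : Fin m → ℝ, ∀ S : Finset ℕ, (∀ p ∈ S, p.Prime) →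
      Real.exp ((∑ p ∈ S, wt a y t p) / 4) ≤ C * Real.log y ^ ((∑ j, (a j) ^ 2) / 4) *
        ∏ i, ∏ j, if i < j then gstar y |t i - t j| ^ (a i * a j / 2) else 1) := by
  obtain ⟨C0, hC0, H⟩ := zeta_gstar
  refine ⟨Real.exp (∑ i, ∑ j, a i * a j * (Real.log C0 + 2) / 4), Real.exp_pos _, ?_⟩
  intro hnz y hy t S hS
  have hlog := log_y_ge y hy
  have h1 := wt_sum_le a ha y hy t S hS
  have h2 : ∑ i, ∑ j, a i * a j * (Real.log ‖riemannZeta (⟨1 + 2 / Real.log y, t i - t j⟩ : ℂ)‖ + 2)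
     ≤ ∑ i, ∑ j, (a i * a j * (Real.log C0 + 2) + a i * a j * Real.log (gstar y |t i - t j|)) := by
    apply sum_le_sum; intro i _; apply sum_le_sum; intro j _
    rw [← mul_add]
    apply mul_le_mul_of_nonneg_left _ (mul_nonneg (ha i) (ha j))
    have hp := gstar_pos y |t i - t j| hy
    have hzp : 0 < ‖riemannZeta (⟨1 + 2 / Real.log y, t i - t j⟩ : ℂ)‖ := by
      apply norm_pos_iff.2
      apply riemannZeta_ne_zero_of_one_lt_re
      show 1 < 1 + 2 / Real.log y
      have : 0 < 2 / Real.log y := by positivity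
      linarith
    have := Real.log_le_log hzp (H hnz y hy (t i - t j))
    rw [Real.log_mul hC0.ne' hp.ne'] at this
    linarith
  have h3 : ∑ i, ∑ j, a i * a j * Real.log (gstar y |t i - t j|) =
      (∑ j, (a j)^2) * Real.log (Real.log y) + 2 * ∑ i, ∑ j, (if i < j then a i * a j * Real.log (gstar y |t i - t j|) else 0) := by
    rw [sum_symm_split]
    · congr 1
      rw [sum_mul]
      apply sum_congr rfl; intro i _
      have : gstar y |t i - t i| = Real.log y := by
        rw [gstar, if_pos]; left; simp; linarith
      rw [this]; ring
    · intro i j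
      rw [abs_sub_comm, mul_comm (a i)]
  have h4 : (∏ i, ∏ j, if i < j then gstar y |t i - t j| ^ (a i * a j / 2) else 1) =
     Real.exp (∑ i, ∑ j, (if i < j then a i * a j * Real.log (gstar y |t i - t j|) else 0) / 2) := by
    rw [Real.exp_sum]
    apply prod_congr rfl; intro i _
    rw [Real.exp_sum]
    apply prod_congr rfl; intro j _
    split_ifs
    · rw [Real.rpow_def_of_pos (gstar_pos _ _ hy)]; congr 1; ring
    · simp
  rw [h4, Real.rpow_def_of_pos (by linarith), ← Real.exp_add, ← Real.exp_add]
  apply Real.exp_le_exp.2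
  simp only [sum_add_distrib] at h2
  rw [h3] at h2
  simp only [← sum_div]
  linarith

end Stmt13

namespace Stmt13

open MeasureTheory Filter Topology

/-- finitely supported Dirichlet polynomials as a monoid algebra -/
abbrev MA (𝕜 : Type) [NormedField 𝕜] := MonoidAlgebra 𝕜 ℕ

lemma ma_coeff_mul {𝕜 : Type} [NormedField 𝕜] (x y : MA 𝕜) (n : ℕ) (s t : Finset ℕ) (hs : x.coeff.support ⊆ s)
    (ht : y.coeff.support ⊆ t) :
    (x * y).coeff n = ∑ a ∈ s, ∑ b ∈ t, if a * b = n then x.coeff a * y.coeff b else 0 := by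
  classical
  rw [MonoidAlgebra.coeff_mul, Finsupp.sum_of_support_subset _ hs]
  · apply sum_congr rfl; intro a _
    rw [Finsupp.sum_of_support_subset _ ht]
    intro i _; simp
  · intro i _; simp [Finsupp.sum]

/-- support predicate -/
def Sup {𝕜 : Type} [NormedField 𝕜] (F : MA 𝕜) (pr : ℕ → Prop) : Prop := ∀ n, F.coeff n ≠ 0 → pr n

lemma Sup.add {𝕜 : Type} [NormedField 𝕜] {F G : MA 𝕜} {pr : ℕ → Prop} (hF : Sup F pr) (hG : Sup G pr) :
    Sup (F + G) pr := by
  intro n hn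
  by_cases h : F.coeff n = 0
  · apply hG; intro h'; apply hn; simp [h, h']
  · exact hF n h

lemma Sup.zero {𝕜 : Type} [NormedField 𝕜] {pr : ℕ → Prop} : Sup (0 : MA 𝕜) pr := by
  intro n hn; simp at hn

lemma Sup.sum {𝕜 : Type} [NormedField 𝕜] {ι : Type} (s : Finset ι) {F : ι → MA 𝕜} {pr : ℕ → Prop}
    (hF : ∀ i ∈ s, Sup (F i) pr) : Sup (∑ i ∈ s, F i) pr := by
  classical
  induction s using Finset.induction_on with
  | empty => simpa using Sup.zero
  | insert i s hi ih =>
    rw [sum_insert hi]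
    exact (hF i (mem_insert_self _ _)).add (ih (fun j hj => hF j (mem_insert_of_mem hj)))

lemma Sup.smul {𝕜 : Type} [NormedField 𝕜] {F : MA 𝕜} {pr : ℕ → Prop} (c : 𝕜) (hF : Sup F pr) : Sup (c • F) pr := by
  intro n hn
  apply hF; intro h; apply hn; simp [h]

lemma Sup.single {𝕜 : Type} [NormedField 𝕜] (n : ℕ) (c : 𝕜) {pr : ℕ → Prop} (h : pr n) : Sup (MonoidAlgebra.single n c) pr := by
  classical
  intro k hk
  rw [MonoidAlgebra.coeff_single, Finsupp.single_apply] at hk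
  by_cases h' : n = k
  · rwa [← h']
  · simp [h'] at hk

lemma Sup.one {𝕜 : Type} [NormedField 𝕜] {pr : ℕ → Prop} (h : pr 1) : Sup (1 : MA 𝕜) pr := by
  rw [MonoidAlgebra.one_def]; exact Sup.single _ _ h

lemma Sup.mul {𝕜 : Type} [NormedField 𝕜] {F G : MA 𝕜} {p1 p2 p3 : ℕ → Prop} (h : ∀ a b, p1 a → p2 b → p3 (a * b))
    (hF : Sup F p1) (hG : Sup G p2) : Sup (F * G) p3 := by
  intro n hn
  rw [ma_coeff_mul F G n _ _ (Finset.Subset.refl _) (Finset.Subset.refl _)] at hn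
  obtain ⟨a, ha, h1⟩ := exists_ne_zero_of_sum_ne_zero hn
  obtain ⟨b, hb, h2⟩ := exists_ne_zero_of_sum_ne_zero h1
  split_ifs at h2 with h3
  · rw [← h3]
    exact h a b (hF a (Finsupp.mem_support_iff.1 ha)) (hG b (Finsupp.mem_support_iff.1 hb))
  · exact absurd rfl h2

/-- coefficientwise majorization -/
def Maj {𝕜 : Type} [NormedField 𝕜] (F : MA 𝕜) (G : MA ℝ) : Prop := ∀ n, ‖F.coeff n‖ ≤ G.coeff n

lemma Maj.zero {𝕜 : Type} [NormedField 𝕜] : Maj (0 : MA 𝕜) 0 := by intro n; simp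

lemma Maj.single {𝕜 : Type} [NormedField 𝕜] (n : ℕ) (c : 𝕜) (d : ℝ) (h : ‖c‖ ≤ d) :
    Maj (MonoidAlgebra.single n c) (MonoidAlgebra.single n d) := by
  classical
  intro k
  simp only [MonoidAlgebra.coeff_single, Finsupp.single_apply]
  split_ifs
  · exact h
  · simp

lemma Maj.one {𝕜 : Type} [NormedField 𝕜] : Maj (1 : MA 𝕜) 1 := by
  rw [MonoidAlgebra.one_def, MonoidAlgebra.one_def]; exact Maj.single _ _ _ (by simp)

lemma Maj.add {𝕜 : Type} [NormedField 𝕜] {F F' : MA 𝕜} {G G' : MA ℝ} (h : Maj F G) (h' : Maj F' G') : Maj (F + F') (G + G') := by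
  intro n
  simp only [MonoidAlgebra.coeff_add, Finsupp.add_apply]
  exact (norm_add_le _ _).trans (add_le_add (h n) (h' n))

lemma Maj.smul {𝕜 : Type} [NormedField 𝕜] {F : MA 𝕜} {G : MA ℝ} (c : 𝕜) (d : ℝ) (hc : ‖c‖ ≤ d) (h : Maj F G) : Maj (c • F) (d • G) := by
  intro n
  simp only [MonoidAlgebra.coeff_smul, Finsupp.smul_apply, smul_eq_mul, norm_mul]
  exact mul_le_mul hc (h n) (norm_nonneg _) ((norm_nonneg _).trans hc)

lemma Maj.mul {𝕜 : Type} [NormedField 𝕜] {F F' : MA 𝕜} {G G' : MA ℝ} (h : Maj F G) (h' : Maj F' G') : Maj (F * F') (G * G') := by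
  classical
  intro n
  rw [ma_coeff_mul F F' n (F.coeff.support ∪ G.coeff.support) (F'.coeff.support ∪ G'.coeff.support) subset_union_left subset_union_left,
    ma_coeff_mul G G' n (F.coeff.support ∪ G.coeff.support) (F'.coeff.support ∪ G'.coeff.support) subset_union_right subset_union_right]
  refine (norm_sum_le _ _).trans (sum_le_sum fun a _ => ?_)
  refine (norm_sum_le _ _).trans (sum_le_sum fun b _ => ?_)
  split_ifs
  · rw [norm_mul]
    exact mul_le_mul (h a) (h' b) (norm_nonneg _) ((norm_nonneg _).trans (h a))
  · simp

lemma Maj.pow {𝕜 : Type} [NormedField 𝕜] {F : MA 𝕜} {G : MA ℝ} (h : Maj F G) (k : ℕ) : Maj (F ^ k) (G ^ k) := by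
  induction k with
  | zero => simpa using Maj.one
  | succ k ih => rw [pow_succ, pow_succ]; exact ih.mul h

lemma Maj.sum {𝕜 : Type} [NormedField 𝕜] {ι : Type} (s : Finset ι) {F : ι → MA 𝕜} {G : ι → MA ℝ}
    (h : ∀ i ∈ s, Maj (F i) (G i)) : Maj (∑ i ∈ s, F i) (∑ i ∈ s, G i) := by
  classical
  induction s using Finset.induction_on with
  | empty => simpa using Maj.zero
  | insert i s hi ih =>
    rw [sum_insert hi, sum_insert hi]
    exact (h i (mem_insert_self _ _)).add (ih (fun j hj => h j (mem_insert_of_mem hj)))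

lemma Maj.prod {𝕜 : Type} [NormedField 𝕜] {ι : Type} (s : Finset ι) {F : ι → MA 𝕜} {G : ι → MA ℝ}
    (h : ∀ i ∈ s, Maj (F i) (G i)) : Maj (∏ i ∈ s, F i) (∏ i ∈ s, G i) := by
  classical
  induction s using Finset.induction_on with
  | empty => simpa using Maj.one
  | insert i s hi ih =>
    rw [prod_insert hi, prod_insert hi]
    exact (h i (mem_insert_self _ _)).mul (ih (fun j hj => h j (mem_insert_of_mem hj)))

lemma Maj.trans {𝕜 : Type} [NormedField 𝕜] {F : MA 𝕜} {G H : MA ℝ} (h : Maj F G) (hGH : Maj G H) : Maj F H := by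
  intro n
  exact (h n).trans ((le_abs_self _).trans (hGH n))

/-- nonnegative real Dirichlet polynomial -/
def NN (G : MA ℝ) : Prop := ∀ n, 0 ≤ G.coeff n

lemma NN.maj {G : MA ℝ} (h : NN G) : Maj G G := fun n => by rw [Real.norm_of_nonneg (h n)]

lemma Maj.nn {𝕜 : Type} [NormedField 𝕜] {F : MA 𝕜} {G : MA ℝ} (h : Maj F G) : NN G := fun n => (norm_nonneg _).trans (h n)

/-- square norm -/
noncomputable def nrm2 (G : MA ℝ) : ℝ := ∑ n ∈ G.coeff.support, (G.coeff n) ^ 2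

lemma nrm2_eq (G : MA ℝ) (s : Finset ℕ) (h : G.coeff.support ⊆ s) : nrm2 G = ∑ n ∈ s, (G.coeff n) ^ 2 := by
  apply sum_subset h
  intro n _ hn
  rw [Finsupp.notMem_support_iff] at hn; simp [hn]

lemma nrm2_nonneg (G : MA ℝ) : 0 ≤ nrm2 G := sum_nonneg fun _ _ => sq_nonneg _

lemma nrm2_one : nrm2 1 = 1 := by
  rw [nrm2_eq 1 {1}]
  · simp
  · intro n hn
    rw [Finsupp.mem_support_iff] at hn
    have := Sup.one (𝕜 := ℝ) (pr := fun n => n = 1) rfl n hn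
    simpa using this

lemma nrm2_smul (c : ℝ) (G : MA ℝ) : nrm2 (c • G) = c ^ 2 * nrm2 G := by
  rw [nrm2_eq (c • G) G.coeff.support, nrm2, mul_sum]
  · apply sum_congr rfl; intro n _; simp; ring
  · intro n hn
    rw [Finsupp.mem_support_iff] at hn ⊢
    intro h; apply hn; simp [h]

lemma nrm2_mono {F G : MA ℝ} (h : Maj F G) : nrm2 F ≤ nrm2 G := by
  classical
  rw [nrm2_eq F (F.coeff.support ∪ G.coeff.support) subset_union_left, nrm2_eq G (F.coeff.support ∪ G.coeff.support) subset_union_right]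
  apply sum_le_sum; intro n _
  rw [← sq_abs]
  exact pow_le_pow_left₀ (abs_nonneg _) (h n) 2

lemma nrm2_mul (F G : MA ℝ) (h : ∀ a b, F.coeff a ≠ 0 → G.coeff b ≠ 0 → Nat.Coprime a b) :
    nrm2 (F * G) ≤ nrm2 F * nrm2 G := by
  classical
  set s := F.coeff.support
  set t := G.coeff.support
  have hinj : ∀ x ∈ s ×ˢ t, ∀ z ∈ s ×ˢ t, x.1 * x.2 = z.1 * z.2 → x = z := by
    rintro ⟨a, b⟩ hx ⟨a', b'⟩ hz he
    simp only [mem_product, s, t, Finsupp.mem_support_iff] at hx hz he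
    have h1 : a ∣ a' := by
      have : a ∣ a' * b' := ⟨b, he.symm⟩
      exact (h a b' hx.1 hz.2).dvd_of_dvd_mul_right this
    have h2 : a' ∣ a := by
      have : a' ∣ a * b := ⟨b', he⟩
      exact (h a' b hz.1 hx.2).dvd_of_dvd_mul_right this
    have h3 : b ∣ b' := by
      have : b ∣ a' * b' := ⟨a, by rw [← he]; ring⟩
      exact (h a' b hz.1 hx.2).symm.dvd_of_dvd_mul_left this
    have h4 : b' ∣ b := by
      have : b' ∣ a * b := ⟨a', by rw [he]; ring⟩
      exact (h a b' hx.1 hz.2).symm.dvd_of_dvd_mul_left this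
    rw [Nat.dvd_antisymm h1 h2, Nat.dvd_antisymm h3 h4]
  have hsub : (F * G).coeff.support ⊆ (s ×ˢ t).image (fun x => x.1 * x.2) := by
    intro n hn
    rw [Finsupp.mem_support_iff] at hn
    have := Sup.mul (F := F) (G := G) (p1 := fun a => a ∈ s) (p2 := fun b => b ∈ t) (p3 := fun n => n ∈ (s ×ˢ t).image (fun x => x.1 * x.2))
      (fun a b ha hb => mem_image.2 ⟨(a, b), mem_product.2 ⟨ha, hb⟩, rfl⟩) (fun n hn => Finsupp.mem_support_iff.2 hn)
      (fun n hn => Finsupp.mem_support_iff.2 hn)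
    exact this n hn
  rw [nrm2_eq _ _ hsub, sum_image hinj, nrm2, nrm2, sum_mul_sum, ← sum_product']
  apply le_of_eq
  apply sum_congr rfl
  rintro ⟨a, b⟩ hx
  have : (F * G).coeff (a * b) = F.coeff a * G.coeff b := by
    rw [ma_coeff_mul F G _ s t (Finset.Subset.refl _) (Finset.Subset.refl _), ← sum_product', sum_eq_single (a, b)]
    · simp
    · intro z hz hne
      rw [if_neg]
      intro he
      exact hne (hinj z hz (a, b) hx he)
    · intro h; exact absurd hx h
  simp only [this]; ring

lemma nrm2_prod_primes (S : Finset ℕ) (hS : ∀ p ∈ S, p.Prime) (f : ℕ → MA ℝ)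
    (hf : ∀ p ∈ S, Sup (f p) (fun n => ∃ k, n = p ^ k)) : nrm2 (∏ p ∈ S, f p) ≤ ∏ p ∈ S, nrm2 (f p) := by
  classical
  have hsup : ∀ T ⊆ S, Sup (∏ p ∈ T, f p) (fun n => ∀ p, p.Prime → p ∣ n → p ∈ T) := by
    intro T
    induction T using Finset.induction_on with
    | empty =>
      intro _
      rw [prod_empty]
      apply Sup.one
      intro p hp hd
      exact absurd (Nat.dvd_one.1 hd) hp.ne_one
    | insert r T hr ih =>
      intro hT
      rw [prod_insert hr]
      refine Sup.mul ?_ (hf r (hT (mem_insert_self _ _))) (ih (fun x hx => hT (mem_insert_of_mem hx)))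
      rintro a b ⟨k, rfl⟩ hb p hp hd
      rcases (Nat.Prime.dvd_mul hp).1 hd with h | h
      · have := (Nat.prime_dvd_prime_iff_eq hp (hS r (hT (mem_insert_self _ _)))).1 (hp.dvd_of_dvd_pow h)
        rw [this]; exact mem_insert_self _ _
      · exact mem_insert_of_mem (hb p hp h)
  have main : ∀ T ⊆ S, nrm2 (∏ p ∈ T, f p) ≤ ∏ p ∈ T, nrm2 (f p) := by
    intro T
    induction T using Finset.induction_on with
    | empty => intro _; simp [nrm2_one]
    | insert r T hr ih =>
      intro hT
      rw [prod_insert hr, prod_insert hr]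
      have hT' : T ⊆ S := fun x hx => hT (mem_insert_of_mem hx)
      have hrS := hT (mem_insert_self r T)
      refine (nrm2_mul _ _ ?_).trans (mul_le_mul_of_nonneg_left (ih hT') (nrm2_nonneg _))
      intro a b ha hb
      obtain ⟨k, rfl⟩ := hf r hrS a ha
      have hb' := hsup T hT' b hb
      apply Nat.Coprime.pow_left
      rw [Nat.Prime.coprime_iff_not_dvd (hS r hrS)]
      intro hd
      exact hr (hb' r (hS r hrS) hd)
  exact main S (Finset.Subset.refl _)

end Stmt13

namespace Stmt13

open MeasureTheory Filter Topology

/-- evaluation at a character -/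
noncomputable def chN {q : ℕ} (χ : DirichletCharacter ℂ q) : ℕ →* ℂ :=
  (χ.toMonoidHom : ZMod q →* ℂ).comp (Nat.castRingHom (ZMod q) : ℕ →* ZMod q)

lemma chN_apply {q : ℕ} (χ : DirichletCharacter ℂ q) (n : ℕ) : chN χ n = χ (n : ZMod q) := rfl

lemma chN_norm {q : ℕ} (χ : DirichletCharacter ℂ q) (n : ℕ) : ‖chN χ n‖ ≤ 1 := by
  rw [chN_apply]; exact χ.norm_le_one _

lemma sum_chN {q : ℕ} [NeZero q] (a b : ℕ) (ha : a < q) (hb : b < q) (hne : a ≠ b) :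
    ∑ χ : DirichletCharacter ℂ q, chN χ a * (starRingEnd ℂ) (chN χ b) = 0 := by
  by_cases hu : IsUnit (b : ZMod q)
  · have h0 : ∀ χ : DirichletCharacter ℂ q, chN χ a * (starRingEnd ℂ) (chN χ b) = χ ((b : ZMod q)⁻¹) * χ (a : ZMod q) := by
      intro χ
      rw [chN_apply, chN_apply, starRingEnd_apply, MulChar.star_apply']
      obtain ⟨u, hu⟩ := hu
      rw [← hu, MulChar.inv_apply, Ring.inverse_unit, mul_comm, ZMod.inv_coe_unit]
    rw [sum_congr rfl (fun χ _ => h0 χ), DirichletCharacter.sum_char_inv_mul_char_eq ℂ hu, if_neg]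
    intro he
    have := congrArg ZMod.val he
    rw [ZMod.val_cast_of_lt ha, ZMod.val_cast_of_lt hb] at this
    exact hne this.symm
  · apply sum_eq_zero; intro χ _
    rw [chN_apply χ b, MulChar.map_nonunit _ hu]; simp

/-- evaluation -/
noncomputable def ev {q : ℕ} (χ : DirichletCharacter ℂ q) : MA ℂ →ₐ[ℂ] ℂ := MonoidAlgebra.lift ℂ ℂ ℕ (chN χ)

lemma ev_single {q : ℕ} (χ : DirichletCharacter ℂ q) (n : ℕ) (c : ℂ) : ev χ (MonoidAlgebra.single n c) = c * χ (n : ZMod q) := by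
  rw [ev, MonoidAlgebra.lift_single, smul_eq_mul, chN_apply]

lemma card_chars {q : ℕ} [NeZero q] : (Fintype.card (DirichletCharacter ℂ q) : ℝ) = Nat.totient q := by
  rw [← Nat.card_eq_fintype_card, DirichletCharacter.card_eq_totient_of_hasEnoughRootsOfUnity ℂ q]

lemma ev_sum {q : ℕ} [NeZero q] (F : MA ℂ) (G : MA ℝ) (hM : Maj F G) (hS : Sup F (fun n => n < q)) :
    ∑ χ : DirichletCharacter ℂ q, ‖ev χ F‖ ^ 2 ≤ Nat.totient q * nrm2 G := by
  classical
  set s := F.coeff.support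
  have hlt : ∀ n ∈ s, n < q := fun n hn => hS n (Finsupp.mem_support_iff.1 hn)
  have h1 : ∀ χ : DirichletCharacter ℂ q, ev χ F = ∑ n ∈ s, F.coeff n * chN χ n := by
    intro χ; rw [ev, MonoidAlgebra.lift_apply, Finsupp.sum]; rfl
  have h2 : ∀ χ : DirichletCharacter ℂ q, ((‖ev χ F‖ ^ 2 : ℝ) : ℂ) =
      ∑ a ∈ s, ∑ b ∈ s, (F.coeff a * (starRingEnd ℂ) (F.coeff b)) * (chN χ a * (starRingEnd ℂ) (chN χ b)) := by
    intro χ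
    rw [← Complex.normSq_eq_norm_sq, ← Complex.mul_conj, h1, map_sum, sum_mul_sum]
    apply sum_congr rfl; intro a _; apply sum_congr rfl; intro b _
    rw [map_mul]; ring
  have h3 : ((∑ χ : DirichletCharacter ℂ q, ‖ev χ F‖ ^ 2 : ℝ) : ℂ) =
      ∑ a ∈ s, (F.coeff a * (starRingEnd ℂ) (F.coeff a)) * ∑ χ : DirichletCharacter ℂ q, (chN χ a * (starRingEnd ℂ) (chN χ a)) := by
    rw [Complex.ofReal_sum, sum_congr rfl (fun χ _ => h2 χ), sum_comm]
    apply sum_congr rfl; intro a ha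
    rw [sum_comm, sum_eq_single a]
    · rw [mul_sum]
    · intro b hb hne
      rw [← mul_sum, sum_chN a b (hlt a ha) (hlt b hb) hne.symm, mul_zero]
    · intro h; exact absurd ha h
  have h4 : (∑ χ : DirichletCharacter ℂ q, ‖ev χ F‖ ^ 2 : ℝ) = ∑ a ∈ s, ‖F.coeff a‖ ^ 2 * ∑ χ : DirichletCharacter ℂ q, ‖chN χ a‖ ^ 2 := by
    have : ∀ z : ℂ, z * (starRingEnd ℂ) z = ((‖z‖ ^ 2 : ℝ) : ℂ) := by
      intro z; rw [Complex.mul_conj, Complex.normSq_eq_norm_sq]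
    simp only [this] at h3
    exact_mod_cast h3
  rw [h4]
  have h5 : ∀ a, ∑ χ : DirichletCharacter ℂ q, ‖chN χ a‖ ^ 2 ≤ (Nat.totient q : ℝ) := by
    intro a
    rw [← card_chars]
    calc ∑ χ : DirichletCharacter ℂ q, ‖chN χ a‖ ^ 2 ≤ ∑ χ : DirichletCharacter ℂ q, (1:ℝ) :=
          sum_le_sum fun χ _ => pow_le_one₀ (norm_nonneg _) (chN_norm χ a)
      _ = _ := by simp
  have hsub : s ∪ G.coeff.support ⊆ s ∪ G.coeff.support := Finset.Subset.refl _
  calc ∑ a ∈ s, ‖F.coeff a‖ ^ 2 * ∑ χ : DirichletCharacter ℂ q, ‖chN χ a‖ ^ 2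
      ≤ ∑ a ∈ s, (G.coeff a) ^ 2 * (Nat.totient q : ℝ) := by
        apply sum_le_sum; intro a _
        exact mul_le_mul (pow_le_pow_left₀ (norm_nonneg _) (hM a) 2) (h5 a) (sum_nonneg fun _ _ => by positivity) (sq_nonneg _)
    _ = (Nat.totient q : ℝ) * ∑ a ∈ s, (G.coeff a) ^ 2 := by rw [← sum_mul, mul_comm]
    _ ≤ (Nat.totient q : ℝ) * ∑ a ∈ s ∪ G.coeff.support, (G.coeff a) ^ 2 := by
        apply mul_le_mul_of_nonneg_left _ (by positivity)
        exact sum_le_sum_of_subset_of_nonneg subset_union_left (fun _ _ _ => sq_nonneg _)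
    _ = _ := by rw [nrm2_eq G _ subset_union_right]

/-- truncated exponential -/
noncomputable def En {𝕜 : Type} [NormedField 𝕜] (n : ℕ) (x : MA 𝕜) : MA 𝕜 := ∑ k ∈ range n, ((k.factorial : 𝕜)⁻¹) • x ^ k

lemma ev_En {q : ℕ} (χ : DirichletCharacter ℂ q) (n : ℕ) (x : MA ℂ) :
    ev χ (En n x) = ∑ k ∈ range n, (ev χ x) ^ k / (k.factorial : ℂ) := by
  rw [En, map_sum]
  apply sum_congr rfl; intro k _
  rw [map_smul, map_pow, smul_eq_mul]; ring

lemma En_maj {n : ℕ} {x : MA ℂ} {X : MA ℝ} (h : Maj x X) : Maj (En n x) (En n X) := by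
  apply Maj.sum; intro k _
  apply Maj.smul _ _ _ (h.pow k)
  simp

lemma En_nn {n : ℕ} {X : MA ℝ} (h : NN X) : NN (En n X) := by
  apply Maj.nn (F := En n X)
  apply Maj.sum; intro k _
  apply Maj.smul _ _ _ (h.maj.pow k)
  simp

lemma NN.smul {X : MA ℝ} (h : NN X) (c : ℝ) (hc : 0 ≤ c) : NN (c • X) := by
  intro n; simp only [MonoidAlgebra.coeff_smul, Finsupp.smul_apply, smul_eq_mul]; exact mul_nonneg hc (h n)

lemma NN.mul {X Y : MA ℝ} (h : NN X) (h' : NN Y) : NN (X * Y) := (h.maj.mul h'.maj).nn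
lemma NN.add {X Y : MA ℝ} (h : NN X) (h' : NN Y) : NN (X + Y) := (h.maj.add h'.maj).nn
lemma NN.pow {X : MA ℝ} (h : NN X) (k : ℕ) : NN (X ^ k) := (h.maj.pow k).nn
lemma NN.sum {ι : Type} (s : Finset ι) {X : ι → MA ℝ} (h : ∀ i ∈ s, NN (X i)) : NN (∑ i ∈ s, X i) :=
  (Maj.sum s (fun i hi => (h i hi).maj)).nn
lemma NN.single (n : ℕ) (c : ℝ) (hc : 0 ≤ c) : NN (MonoidAlgebra.single n c) :=
  (Maj.single n c c (by rw [Real.norm_of_nonneg hc])).nn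

lemma En_add {n : ℕ} {X Y : MA ℝ} (hX : NN X) (hY : NN Y) : Maj (En n (X + Y)) (En n X * En n Y) := by
  classical
  set t : ℕ × ℕ → MA ℝ := fun x => (((x.1.factorial : ℝ)⁻¹) • X ^ x.1) * (((x.2.factorial : ℝ)⁻¹) • Y ^ x.2) with ht
  have hnn : ∀ x, NN (t x) := fun x => (((hX.pow _).smul _ (by positivity))).mul ((hY.pow _).smul _ (by positivity))
  have h1 : En n X * En n Y = ∑ x ∈ range n ×ˢ range n, t x := by
    rw [En, En, sum_mul_sum, ← sum_product']
  have h2 : En n (X + Y) = ∑ x ∈ (range n ×ˢ range n).filter (fun x => x.1 + x.2 < n), t x := by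
    rw [← sum_fiberwise_of_maps_to (s := (range n ×ˢ range n).filter (fun x => x.1 + x.2 < n)) (t := range n) (g := fun x => x.1 + x.2)
      (fun x hx => mem_range.2 (mem_filter.1 hx).2), En]
    apply sum_congr rfl; intro k hk
    have hk' := mem_range.1 hk
    have h3 : ((range n ×ˢ range n).filter (fun x => x.1 + x.2 < n)).filter (fun x => x.1 + x.2 = k) = Finset.HasAntidiagonal.antidiagonal k := by
      ext ⟨i, j⟩
      simp only [mem_filter, mem_product, mem_range, Finset.HasAntidiagonal.mem_antidiagonal]
      omega
    rw [h3, (Commute.all X Y).add_pow', smul_sum]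
    apply sum_congr rfl
    rintro ⟨i, j⟩ hij
    rw [Finset.HasAntidiagonal.mem_antidiagonal] at hij
    simp only at hij
    simp only [ht]
    rw [← Nat.cast_smul_eq_nsmul ℝ, smul_smul, smul_mul_smul_comm]
    congr 1
    have h4 := Nat.choose_mul_factorial_mul_factorial (show i ≤ k by omega)
    rw [show k - i = j by omega] at h4
    have h5 : ((k.choose i : ℝ)) * i.factorial * j.factorial = k.factorial := by exact_mod_cast h4
    rw [← h5]
    have : (k.choose i : ℝ) ≠ 0 := by
      have := Nat.choose_pos (show i ≤ k by omega)
      positivity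
    field_simp
  rw [h1, h2]
  intro m
  have hnnf := NN.sum ((range n ×ˢ range n).filter (fun x => x.1 + x.2 < n)) (fun x _ => hnn x)
  rw [Real.norm_of_nonneg (hnnf m)]
  simp only [MonoidAlgebra.coeff_sum, Finsupp.coe_finsetSum, Finset.sum_apply]
  exact sum_le_sum_of_subset_of_nonneg (filter_subset _ _) (fun x _ _ => hnn x m)

lemma En_zero {n : ℕ} (hn : 1 ≤ n) : En n (0 : MA ℝ) = 1 := by
  rw [En, sum_eq_single 0]
  · simp
  · intro b _ hb; simp [hb]
  · intro h; simp at h; omega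

lemma En_sum {n : ℕ} (hn : 1 ≤ n) {ι : Type} (S : Finset ι) {X : ι → MA ℝ} (hX : ∀ i ∈ S, NN (X i)) :
    Maj (En n (∑ i ∈ S, X i)) (∏ i ∈ S, En n (X i)) := by
  classical
  induction S using Finset.induction_on with
  | empty => rw [sum_empty, prod_empty, En_zero hn]; exact Maj.one
  | insert i S hi ih =>
    rw [sum_insert hi, prod_insert hi]
    have h1 := hX i (mem_insert_self _ _)
    have h2 : ∀ j ∈ S, NN (X j) := fun j hj => hX j (mem_insert_of_mem hj)
    exact (En_add h1 (NN.sum S h2)).trans ((En_nn h1).maj.mul (ih h2))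

end Stmt13

namespace Stmt13

open MeasureTheory Filter Topology

lemma coeff_sum_single_pow {p : ℕ} (hp : 2 ≤ p) (n : ℕ) (f : ℕ → ℝ) (k : ℕ) :
    (∑ j ∈ range n, (MonoidAlgebra.single (p ^ j) (f j) : MA ℝ)).coeff (p ^ k) = if k < n then f k else 0 := by
  classical
  simp only [MonoidAlgebra.coeff_sum, Finsupp.coe_finsetSum, Finset.sum_apply, MonoidAlgebra.coeff_single, Finsupp.single_apply]
  have : ∀ j, (p ^ j = p ^ k) ↔ j = k := fun j => (Nat.pow_right_injective hp).eq_iff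
  simp [this]

lemma nrm2_sum_single_pow {p : ℕ} (hp : 2 ≤ p) (n : ℕ) (f : ℕ → ℝ) :
    nrm2 (∑ j ∈ range n, (MonoidAlgebra.single (p ^ j) (f j) : MA ℝ)) = ∑ j ∈ range n, (f j) ^ 2 := by
  classical
  rw [nrm2_eq _ ((range n).image (fun j => p ^ j)), sum_image]
  · apply sum_congr rfl; intro j hj
    rw [coeff_sum_single_pow hp, if_pos (mem_range.1 hj)]
  · intro a _ b _ h; exact Nat.pow_right_injective hp h
  · intro m hm
    rw [Finsupp.mem_support_iff] at hm
    have : Sup (∑ j ∈ range n, (MonoidAlgebra.single (p ^ j) (f j) : MA ℝ)) (fun m => m ∈ (range n).image (fun j => p ^ j)) := by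
      apply Sup.sum; intro j hj
      apply Sup.single
      exact mem_image_of_mem _ hj
    exact this m hm

lemma nrm2_En_single {p : ℕ} (hp : 2 ≤ p) (n : ℕ) (c : ℝ) : nrm2 (En n (MonoidAlgebra.single p c)) ≤ Real.exp (c ^ 2) := by
  have h1 : En n (MonoidAlgebra.single p c : MA ℝ) = ∑ j ∈ range n, MonoidAlgebra.single (p ^ j) ((j.factorial : ℝ)⁻¹ * c ^ j) := by
    rw [En]; apply sum_congr rfl; intro j _
    rw [MonoidAlgebra.single_pow, MonoidAlgebra.smul_single, smul_eq_mul]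
  rw [h1, nrm2_sum_single_pow hp]
  refine le_trans (sum_le_sum fun j _ => ?_) (Real.sum_le_exp_of_nonneg (sq_nonneg c) n)
  rw [mul_pow, ← pow_mul, mul_comm j 2, pow_mul, div_eq_inv_mul]
  apply mul_le_mul_of_nonneg_right _ (by positivity)
  have : (1:ℝ) ≤ j.factorial := by exact_mod_cast j.factorial_pos
  have h2 : ((j.factorial : ℝ)⁻¹) ≤ 1 := inv_le_one_of_one_le₀ this
  have h3 : 0 ≤ ((j.factorial : ℝ)⁻¹) := by positivity
  nlinarith

lemma Sup_En {𝕜 : Type} [NormedField 𝕜] {pr : ℕ → Prop} (h1 : pr 1) (hm : ∀ a b, pr a → pr b → pr (a * b)) (n : ℕ) {X : MA 𝕜} (hX : Sup X pr) :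
    Sup (En n X) pr := by
  apply Sup.sum; intro k hk
  apply Sup.smul
  clear hk
  induction k with
  | zero => rw [pow_zero]; exact Sup.one h1
  | succ k ih => rw [pow_succ]; exact Sup.mul hm ih hX

lemma Sup_En_pow {p : ℕ} (n : ℕ) (c d : ℝ) :
    Sup (En n (MonoidAlgebra.single p c + MonoidAlgebra.single (p ^ 2) d : MA ℝ)) (fun m => ∃ k, m = p ^ k) := by
  refine Sup_En (pr := fun m => ∃ k, m = p ^ k) ⟨0, by simp⟩ ?_ n ?_
  · rintro a b ⟨k, rfl⟩ ⟨l, rfl⟩; exact ⟨k + l, by rw [pow_add]⟩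
  · exact (Sup.single _ _ ⟨1, by simp⟩).add (Sup.single _ _ ⟨2, rfl⟩)

lemma Sup_En_single {p : ℕ} (n : ℕ) (c : ℝ) :
    Sup (En n (MonoidAlgebra.single p c : MA ℝ)) (fun m => ∃ k, m = p ^ k) := by
  refine Sup_En (pr := fun m => ∃ k, m = p ^ k) ⟨0, by simp⟩ ?_ n ?_
  · rintro a b ⟨k, rfl⟩ ⟨l, rfl⟩; exact ⟨k + l, by rw [pow_add]⟩
  · exact (Sup.single _ _ ⟨1, by simp⟩)

lemma exp_sub_le (u : ℝ) (hu : 0 ≤ u) : Real.exp u - 1 - u ≤ u ^ 2 * Real.exp u := by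
  have h1 : Real.exp u ≤ 1 + u * Real.exp u := by
    have h := Real.add_one_le_exp (-u)
    have h2 : Real.exp (-u) * Real.exp u = 1 := by rw [← Real.exp_add]; simp
    nlinarith [Real.exp_pos u]
  nlinarith

lemma nrm2_En_two {p : ℕ} (hp : 2 ≤ p) (n : ℕ) (hn : 2 ≤ n) (c d : ℝ) (hc : 0 ≤ c) (hd : 0 ≤ d) :
    nrm2 (En n (MonoidAlgebra.single p c + MonoidAlgebra.single (p ^ 2) d)) ≤ 1 + c ^ 2 + (Real.exp (c + d) - 1 - c) ^ 2 := by
  set X : MA ℝ := MonoidAlgebra.single p c + MonoidAlgebra.single (p ^ 2) d with hX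
  have hnn : NN (En n X) := En_nn ((NN.single _ _ hc).add (NN.single _ _ hd))
  set f : Polynomial ℝ := ∑ k ∈ range n, Polynomial.C ((k.factorial : ℝ)⁻¹) * (Polynomial.C c * Polynomial.X + Polynomial.C d * Polynomial.X ^ 2) ^ k with hf
  have hae : Polynomial.aeval (MonoidAlgebra.single p (1:ℝ) : MA ℝ) f = En n X := by
    rw [hf, map_sum, En]
    apply sum_congr rfl; intro k _
    simp only [map_mul, map_pow, map_add, Polynomial.aeval_X, Polynomial.aeval_C]
    rw [← Algebra.smul_def, ← Algebra.smul_def, ← Algebra.smul_def, MonoidAlgebra.single_pow, MonoidAlgebra.smul_single, MonoidAlgebra.smul_single, hX]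
    simp
  set M := f.natDegree + 2 with hM
  have hae2 : En n X = ∑ j ∈ range M, MonoidAlgebra.single (p ^ j) (f.coeff j) := by
    rw [← hae, Polynomial.aeval_eq_sum_range' (n := M) (by omega)]
    apply sum_congr rfl; intro j _
    rw [MonoidAlgebra.single_pow, MonoidAlgebra.smul_single]; simp
  have hfn : ∀ j < M, 0 ≤ f.coeff j := by
    intro j hj
    have := hnn (p ^ j)
    rw [hae2, coeff_sum_single_pow hp, if_pos hj] at this
    exact this
  have hkey : ∀ k, ((Polynomial.C c * Polynomial.X + Polynomial.C d * Polynomial.X ^ 2) ^ k : Polynomial ℝ) = (Polynomial.C c + Polynomial.C d * Polynomial.X) ^ k * Polynomial.X ^ k := by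
    intro k; rw [← mul_pow]; congr 1; ring
  have hf0 : f.coeff 0 = 1 := by
    rw [hf, Polynomial.finsetSum_coeff, sum_eq_single 0]
    · simp
    · intro k _ hk
      rw [hkey, Polynomial.coeff_C_mul, Polynomial.coeff_mul_X_pow', if_neg (by omega), mul_zero]
    · intro h; simp at h; omega
  have hf1 : f.coeff 1 = c := by
    rw [hf, Polynomial.finsetSum_coeff, sum_eq_single 1]
    · simp
    · intro k _ hk
      rcases Nat.lt_or_ge k 1 with h | h
      · have : k = 0 := by omega
        subst this; simp [Polynomial.coeff_one]
      · rw [hkey, Polynomial.coeff_C_mul, Polynomial.coeff_mul_X_pow', if_neg (by omega), mul_zero]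
    · intro h; simp at h; omega
  have htot : ∑ j ∈ range M, f.coeff j ≤ Real.exp (c + d) := by
    have h1 : ∑ j ∈ range M, f.coeff j = f.eval 1 := by
      rw [Polynomial.eval_eq_sum_range' (n := M) (by omega)]; simp
    rw [h1, hf, Polynomial.eval_finsetSum]
    refine le_trans (le_of_eq ?_) (Real.sum_le_exp_of_nonneg (add_nonneg hc hd) n)
    apply sum_congr rfl; intro k _
    simp; ring
  rw [hae2, nrm2_sum_single_pow hp]
  rw [hM, sum_range_succ', sum_range_succ'] at htot ⊢
  simp only [zero_add, hf0, hf1] at htot ⊢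
  have hrest : ∑ k ∈ range f.natDegree, f.coeff (k + 1 + 1) ^ 2 ≤ (∑ k ∈ range f.natDegree, f.coeff (k + 1 + 1)) ^ 2 := by
    apply sum_sq_le_sq_sum_of_nonneg
    intro k hk
    apply hfn
    have := mem_range.1 hk
    omega
  have hr0 : 0 ≤ ∑ k ∈ range f.natDegree, f.coeff (k + 1 + 1) := by
    apply sum_nonneg; intro k hk
    apply hfn
    have := mem_range.1 hk
    omega
  have := pow_le_pow_left₀ hr0 (show ∑ k ∈ range f.natDegree, f.coeff (k + 1 + 1) ≤ Real.exp (c + d) - 1 - c by linarith) 2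
  linarith

lemma nrm2_gp {b : ℝ} (hb : 0 ≤ b) {p : ℕ} (hp : 2 ≤ p) (n : ℕ) (hn : 2 ≤ n) (c d : ℝ) (hc : 0 ≤ c) (hd : 0 ≤ d)
    (hcb : c ^ 2 ≤ b ^ 2 / p) (hdb : d ≤ b / p) :
    nrm2 (En n (MonoidAlgebra.single p c + MonoidAlgebra.single (p ^ 2) d)) ≤ Real.exp (c ^ 2 + (b + 4 * b ^ 2 * Real.exp (2 * b)) ^ 2 * (1 / (p:ℝ) ^ 2)) := by
  have hp' : (2:ℝ) ≤ p := by exact_mod_cast hp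
  have hp1 : 1 / (p:ℝ) ≤ 1 := by rw [div_le_one (by linarith)]; linarith
  have hp0 : 0 < 1 / (p:ℝ) := by positivity
  have hd1 : d ≤ b * (1 / p) := by rw [mul_one_div]; exact hdb
  have hc1 : c ^ 2 ≤ b ^ 2 * (1 / p) := by rw [mul_one_div]; exact hcb
  have hdb' : d ≤ b := by nlinarith
  have hcb' : c ≤ b := by
    apply le_of_sq_le_sq _ hb
    nlinarith [sq_nonneg b]
  have hd2 : d ^ 2 ≤ b ^ 2 * (1 / p) := by
    calc d ^ 2 = d * d := by ring
      _ ≤ (b * (1 / p)) * b := mul_le_mul hd1 hdb' hd (by positivity)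
      _ = _ := by ring
  refine (nrm2_En_two hp n hn c d hc hd).trans ?_
  have h1 := exp_sub_le (c + d) (add_nonneg hc hd)
  have h2 : (c + d) ^ 2 ≤ 4 * b ^ 2 * (1 / p) := by nlinarith [sq_nonneg (c - d)]
  have h3 : Real.exp (c + d) ≤ Real.exp (2 * b) := Real.exp_le_exp.2 (by linarith)
  have h4 : (c + d) ^ 2 * Real.exp (c + d) ≤ 4 * b ^ 2 * (1 / p) * Real.exp (2 * b) :=
    mul_le_mul h2 h3 (Real.exp_pos _).le (by positivity)
  have h5 : Real.exp (c + d) - 1 - c ≤ (b + 4 * b ^ 2 * Real.exp (2 * b)) * (1 / p) := by linarith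
  have h6 : 0 ≤ Real.exp (c + d) - 1 - c := by
    have := Real.add_one_le_exp (c + d); linarith
  have h7 := pow_le_pow_left₀ h6 h5 2
  have h8 := Real.add_one_le_exp (c ^ 2 + (b + 4 * b ^ 2 * Real.exp (2 * b)) ^ 2 * (1 / (p:ℝ) ^ 2))
  have h9 : ((b + 4 * b ^ 2 * Real.exp (2 * b)) * (1 / p)) ^ 2 = (b + 4 * b ^ 2 * Real.exp (2 * b)) ^ 2 * (1 / (p:ℝ) ^ 2) := by
    rw [mul_pow, div_pow, one_pow]
  linarith

end Stmt13

namespace Stmt13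

open MeasureTheory Filter Topology

lemma exp_trunc (z : ℂ) (R : ℝ) (n N : ℕ) (hz : ‖z‖ ≤ R) (hn : 21 * R ≤ n) (hN : N + 2 ≤ n) :
    Real.exp (2 * z.re) ≤ ‖∑ k ∈ range n, z ^ k / (k.factorial : ℂ)‖ ^ 2 * Real.exp (2 * (1 / 2) ^ N) := by
  have hR : 0 ≤ R := (norm_nonneg z).trans hz
  have hn0 : (0:ℝ) < n := by
    have : 0 < n := by omega
    exact_mod_cast this
  set E := ∑ k ∈ range n, z ^ k / (k.factorial : ℂ) with hE
  have h1 : ‖Complex.exp z - E‖ ≤ ‖z‖ ^ n / n.factorial * 2 := by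
    apply Complex.exp_bound'
    rw [div_le_iff₀ (by positivity)]
    push_cast
    linarith
  have h2 : ‖z‖ ^ n / n.factorial ≤ Real.exp (-R) * Real.exp (-n) := by
    have h3 := Real.pow_div_factorial_le_exp (Real.exp 3 * R) (by positivity) n
    rw [mul_pow, ← Real.exp_nat_mul] at h3
    have h4 : Real.exp 3 ≤ 21 := by
      have h5 := Real.exp_one_lt_d9
      have h6 : Real.exp 3 = Real.exp 1 ^ 3 := by rw [← Real.exp_nat_mul]; norm_num
      rw [h6]
      calc Real.exp 1 ^ 3 ≤ (2.7182818286:ℝ) ^ 3 := pow_le_pow_left₀ (Real.exp_pos _).le h5.le 3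
        _ ≤ 21 := by norm_num
    have h7 : Real.exp (Real.exp 3 * R) ≤ Real.exp n := Real.exp_le_exp.2 (by nlinarith)
    have h8 : R ^ n / n.factorial ≤ Real.exp (-(2 * n)) := by
      have h9 : Real.exp (-(2 * n)) = Real.exp n * Real.exp (-(n * 3)) := by rw [← Real.exp_add]; congr 1; ring
      have h10 : Real.exp (n * 3) * Real.exp (-(n * 3)) = 1 := by rw [← Real.exp_add]; simp
      have h11 : Real.exp (n * 3) * (R ^ n / n.factorial) ≤ Real.exp n := by
        rw [← mul_div_assoc]; exact h3.trans h7
      rw [h9]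
      calc R ^ n / n.factorial = (Real.exp (n * 3) * Real.exp (-(n * 3))) * (R ^ n / n.factorial) := by rw [h10]; ring
        _ = (Real.exp (n * 3) * (R ^ n / n.factorial)) * Real.exp (-(n * 3)) := by ring
        _ ≤ _ := mul_le_mul_of_nonneg_right h11 (Real.exp_pos _).le
    have h12 : ‖z‖ ^ n / n.factorial ≤ R ^ n / n.factorial := by gcongr
    refine h12.trans (h8.trans ?_)
    rw [← Real.exp_add]
    apply Real.exp_le_exp.2; linarith
  have h3 : Real.exp (-R) ≤ ‖Complex.exp z‖ := by
    rw [Complex.norm_exp]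
    apply Real.exp_le_exp.2
    have := Complex.abs_re_le_norm z
    have := neg_abs_le z.re
    linarith
  set u := 2 * Real.exp (-(n:ℝ)) with hu
  have hu0 : 0 < u := by positivity
  have hu1 : u ≤ (1 / 2) ^ (N + 1) := by
    have h4 : Real.exp (-(n:ℝ)) ≤ (1 / 2) ^ n := by
      rw [Real.exp_neg, one_div, inv_pow]
      apply inv_anti₀ (by positivity)
      have h5 := Real.add_one_le_exp (1:ℝ)
      have : Real.exp n = Real.exp 1 ^ n := by rw [← Real.exp_nat_mul]; simp
      rw [this]
      exact pow_le_pow_left₀ (by norm_num) (by linarith) n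
    have h5 : ((1:ℝ) / 2) ^ n ≤ (1 / 2) ^ (N + 2) := pow_le_pow_of_le_one (by norm_num) (by norm_num) hN
    have : ((1:ℝ) / 2) ^ (N + 2) = (1 / 2) ^ (N + 1) / 2 := by rw [pow_succ]; ring
    rw [hu]; linarith
  have hu2 : u ≤ 1 / 2 := by
    refine hu1.trans ?_
    calc ((1:ℝ) / 2) ^ (N + 1) ≤ (1/2) ^ 1 := pow_le_pow_of_le_one (by norm_num) (by norm_num) (by omega)
      _ = _ := by norm_num
  have h4 : ‖Complex.exp z‖ * (1 - u) ≤ ‖E‖ := by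
    have h5 : ‖Complex.exp z‖ ≤ ‖E‖ + ‖Complex.exp z - E‖ := by
      have := norm_add_le E (Complex.exp z - E)
      simpa using this
    have h6 : Real.exp (-R) * Real.exp (-n) ≤ ‖Complex.exp z‖ * Real.exp (-n) := mul_le_mul_of_nonneg_right h3 (Real.exp_pos _).le
    rw [hu]
    nlinarith
  have h5 : 1 ≤ (1 - u) * Real.exp (2 * u) := by
    have := Real.add_one_le_exp (2 * u)
    nlinarith
  have h6 : ‖Complex.exp z‖ ≤ ‖E‖ * Real.exp (2 * u) := by
    calc ‖Complex.exp z‖ ≤ ‖Complex.exp z‖ * ((1 - u) * Real.exp (2 * u)) := le_mul_of_one_le_right (norm_nonneg _) h5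
      _ = (‖Complex.exp z‖ * (1 - u)) * Real.exp (2 * u) := by ring
      _ ≤ _ := mul_le_mul_of_nonneg_right h4 (Real.exp_pos _).le
  have h7 : Real.exp (2 * z.re) = ‖Complex.exp z‖ ^ 2 := by
    rw [Complex.norm_exp, ← Real.exp_nat_mul]; norm_num
  rw [h7]
  calc ‖Complex.exp z‖ ^ 2 ≤ (‖E‖ * Real.exp (2 * u)) ^ 2 := pow_le_pow_left₀ (norm_nonneg _) h6 2
    _ = ‖E‖ ^ 2 * Real.exp (4 * u) := by rw [mul_pow, ← Real.exp_nat_mul]; congr 2; push_cast; ring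
    _ ≤ _ := by
      apply mul_le_mul_of_nonneg_left _ (by positivity)
      apply Real.exp_le_exp.2
      rw [pow_succ] at hu1
      linarith

/-- block of primes -/
def Blk (i : ℕ) : Finset ℕ := (range (2 ^ 2 ^ (i + 1))).filter (fun p => p.Prime ∧ 2 ^ 2 ^ i ≤ p)
/-- primes below level -/
def PS (l : ℕ) : Finset ℕ := (range (2 ^ 2 ^ l)).filter Nat.Prime

lemma Blk_prime {i p : ℕ} (h : p ∈ Blk i) : p.Prime := (mem_filter.1 h).2.1
lemma Blk_lt {i p : ℕ} (h : p ∈ Blk i) : p < 2 ^ 2 ^ (i + 1) := mem_range.1 (mem_filter.1 h).1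
lemma PS_prime {i p : ℕ} (h : p ∈ PS i) : p.Prime := (mem_filter.1 h).2

lemma PS_zero : PS 0 = ∅ := by
  ext p
  simp only [PS, mem_filter, mem_range, notMem_empty, iff_false, not_and]
  intro h hp
  have := hp.two_le
  norm_num at h; omega

lemma PS_succ (l : ℕ) : PS (l + 1) = PS l ∪ Blk l ∧ Disjoint (PS l) (Blk l) := by
  constructor
  · ext p
    simp only [PS, Blk, mem_union, mem_filter, mem_range]
    have : 2 ^ 2 ^ l ≤ 2 ^ 2 ^ (l + 1) := Nat.pow_le_pow_right (by norm_num) (Nat.pow_le_pow_right (by norm_num) (by omega))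
    constructor
    · rintro ⟨h1, h2⟩
      by_cases h : p < 2 ^ 2 ^ l
      · exact Or.inl ⟨h, h2⟩
      · exact Or.inr ⟨h1, h2, by omega⟩
    · rintro (⟨h1, h2⟩ | ⟨h1, h2, h3⟩)
      · exact ⟨by omega, h2⟩
      · exact ⟨h1, h2⟩
  · rw [disjoint_left]
    intro p h1 h2
    have a := mem_range.1 (mem_filter.1 h1).1
    have b := (mem_filter.1 h2).2.2
    omega

lemma PS_sum {M : Type} [AddCommMonoid M] (l : ℕ) (f : ℕ → M) : ∑ p ∈ PS l, f p = ∑ i ∈ range l, ∑ p ∈ Blk i, f p := by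
  induction l with
  | zero => simp [PS_zero]
  | succ l ih => rw [(PS_succ l).1, sum_union (PS_succ l).2, sum_range_succ, ih]

lemma PS_prod {M : Type} [CommMonoid M] (l : ℕ) (f : ℕ → M) : ∏ p ∈ PS l, f p = ∏ i ∈ range l, ∏ p ∈ Blk i, f p := by
  induction l with
  | zero => simp [PS_zero]
  | succ l ih => rw [(PS_succ l).1, prod_union (PS_succ l).2, prod_range_succ, ih]

lemma PS_mono {l l' : ℕ} (h : l ≤ l') : PS l ⊆ PS l' := by
  intro p hp
  rw [PS, mem_filter, mem_range] at hp ⊢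
  have : 2 ^ 2 ^ l ≤ 2 ^ 2 ^ l' := Nat.pow_le_pow_right (by norm_num) (Nat.pow_le_pow_right (by norm_num) h)
  exact ⟨by omega, hp.2⟩

lemma dyadic_card (j : ℕ) : j * ((range (2 ^ (j + 1))).filter (fun p => p.Prime ∧ 2 ^ j ≤ p)).card ≤ 2 ^ (j + 2) := by
  set D := (range (2 ^ (j + 1))).filter (fun p => p.Prime ∧ 2 ^ j ≤ p)
  have h1 : (2 ^ j) ^ D.card ≤ ∏ p ∈ D, p := by
    rw [← prod_const]
    exact prod_le_prod' fun p hp => (mem_filter.1 hp).2.2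
  have h2 : ∏ p ∈ D, p ≤ primorial (2 ^ (j + 1)) := by
    rw [primorial]
    apply prod_le_prod_of_subset_of_one_le'
    · intro p hp
      rw [mem_filter] at hp ⊢
      refine ⟨?_, hp.2.1⟩
      have := mem_range.1 hp.1
      rw [mem_range]; omega
    · intro p hp _
      exact (mem_filter.1 hp).2.one_lt.le
  have h3 := h1.trans (h2.trans (primorial_le_four_pow _))
  rw [← pow_mul, show (4:ℕ) = 2 ^ 2 by norm_num, ← pow_mul] at h3
  have h4 := (Nat.pow_le_pow_iff_right (by norm_num : 1 < 2)).1 h3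
  calc _ ≤ _ := h4
    _ = _ := by rw [pow_succ 2 (j+1)]; ring

lemma Blk_sum (i : ℕ) : ∑ p ∈ Blk i, 1 / (p : ℝ) ≤ 4 := by
  have hmaps : ∀ p ∈ Blk i, Nat.log 2 p ∈ Ico (2 ^ i) (2 ^ (i + 1)) := by
    intro p hp
    have h1 := Blk_lt hp
    have h2 := (mem_filter.1 hp).2.2
    have h0 := (Blk_prime hp).ne_zero
    rw [mem_Ico]
    exact ⟨Nat.le_log_of_pow_le (by norm_num) h2, Nat.log_lt_of_lt_pow h0 h1⟩
  rw [← sum_fiberwise_of_maps_to hmaps]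
  calc ∑ j ∈ Ico (2 ^ i) (2 ^ (i + 1)), ∑ p ∈ (Blk i).filter (fun p => Nat.log 2 p = j), 1 / (p : ℝ)
      ≤ ∑ j ∈ Ico (2 ^ i) (2 ^ (i + 1)), 4 / (2:ℝ) ^ i := by
        apply sum_le_sum; intro j hj
        rw [mem_Ico] at hj
        have hj0 : 0 < j := lt_of_lt_of_le (by positivity) hj.1
        have hsub : (Blk i).filter (fun p => Nat.log 2 p = j) ⊆ (range (2 ^ (j + 1))).filter (fun p => p.Prime ∧ 2 ^ j ≤ p) := by
          intro p hp
          rw [mem_filter] at hp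
          have h0 := (Blk_prime hp.1).ne_zero
          rw [mem_filter, mem_range]
          refine ⟨?_, Blk_prime hp.1, ?_⟩
          · rw [← hp.2]; exact Nat.lt_pow_succ_log_self (by norm_num) p
          · rw [← hp.2]; exact Nat.pow_log_le_self 2 h0
        have hcard := dyadic_card j
        set D := (range (2 ^ (j + 1))).filter (fun p => p.Prime ∧ 2 ^ j ≤ p)
        have hc : (j:ℝ) * D.card ≤ 2 ^ (j + 2) := by exact_mod_cast hcard
        calc ∑ p ∈ (Blk i).filter (fun p => Nat.log 2 p = j), 1 / (p : ℝ) ≤ ∑ p ∈ D, 1 / (p : ℝ) :=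
              sum_le_sum_of_subset_of_nonneg hsub (fun _ _ _ => by positivity)
          _ ≤ ∑ p ∈ D, 1 / (2:ℝ) ^ j := by
              apply sum_le_sum; intro p hp
              have h2 : (2:ℝ) ^ j ≤ p := by exact_mod_cast (mem_filter.1 hp).2.2
              gcongr
          _ = D.card / (2:ℝ) ^ j := by rw [sum_const, nsmul_eq_mul]; ring
          _ ≤ 4 / j := by
              rw [div_le_div_iff₀ (by positivity) (by exact_mod_cast hj0)]
              rw [pow_add] at hc
              linarith
          _ ≤ _ := by
              have : (2:ℝ) ^ i ≤ j := by exact_mod_cast hj.1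
              gcongr
    _ = 4 := by
        rw [sum_const, Nat.card_Ico, nsmul_eq_mul, pow_succ]
        have : 2 ^ i * 2 - 2 ^ i = 2 ^ i := by omega
        rw [this]
        push_cast
        field_simp

lemma PS_inv_sq (l : ℕ) : ∑ p ∈ PS l, 1 / (p : ℝ) ^ 2 ≤ 2 := by
  have hs2n : Summable (fun n : ℕ => (1:ℝ) / (n:ℝ) ^ 2) := hasSum_zeta_two.summable
  exact (hs2n.sum_le_tsum _ (fun _ _ => by positivity)).trans natCast_rpow_sum

end Stmt13

namespace Stmt13

open MeasureTheory Filter Topology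

lemma Blk_idx {i p : ℕ} (hp : p ∈ Blk i) : Nat.log 2 (Nat.log 2 p) = i := by
  have h1 := Blk_lt hp
  have h2 := (mem_filter.1 hp).2.2
  have h0 := (Blk_prime hp).ne_zero
  have h3 : 2 ^ i ≤ Nat.log 2 p := Nat.le_log_of_pow_le (by norm_num) h2
  have h4 : Nat.log 2 p < 2 ^ (i + 1) := Nat.log_lt_of_lt_pow h0 h1
  apply Nat.log_eq_of_pow_le_of_lt_pow h3 h4

lemma Blk_sub_PS {i l p : ℕ} (hil : i < l) (hp : p ∈ Blk i) : p ∈ PS l := by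
  apply PS_mono (show i + 1 ≤ l from hil)
  rw [(PS_succ i).1]; exact mem_union_right _ hp

lemma PS_Blk {l p : ℕ} (hp : p ∈ PS l) : Nat.log 2 (Nat.log 2 p) < l ∧ p ∈ Blk (Nat.log 2 (Nat.log 2 p)) := by
  induction l with
  | zero => rw [PS_zero] at hp; simp at hp
  | succ l ih =>
    rw [(PS_succ l).1, mem_union] at hp
    rcases hp with h | h
    · exact ⟨(ih h).1.trans (by omega), (ih h).2⟩
    · rw [Blk_idx h]; exact ⟨by omega, h⟩

lemma blocks_nrm2 (l : ℕ) (f : ℕ → ℕ → MA ℝ) (hf : ∀ i p, Sup (f i p) (fun n => ∃ k, n = p ^ k)) :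
    nrm2 (∏ i ∈ range l, ∏ p ∈ Blk i, f i p) ≤ ∏ i ∈ range l, ∏ p ∈ Blk i, nrm2 (f i p) := by
  have h1 : ∏ i ∈ range l, ∏ p ∈ Blk i, f i p = ∏ p ∈ PS l, f (Nat.log 2 (Nat.log 2 p)) p := by
    rw [PS_prod]
    apply prod_congr rfl; intro i _; apply prod_congr rfl; intro p hp; rw [Blk_idx hp]
  have h2 : ∏ i ∈ range l, ∏ p ∈ Blk i, nrm2 (f i p) = ∏ p ∈ PS l, nrm2 (f (Nat.log 2 (Nat.log 2 p)) p) := by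
    rw [PS_prod]
    apply prod_congr rfl; intro i _; apply prod_congr rfl; intro p hp; rw [Blk_idx hp]
  rw [h1, h2]
  exact nrm2_prod_primes _ (fun p hp => PS_prime hp) _ (fun p _ => hf _ p)

/-- number of terms -/
noncomputable def nnt (H N : ℕ) : ℕ := H * ⌈(3 / 2 : ℝ) ^ N⌉₊

/-- prime part -/
noncomputable def P1 (c : ℕ → ℕ → ℂ) (i l : ℕ) : MA ℂ := ∑ p ∈ Blk i, MonoidAlgebra.single p (c l p)
/-- full block poly -/
noncomputable def PP (c d : ℕ → ℕ → ℂ) (i l : ℕ) : MA ℂ :=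
  ∑ p ∈ Blk i, (MonoidAlgebra.single p (c l p) + MonoidAlgebra.single (p ^ 2) (d l p))
/-- product of truncated exponentials -/
noncomputable def AA (H L : ℕ) (c d : ℕ → ℕ → ℂ) (l : ℕ) : MA ℂ := ∏ i ∈ range l, En (nnt H (L - i)) (PP c d i l)

/-- one-prime majorant -/
noncomputable def gP (b : ℝ) (γ : ℕ → ℝ) (n p : ℕ) : MA ℝ := En n (MonoidAlgebra.single p (γ p) + MonoidAlgebra.single (p ^ 2) (b / p))

lemma nnt_ge {H : ℕ} (N : ℕ) (hH : 4 ≤ H) : N + 2 ≤ nnt H N := by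
  have h1 : (1:ℝ) + N * (1 / 2) ≤ (1 + 1 / 2) ^ N := one_add_mul_le_pow (by norm_num) N
  have h2 : ((3:ℝ) / 2) ^ N ≤ ⌈(3 / 2 : ℝ) ^ N⌉₊ := Nat.le_ceil _
  have h3 : (4:ℝ) ≤ H := by exact_mod_cast hH
  have : ((N + 2 : ℕ) : ℝ) ≤ (nnt H N : ℕ) := by
    rw [nnt]; push_cast
    norm_num at h1
    nlinarith
  exact_mod_cast this

lemma AA_maj {b : ℝ} {γ : ℕ → ℝ} {c d : ℕ → ℕ → ℂ} (hb : 0 ≤ b) (hγ : ∀ p, 0 ≤ γ p) (hc : ∀ l p, ‖c l p‖ ≤ γ p) (hd : ∀ l p, ‖d l p‖ ≤ b / p)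
    {H : ℕ} (hH : 4 ≤ H) (L l : ℕ) :
    Maj (AA H L c d l) (∏ i ∈ range l, ∏ p ∈ Blk i, gP b γ (nnt H (L - i)) p) := by
  apply Maj.prod; intro i _
  have h1 : Maj (PP c d i l) (∑ p ∈ Blk i, (MonoidAlgebra.single p (γ p) + MonoidAlgebra.single (p ^ 2) (b / p))) := by
    apply Maj.sum; intro p _
    exact (Maj.single _ _ _ (hc l p)).add (Maj.single _ _ _ (hd l p))
  refine (En_maj h1).trans (En_sum ?_ _ ?_)
  · have := nnt_ge (L - i) hH; omega
  · intro p _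
    exact (NN.single _ _ (hγ p)).add (NN.single _ _ (by positivity))

lemma gP_nrm {b : ℝ} {γ : ℕ → ℝ} (hb : 0 ≤ b) (hγ : ∀ p, 0 ≤ γ p) (hγb : ∀ p, γ p ^ 2 ≤ b ^ 2 / p) {H : ℕ} (hH : 4 ≤ H) (N : ℕ) (p : ℕ) (hp : p.Prime) :
    nrm2 (gP b γ (nnt H N) p) ≤ Real.exp (γ p ^ 2 + (b + 4 * b ^ 2 * Real.exp (2 * b)) ^ 2 * (1 / (p:ℝ) ^ 2)) := by
  apply nrm2_gp hb hp.two_le _ _ _ _ (hγ p) (by positivity) (hγb p) le_rfl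
  have := nnt_ge N hH; omega

lemma AA_prod_bound {b : ℝ} {γ : ℕ → ℝ} (hb : 0 ≤ b) (hγ : ∀ p, 0 ≤ γ p) (hγb : ∀ p, γ p ^ 2 ≤ b ^ 2 / p) {H : ℕ} (hH : 4 ≤ H) (L l : ℕ) (hl : l ≤ L) :
    ∏ i ∈ range l, ∏ p ∈ Blk i, nrm2 (gP b γ (nnt H (L - i)) p) ≤
      Real.exp (∑ p ∈ PS L, γ p ^ 2 + 2 * (b + 4 * b ^ 2 * Real.exp (2 * b)) ^ 2) := by
  set K := (b + 4 * b ^ 2 * Real.exp (2 * b)) ^ 2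
  calc ∏ i ∈ range l, ∏ p ∈ Blk i, nrm2 (gP b γ (nnt H (L - i)) p)
      ≤ ∏ i ∈ range l, ∏ p ∈ Blk i, Real.exp (γ p ^ 2 + K * (1 / (p:ℝ) ^ 2)) := by
        apply prod_le_prod (fun i _ => prod_nonneg fun p _ => nrm2_nonneg _)
        intro i _
        apply prod_le_prod (fun p _ => nrm2_nonneg _)
        intro p hp
        exact gP_nrm hb hγ hγb hH _ p (Blk_prime hp)
    _ = Real.exp (∑ p ∈ PS l, (γ p ^ 2 + K * (1 / (p:ℝ) ^ 2))) := by
        rw [← PS_prod l (fun p => Real.exp (γ p ^ 2 + K * (1 / (p:ℝ) ^ 2))), Real.exp_sum]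
    _ ≤ _ := by
        apply Real.exp_le_exp.2
        rw [sum_add_distrib, ← mul_sum]
        have h1 := PS_inv_sq l
        have hK : 0 ≤ K := sq_nonneg _
        have h2 : ∑ p ∈ PS l, γ p ^ 2 ≤ ∑ p ∈ PS L, γ p ^ 2 :=
          sum_le_sum_of_subset_of_nonneg (PS_mono hl) (fun _ _ _ => sq_nonneg _)
        nlinarith

lemma Sup_pow_le {F : MA ℂ} {D : ℕ} (hF : Sup F (fun n => n ≤ D)) (k : ℕ) : Sup (F ^ k) (fun n => n ≤ D ^ k) := by
  induction k with
  | zero => rw [pow_zero]; exact Sup.one (by simp)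
  | succ k ih => rw [pow_succ]; exact Sup.mul (fun a b ha hb => by rw [pow_succ]; exact Nat.mul_le_mul ha hb) ih hF

lemma Sup_En_le {F : MA ℂ} {D : ℕ} (hD : 1 ≤ D) (hF : Sup F (fun n => n ≤ D)) (n : ℕ) : Sup (En n F) (fun m => m ≤ D ^ n) := by
  apply Sup.sum; intro k hk
  apply Sup.smul
  intro m hm
  have := Sup_pow_le hF k m hm
  exact this.trans (Nat.pow_le_pow_right hD (mem_range.1 hk).le)

lemma Sup_PP_le {c d : ℕ → ℕ → ℂ} {i l D : ℕ} (h : ∀ p ∈ Blk i, p ^ 2 ≤ D) : Sup (PP c d i l) (fun n => n ≤ D) := by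
  apply Sup.sum; intro p hp
  have h2 := h p hp
  have h1 : p ≤ D := (Nat.le_self_pow (by norm_num) p).trans h2
  exact (Sup.single (pr := fun n => n ≤ D) p _ h1).add (Sup.single (pr := fun n => n ≤ D) (p ^ 2) _ h2)

lemma Blk_sq {i p : ℕ} (hp : p ∈ Blk i) : p ^ 2 ≤ 2 ^ 2 ^ (i + 2) := by
  calc p ^ 2 ≤ (2 ^ 2 ^ (i + 1)) ^ 2 := Nat.pow_le_pow_left (Blk_lt hp).le 2
    _ = _ := by rw [← pow_mul, pow_succ 2 (i+1)]

lemma Sup_AA_aux (D n : ℕ → ℕ) (hD : ∀ i, 1 ≤ D i) (F : ℕ → MA ℂ) (hF : ∀ i, Sup (F i) (fun m => m ≤ D i)) (s : Finset ℕ) :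
    Sup (∏ i ∈ s, En (n i) (F i)) (fun m => m ≤ ∏ i ∈ s, D i ^ n i) := by
  induction s using Finset.induction_on with
  | empty => rw [prod_empty]; exact Sup.one (by simp)
  | insert i s hi ih =>
    rw [prod_insert hi]
    refine Sup.mul ?_ (Sup_En_le (hD i) (hF i) (n i)) ih
    intro a b ha hb
    rw [prod_insert hi]
    exact Nat.mul_le_mul ha hb

lemma Sup_AA (H L : ℕ) (c d : ℕ → ℕ → ℂ) (l : ℕ) :
    Sup (AA H L c d l) (fun m => m ≤ 2 ^ (∑ i ∈ range l, 2 ^ (i + 2) * nnt H (L - i))) := by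
  have h := Sup_AA_aux (fun i => 2 ^ 2 ^ (i + 2)) (fun i => nnt H (L - i)) (fun i => Nat.one_le_two_pow)
    (fun i => PP c d i l) (fun i => Sup_PP_le (fun p hp => Blk_sq hp)) (range l)
  have e : ∏ i ∈ range l, (2 ^ 2 ^ (i + 2)) ^ nnt H (L - i) = 2 ^ (∑ i ∈ range l, 2 ^ (i + 2) * nnt H (L - i)) := by
    rw [← prod_pow_eq_pow_sum]
    apply prod_congr rfl; intro i _; rw [pow_mul]
  intro m hm
  have := h m hm
  rw [← e]; exact this

lemma geo_sum (L l : ℕ) (hl : l ≤ L) : ∑ i ∈ range l, (2:ℝ) ^ i * (3 / 2) ^ (L - i) ≤ 3 * 2 ^ L := by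
  have h1 : ∀ k ≤ L, ∑ i ∈ range k, (2:ℝ) ^ i * (3 / 2) ^ (L - i) ≤ 3 * (2 ^ k * (3 / 2) ^ (L - k)) := by
    intro k
    induction k with
    | zero => intro _; simp; positivity
    | succ k ih =>
      intro hk
      rw [sum_range_succ]
      have := ih (by omega)
      obtain ⟨j, hj⟩ : ∃ j, L - k = j + 1 := ⟨L - k - 1, by omega⟩
      have hj' : L - (k + 1) = j := by omega
      rw [hj'] ; rw [hj] at this ⊢
      rw [pow_succ 2 k]; rw [pow_succ _ j] at this ⊢
      linarith
  refine (h1 l hl).trans ?_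
  have h2 : ((3:ℝ) / 2) ^ (L - l) ≤ 2 ^ (L - l) := pow_le_pow_left₀ (by norm_num) (by norm_num) _
  have h3 : (2:ℝ) ^ l * 2 ^ (L - l) = 2 ^ L := by rw [← pow_add]; congr 1; omega
  have : (2:ℝ) ^ l * (3 / 2) ^ (L - l) ≤ 2 ^ L := by rw [← h3]; gcongr
  linarith

lemma deg_bound (H L l : ℕ) (hl : l ≤ L) : ((∑ i ∈ range l, 2 ^ (i + 2) * nnt H (L - i) : ℕ) : ℝ) ≤ 24 * H * 2 ^ L := by
  have h := geo_sum L l hl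
  push_cast
  calc ∑ i ∈ range l, (2:ℝ) ^ (i + 2) * (nnt H (L - i) : ℝ) ≤ ∑ i ∈ range l, 8 * H * ((2:ℝ) ^ i * (3 / 2) ^ (L - i)) := by
        apply sum_le_sum; intro i _
        rw [nnt]; push_cast
        have h1 : (1:ℝ) ≤ (3 / 2) ^ (L - i) := one_le_pow₀ (by norm_num)
        have h2 : ((⌈(3 / 2 : ℝ) ^ (L - i)⌉₊ : ℕ) : ℝ) ≤ 2 * (3 / 2) ^ (L - i) := by
          have := (Nat.ceil_lt_add_one (show (0:ℝ) ≤ (3/2) ^ (L - i) by positivity)).le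
          linarith
        calc (2:ℝ) ^ (i + 2) * (H * (⌈(3 / 2 : ℝ) ^ (L - i)⌉₊ : ℕ)) ≤ (2:ℝ) ^ (i + 2) * (H * (2 * (3 / 2) ^ (L - i))) := by gcongr
          _ = _ := by rw [pow_add]; ring
    _ = 8 * H * ∑ i ∈ range l, ((2:ℝ) ^ i * (3 / 2) ^ (L - i)) := by rw [mul_sum]
    _ ≤ 8 * H * (3 * 2 ^ L) := by gcongr
    _ = _ := by ring

lemma two_pow_lt {q e : ℕ} (hq : 1 < q) {B : ℝ} (he : (e : ℝ) ≤ B) (hB : B ≤ Real.log q) : 2 ^ e < q := by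
  have hq0 : (0:ℝ) < q := by positivity
  have hlq : 0 < Real.log q := Real.log_pos (by exact_mod_cast hq)
  have h1 : (e:ℝ) * Real.log 2 < Real.log q := by
    have h2 := Real.log_two_lt_d9
    have h3 := Real.log_two_gt_d9
    have h0 : (0:ℝ) ≤ e := by positivity
    nlinarith
  have h2 : Real.log ((2:ℝ) ^ e) < Real.log q := by rw [Real.log_pow]; exact h1
  have := (Real.log_lt_log_iff (by positivity) hq0).1 h2
  exact_mod_cast this

/-- mean square of product of truncated exponentials -/
lemma AA_mean {b : ℝ} {γ : ℕ → ℝ} {c d : ℕ → ℕ → ℂ} (hb : 0 ≤ b) (hγ : ∀ p, 0 ≤ γ p) (hγb : ∀ p, γ p ^ 2 ≤ b ^ 2 / p)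
    (hc : ∀ l p, ‖c l p‖ ≤ γ p) (hd : ∀ l p, ‖d l p‖ ≤ b / p)
    {H : ℕ} (hH : 4 ≤ H) (L l : ℕ) (hl : l ≤ L) {q : ℕ} [NeZero q] (hq : 1 < q) (hL : L = 0 ∨ ((24 * H + 2 : ℕ):ℝ) * 2 ^ L ≤ Real.log q) :
    ∑ χ : DirichletCharacter ℂ q, ‖ev χ (AA H L c d l)‖ ^ 2 ≤
      Nat.totient q * Real.exp (∑ p ∈ PS L, γ p ^ 2 + 2 * (b + 4 * b ^ 2 * Real.exp (2 * b)) ^ 2) := by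
  refine (ev_sum _ _ (AA_maj hb hγ hc hd hH L l) ?_).trans ?_
  · intro n hn
    have h1 := Sup_AA H L c d l n hn
    refine lt_of_le_of_lt h1 ?_
    rcases hL with h0 | h0
    · have : l = 0 := by omega
      subst this; simpa using hq
    · apply two_pow_lt hq (deg_bound H L l hl) (le_trans _ h0)
      push_cast
      gcongr; linarith
  · apply mul_le_mul_of_nonneg_left _ (by positivity)
    exact (blocks_nrm2 l (fun i p => gP b γ (nnt H (L - i)) p) (fun i p => Sup_En_pow _ _ _)).trans (AA_prod_bound hb hγ hγb hH L l hl)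

end Stmt13

namespace Stmt13

open MeasureTheory Filter Topology

lemma pow_maj_En {X : MA ℝ} (hX : NN X) (m : ℕ) : Maj (X ^ m) ((m.factorial : ℝ) • En (m + 1) X) := by
  have h1 : En (m + 1) X = En m X + ((m.factorial : ℝ)⁻¹) • X ^ m := by rw [En, sum_range_succ]; rfl
  have h2 : (m.factorial : ℝ) • En (m + 1) X = (m.factorial : ℝ) • En m X + X ^ m := by
    rw [h1, smul_add, smul_smul, mul_inv_cancel₀ (by positivity), one_smul]
  rw [h2]
  intro n
  have h3 := (((En_nn (n := m) hX).smul (m.factorial : ℝ) (by positivity))) n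
  have h4 := (hX.pow m).maj n
  simp only [MonoidAlgebra.coeff_add, Finsupp.add_apply]
  linarith

lemma P1_pow_maj {γ : ℕ → ℝ} {c : ℕ → ℕ → ℂ} (hγ : ∀ p, 0 ≤ γ p) (hc : ∀ l p, ‖c l p‖ ≤ γ p) (i l m : ℕ) (hm : 1 ≤ m) :
    Maj (P1 c i l ^ m) (((m.factorial : ℝ) / √(m:ℝ) ^ m) • ∏ p ∈ Blk i, En (m + 1) (MonoidAlgebra.single p (√(m:ℝ) * γ p))) := by
  have hs : 0 < √(m:ℝ) := Real.sqrt_pos.2 (by exact_mod_cast hm)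
  set Y : MA ℝ := ∑ p ∈ Blk i, MonoidAlgebra.single p (γ p) with hY
  have h1 : Maj (P1 c i l) Y := by
    apply Maj.sum; intro p _; exact Maj.single _ _ _ (hc l p)
  have hYn : NN Y := h1.nn
  set Z : MA ℝ := ∑ p ∈ Blk i, MonoidAlgebra.single p (√(m:ℝ) * γ p) with hZ
  have hZY : Z = √(m:ℝ) • Y := by
    rw [hZ, hY, smul_sum]; apply sum_congr rfl; intro p _
    rw [MonoidAlgebra.smul_single, smul_eq_mul]
  have hZn : NN Z := by rw [hZY]; exact hYn.smul _ hs.le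
  have h2 : Maj (Y ^ m) ((1 / √(m:ℝ) ^ m) • ((m.factorial : ℝ) • En (m + 1) Z)) := by
    have h3 := Maj.smul (1 / √(m:ℝ) ^ m : ℝ) (1 / √(m:ℝ) ^ m) (by rw [Real.norm_of_nonneg (by positivity)]) (pow_maj_En hZn m)
    have h4 : (1 / √(m:ℝ) ^ m : ℝ) • Z ^ m = Y ^ m := by
      rw [hZY, smul_pow, smul_smul, one_div, inv_mul_cancel₀ (by positivity), one_smul]
    rwa [h4] at h3
  have h5 : Maj (En (m + 1) Z) (∏ p ∈ Blk i, En (m + 1) (MonoidAlgebra.single p (√(m:ℝ) * γ p))) := by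
    apply En_sum (by omega)
    intro p _; exact NN.single _ _ (mul_nonneg hs.le (hγ p))
  refine (h1.pow m).trans (h2.trans ?_)
  rw [smul_smul]
  have : (1 / √(m:ℝ) ^ m * (m.factorial : ℝ)) = (m.factorial : ℝ) / √(m:ℝ) ^ m := by ring
  rw [this]
  exact Maj.smul _ _ (by rw [Real.norm_of_nonneg (by positivity)]) h5

lemma blk_gamma {b : ℝ} {γ : ℕ → ℝ} (hγb : ∀ p, γ p ^ 2 ≤ b ^ 2 / p) (i : ℕ) : ∑ p ∈ Blk i, γ p ^ 2 ≤ 4 * b ^ 2 := by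
  calc ∑ p ∈ Blk i, γ p ^ 2 ≤ ∑ p ∈ Blk i, b ^ 2 * (1 / (p:ℝ)) := by
        apply sum_le_sum; intro p _; rw [mul_one_div]; exact hγb p
    _ = b ^ 2 * ∑ p ∈ Blk i, 1 / (p:ℝ) := by rw [mul_sum]
    _ ≤ b ^ 2 * 4 := by gcongr; exact Blk_sum i
    _ = _ := by ring

lemma fail_mean {b : ℝ} {γ : ℕ → ℝ} {c d : ℕ → ℕ → ℂ} (hb : 0 ≤ b) (hγ : ∀ p, 0 ≤ γ p) (hγb : ∀ p, γ p ^ 2 ≤ b ^ 2 / p)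
    (hc : ∀ l p, ‖c l p‖ ≤ γ p) (hd : ∀ l p, ‖d l p‖ ≤ b / p)
    {H : ℕ} (hH : 4 ≤ H) (L l l' : ℕ) (hl : l < L) {q : ℕ} [NeZero q] (hq : 1 < q) (hL : L = 0 ∨ ((24 * H + 2 : ℕ):ℝ) * 2 ^ L ≤ Real.log q) :
    ∑ χ : DirichletCharacter ℂ q, ‖ev χ (AA H L c d l * P1 c l l' ^ (2 ^ (L - l)))‖ ^ 2 ≤
      Nat.totient q * (Real.exp (∑ p ∈ PS L, γ p ^ 2 + 2 * (b + 4 * b ^ 2 * Real.exp (2 * b)) ^ 2) *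
        ((2:ℝ) ^ (L - l) * Real.exp (4 * b ^ 2)) ^ (2 ^ (L - l))) := by
  set m := 2 ^ (L - l) with hm
  have hm1 : 1 ≤ m := Nat.one_le_two_pow
  have hmR : ((2:ℝ) ^ (L - l)) = (m : ℝ) := by rw [hm]; push_cast; rfl
  rw [hmR]
  have hmpos : (0:ℝ) < m := by exact_mod_cast hm1
  have hs : 0 < √(m:ℝ) := Real.sqrt_pos.2 hmpos
  have hM := (AA_maj hb hγ hc hd hH L l).mul (P1_pow_maj hγ hc l l' m hm1)
  refine (ev_sum _ _ hM ?_).trans ?_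
  · have hLL : ((24 * H + 2 : ℕ):ℝ) * 2 ^ L ≤ Real.log q := by
      rcases hL with h | h
      · omega
      · exact h
    have hP1 : ∀ D : ℕ, (∀ p ∈ Blk l, p ≤ D) → Sup (P1 c l l') (fun n => n ≤ D) := by
      intro D hD
      apply Sup.sum; intro p hp
      exact Sup.single (pr := fun n => n ≤ D) p _ (hD p hp)
    have hP2 := Sup_pow_le (hP1 (2 ^ 2 ^ (l + 1)) (fun p hp => (Blk_lt hp).le)) m
    refine Sup.mul ?_ (Sup_AA H L c d l) hP2
    intro x y hx hy
    set E := ∑ i ∈ range l, 2 ^ (i + 2) * nnt H (L - i) with hE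
    have e1 : 2 ^ (l + 1) * m = 2 * 2 ^ L := by
      rw [hm, ← pow_add, ← pow_succ']; congr 1; omega
    have h1 : x * y ≤ 2 ^ (E + 2 * 2 ^ L) := by
      rw [pow_add, ← e1, pow_mul]; exact Nat.mul_le_mul hx hy
    refine lt_of_le_of_lt h1 (two_pow_lt hq ?_ hLL)
    have h2 := deg_bound H L l hl.le
    push_cast at h2 ⊢
    rw [hE]; push_cast; linarith
  · apply mul_le_mul_of_nonneg_left _ (by positivity)
    set f : ℕ → ℕ → MA ℝ := fun i p => if i < l then gP b γ (nnt H (L - i)) p else En (m + 1) (MonoidAlgebra.single p (√(m:ℝ) * γ p)) with hf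
    have e1 : ∏ i ∈ range l, ∏ p ∈ Blk i, gP b γ (nnt H (L - i)) p = ∏ i ∈ range l, ∏ p ∈ Blk i, f i p := by
      apply prod_congr rfl; intro i hi; apply prod_congr rfl; intro p _
      simp only [hf, if_pos (mem_range.1 hi)]
    have e2 : ∏ p ∈ Blk l, En (m + 1) (MonoidAlgebra.single p (√(m:ℝ) * γ p)) = ∏ p ∈ Blk l, f l p := by
      apply prod_congr rfl; intro p _; simp [hf]
    have e3 : ∏ i ∈ range l, ∏ p ∈ Blk i, nrm2 (gP b γ (nnt H (L - i)) p) = ∏ i ∈ range l, ∏ p ∈ Blk i, nrm2 (f i p) := by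
      apply prod_congr rfl; intro i hi; apply prod_congr rfl; intro p _
      simp only [hf, if_pos (mem_range.1 hi)]
    have hA := AA_prod_bound hb hγ hγb hH L l hl.le
    rw [e3] at hA
    rw [e1, e2, mul_smul_comm, ← prod_range_succ (fun i => ∏ p ∈ Blk i, f i p) l, nrm2_smul]
    have hB := blocks_nrm2 (l + 1) f (fun i p => by
      simp only [hf]; split_ifs
      · exact Sup_En_pow _ _ _
      · exact Sup_En_single _ _)
    have hC : ∏ p ∈ Blk l, nrm2 (f l p) ≤ Real.exp (4 * b ^ 2) ^ m := by
      calc ∏ p ∈ Blk l, nrm2 (f l p) ≤ ∏ p ∈ Blk l, Real.exp (m * γ p ^ 2) := by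
            apply prod_le_prod (fun p _ => nrm2_nonneg _)
            intro p hp
            simp only [hf, lt_irrefl, if_false]
            refine (nrm2_En_single (Blk_prime hp).two_le _ _).trans (le_of_eq ?_)
            rw [mul_pow, Real.sq_sqrt hmpos.le]
        _ = Real.exp (m * ∑ p ∈ Blk l, γ p ^ 2) := by rw [mul_sum, Real.exp_sum]
        _ ≤ Real.exp (m * (4 * b ^ 2)) := by
            apply Real.exp_le_exp.2; gcongr; exact blk_gamma hγb l
        _ = _ := by rw [← Real.exp_nat_mul]
    rw [prod_range_succ (fun i => ∏ p ∈ Blk i, nrm2 (f i p)) l] at hB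
    have hfac : ((m.factorial : ℝ) / √(m:ℝ) ^ m) ^ 2 ≤ (m:ℝ) ^ m := by
      rw [div_pow, ← pow_mul, mul_comm m 2, pow_mul, Real.sq_sqrt hmpos.le, div_le_iff₀ (by positivity)]
      have : (m.factorial : ℝ) ≤ (m:ℝ) ^ m := by exact_mod_cast Nat.factorial_le_pow m
      nlinarith [show (0:ℝ) ≤ m.factorial by positivity]
    set EW := Real.exp (∑ p ∈ PS L, γ p ^ 2 + 2 * (b + 4 * b ^ 2 * Real.exp (2 * b)) ^ 2) with hEW
    calc ((m.factorial : ℝ) / √(m:ℝ) ^ m) ^ 2 * nrm2 (∏ i ∈ range (l + 1), ∏ p ∈ Blk i, f i p)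
        ≤ (m:ℝ) ^ m * (EW * Real.exp (4 * b ^ 2) ^ m) := by
          apply mul_le_mul hfac _ (nrm2_nonneg _) (by positivity)
          refine hB.trans (mul_le_mul hA hC (prod_nonneg fun p _ => nrm2_nonneg _) (Real.exp_pos _).le)
      _ = _ := by rw [mul_pow]; ring

end Stmt13

namespace Stmt13

open MeasureTheory Filter Topology

lemma half_geo (L l : ℕ) (hl : l ≤ L) : ∑ i ∈ range l, ((1:ℝ) / 2) ^ (L - i) ≤ 1 := by
  have h1 : ∀ k ≤ L, ∑ i ∈ range k, ((1:ℝ) / 2) ^ (L - i) ≤ (1 / 2) ^ (L - k) := by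
    intro k
    induction k with
    | zero => intro _; simp
    | succ k ih =>
      intro hk
      rw [sum_range_succ]
      have := ih (by omega)
      obtain ⟨j, hj⟩ : ∃ j, L - k = j + 1 := ⟨L - k - 1, by omega⟩
      have hj' : L - (k + 1) = j := by omega
      rw [hj']; rw [hj] at this ⊢
      rw [pow_succ] at this ⊢
      linarith
  exact (h1 l hl).trans (pow_le_one₀ (by norm_num) (by norm_num))

lemma ev_PP_norm {b : ℝ} {c d : ℕ → ℕ → ℂ} (hb : 0 ≤ b) (hd : ∀ l p, ‖d l p‖ ≤ b / p) {q : ℕ} (χ : DirichletCharacter ℂ q) (i l : ℕ) :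
    ‖ev χ (PP c d i l)‖ ≤ ‖ev χ (P1 c i l)‖ + 4 * b := by
  have h1 : ev χ (PP c d i l) = ev χ (P1 c i l) + ∑ p ∈ Blk i, ev χ (MonoidAlgebra.single (p ^ 2) (d l p)) := by
    rw [PP, P1, sum_add_distrib, map_add, map_sum, map_sum]
  rw [h1]
  refine (norm_add_le _ _).trans ?_
  gcongr
  calc ‖∑ p ∈ Blk i, ev χ (MonoidAlgebra.single (p ^ 2) (d l p))‖ ≤ ∑ p ∈ Blk i, b * (1 / (p:ℝ)) := by
        refine norm_sum_le_of_le _ (fun p _ => ?_)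
        rw [ev_single, norm_mul, mul_one_div]
        calc ‖d l p‖ * ‖χ ((p ^ 2 : ℕ) : ZMod q)‖ ≤ ‖d l p‖ * 1 := by gcongr; exact χ.norm_le_one _
          _ ≤ _ := by rw [mul_one]; exact hd l p
    _ = b * ∑ p ∈ Blk i, (1 / (p:ℝ)) := by rw [mul_sum]
    _ ≤ b * 4 := by gcongr; exact Blk_sum i
    _ = _ := by ring

lemma good_prod {b : ℝ} {c d : ℕ → ℕ → ℂ} (hb : 0 ≤ b) (hd : ∀ l p, ‖d l p‖ ≤ b / p) {H : ℕ} (hH : 4 ≤ H) (hHb : 21 * (1 + 4 * b) ≤ H)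
    {q : ℕ} (χ : DirichletCharacter ℂ q) (L l : ℕ) (hl : l ≤ L) (hg : ∀ i < l, ‖ev χ (P1 c i l)‖ ≤ (3 / 2 : ℝ) ^ (L - i)) :
    Real.exp (2 * (∑ i ∈ range l, ev χ (PP c d i l)).re) ≤ ‖ev χ (AA H L c d l)‖ ^ 2 * Real.exp 2 := by
  have h1 : Real.exp (2 * (∑ i ∈ range l, ev χ (PP c d i l)).re) = ∏ i ∈ range l, Real.exp (2 * (ev χ (PP c d i l)).re) := by
    rw [re_sum, mul_sum, Real.exp_sum]
  have h2 : ∏ i ∈ range l, Real.exp (2 * (ev χ (PP c d i l)).re) ≤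
      ∏ i ∈ range l, (‖ev χ (En (nnt H (L - i)) (PP c d i l))‖ ^ 2 * Real.exp (2 * (1 / 2) ^ (L - i))) := by
    apply prod_le_prod (fun i _ => (Real.exp_pos _).le)
    intro i hi
    rw [ev_En]
    have hone : (1:ℝ) ≤ (3 / 2) ^ (L - i) := one_le_pow₀ (by norm_num)
    apply exp_trunc _ ((3 / 2 : ℝ) ^ (L - i) + 4 * b) _ _ _ _ (nnt_ge _ hH)
    · exact (ev_PP_norm hb hd χ i l).trans (by have := hg i (mem_range.1 hi); linarith)
    · rw [nnt]; push_cast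
      have h3 : ((3:ℝ) / 2) ^ (L - i) ≤ ⌈(3 / 2 : ℝ) ^ (L - i)⌉₊ := Nat.le_ceil _
      calc 21 * ((3 / 2 : ℝ) ^ (L - i) + 4 * b) ≤ 21 * (1 + 4 * b) * (3 / 2 : ℝ) ^ (L - i) := by nlinarith
        _ ≤ H * (3 / 2 : ℝ) ^ (L - i) := by gcongr
        _ ≤ _ := by gcongr
  rw [h1]
  refine h2.trans ?_
  rw [prod_mul_distrib, ← Real.exp_sum, ← mul_sum, prod_pow, AA, map_prod, norm_prod]
  gcongr
  have := half_geo L l hl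
  linarith

/-- main pointwise bound -/
lemma pointwise {b C1 : ℝ} {c d : ℕ → ℕ → ℂ} (hb : 0 ≤ b) (hd : ∀ l p, ‖d l p‖ ≤ b / p) {H : ℕ} (hH : 4 ≤ H) (hHb : 21 * (1 + 4 * b) ≤ H)
    {q : ℕ} (χ : DirichletCharacter ℂ q) (L : ℕ) (X : ℝ)
    (hX : ∀ l ≤ L, X ≤ Real.exp (2 * (∑ i ∈ range l, ev χ (PP c d i l)).re + C1 * 2 ^ (L - l))) :
    X ≤ Real.exp (C1 + 2) * ‖ev χ (AA H L c d L)‖ ^ 2 + ∑ l ∈ range L, ∑ l' ∈ Ioc l L,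
      Real.exp (C1 * 2 ^ (L - l) + 2) * ((4 / 9 : ℝ) ^ (L - l)) ^ (2 ^ (L - l)) * ‖ev χ (AA H L c d l * P1 c l l' ^ (2 ^ (L - l)))‖ ^ 2 := by
  have hbase : ∀ l ≤ L, (∀ i < l, ‖ev χ (P1 c i l)‖ ≤ (3 / 2 : ℝ) ^ (L - i)) →
      X ≤ Real.exp (C1 * 2 ^ (L - l) + 2) * ‖ev χ (AA H L c d l)‖ ^ 2 := by
    intro l hl hg
    refine (hX l hl).trans ?_
    rw [Real.exp_add, Real.exp_add]
    have := good_prod hb hd hH hHb χ L l hl hg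
    nlinarith [Real.exp_pos (C1 * 2 ^ (L - l))]
  by_cases hall : ∀ i < L, ∀ l' ∈ Ioc i L, ‖ev χ (P1 c i l')‖ ≤ (3 / 2 : ℝ) ^ (L - i)
  · have h1 := hbase L le_rfl (fun i hi => hall i hi L (mem_Ioc.2 ⟨hi, le_rfl⟩))
    rw [Nat.sub_self, pow_zero, mul_one] at h1
    refine h1.trans (le_add_of_nonneg_right ?_)
    exact sum_nonneg fun l _ => sum_nonneg fun l' _ => by positivity
  · classical
    have hex : ∃ i, i < L ∧ ∃ l' ∈ Ioc i L, (3 / 2 : ℝ) ^ (L - i) < ‖ev χ (P1 c i l')‖ := by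
      push Not at hall
      obtain ⟨i, hi, l', h1, h2⟩ := hall
      exact ⟨i, hi, l', h1, h2⟩
    set l := Nat.find hex with hldef
    obtain ⟨hlL, l', hl', hbig⟩ := Nat.find_spec hex
    rw [← hldef] at hlL hl' hbig
    have hg : ∀ i < l, ‖ev χ (P1 c i l)‖ ≤ (3 / 2 : ℝ) ^ (L - i) := by
      intro i hi
      have := Nat.find_min hex hi
      push Not at this
      exact this (hi.trans hlL) l (mem_Ioc.2 ⟨hi, hlL.le⟩)
    have h1 := hbase l hlL.le hg
    set m := 2 ^ (L - l) with hm
    have h2 : X ≤ Real.exp (C1 * 2 ^ (L - l) + 2) * ((4 / 9 : ℝ) ^ (L - l)) ^ m * ‖ev χ (AA H L c d l * P1 c l l' ^ m)‖ ^ 2 := by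
      refine h1.trans ?_
      rw [map_mul, map_pow, norm_mul, norm_pow, mul_pow]
      have h3 : 1 ≤ ((4 / 9 : ℝ) ^ (L - l)) ^ m * (‖ev χ (P1 c l l')‖ ^ m) ^ 2 := by
        rw [pow_right_comm ‖_‖ m 2, ← mul_pow]
        apply one_le_pow₀
        have h4 : ((3 / 2 : ℝ) ^ (L - l)) ^ 2 ≤ ‖ev χ (P1 c l l')‖ ^ 2 := pow_le_pow_left₀ (by positivity) hbig.le 2
        calc (1:ℝ) = (4 / 9 : ℝ) ^ (L - l) * ((3 / 2 : ℝ) ^ (L - l)) ^ 2 := by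
              rw [← pow_mul, mul_comm _ 2, pow_mul, ← mul_pow]; norm_num
          _ ≤ _ := by gcongr
      have h5 : 0 ≤ Real.exp (C1 * 2 ^ (L - l) + 2) * ‖ev χ (AA H L c d l)‖ ^ 2 := by positivity
      calc _ ≤ Real.exp (C1 * 2 ^ (L - l) + 2) * ‖ev χ (AA H L c d l)‖ ^ 2 * (((4 / 9 : ℝ) ^ (L - l)) ^ m * (‖ev χ (P1 c l l')‖ ^ m) ^ 2) := le_mul_of_one_le_right h5 h3
        _ = _ := by ring
    have h6 : X ≤ ∑ l ∈ range L, ∑ l' ∈ Ioc l L,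
      Real.exp (C1 * 2 ^ (L - l) + 2) * ((4 / 9 : ℝ) ^ (L - l)) ^ (2 ^ (L - l)) * ‖ev χ (AA H L c d l * P1 c l l' ^ (2 ^ (L - l)))‖ ^ 2 := by
      refine h2.trans ?_
      refine le_trans ?_ (single_le_sum (f := fun l => ∑ l' ∈ Ioc l L,
        Real.exp (C1 * 2 ^ (L - l) + 2) * ((4 / 9 : ℝ) ^ (L - l)) ^ (2 ^ (L - l)) * ‖ev χ (AA H L c d l * P1 c l l' ^ (2 ^ (L - l)))‖ ^ 2)
        (fun l _ => sum_nonneg fun l' _ => by positivity) (mem_range.2 hlL))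
      exact single_le_sum (f := fun l' => 
        Real.exp (C1 * 2 ^ (L - l) + 2) * ((4 / 9 : ℝ) ^ (L - l)) ^ (2 ^ (L - l)) * ‖ev χ (AA H L c d l * P1 c l l' ^ (2 ^ (L - l)))‖ ^ 2)
        (fun l' _ => by positivity) hl'
    exact h6.trans (le_add_of_nonneg_left (by positivity))

/-- tail series -/
noncomputable def gT (D : ℝ) (N : ℕ) : ℝ := N * (D * (8 / 9) ^ N) ^ (2 ^ N)

lemma gT_nonneg {D : ℝ} (hD : 0 ≤ D) (N : ℕ) : 0 ≤ gT D N := by rw [gT]; positivity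

lemma gT_summable {D : ℝ} (hD : 0 ≤ D) : Summable (gT D) := by
  have hs : Summable (fun n : ℕ => (n:ℝ) ^ 1 * (1 / 2 : ℝ) ^ n) :=
    summable_pow_mul_geometric_of_norm_lt_one 1 (by norm_num)
  apply Summable.of_norm_bounded_eventually_nat hs
  have ht : Tendsto (fun N : ℕ => D * (8 / 9 : ℝ) ^ N) atTop (𝓝 (D * 0)) :=
    (tendsto_pow_atTop_nhds_zero_of_lt_one (by norm_num) (by norm_num)).const_mul D
  rw [mul_zero] at ht
  filter_upwards [ht.eventually (gt_mem_nhds (show (0:ℝ) < 1 / 2 by norm_num))] with N hN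
  rw [Real.norm_of_nonneg (gT_nonneg hD N), gT, pow_one]
  gcongr
  calc (D * (8 / 9 : ℝ) ^ N) ^ (2 ^ N) ≤ (1 / 2) ^ (2 ^ N) := pow_le_pow_left₀ (by positivity) hN.le _
    _ ≤ (1 / 2) ^ N := pow_le_pow_of_le_one (by norm_num) (by norm_num) Nat.lt_two_pow_self.le

/-- the abstract moment bound -/
lemma harper (b C1 : ℝ) (hb : 0 ≤ b) {H : ℕ} (hH : 4 ≤ H) (hHb : 21 * (1 + 4 * b) ≤ H) :
    ∃ C2 > 0, ∀ (q : ℕ) [NeZero q], 1 < q → ∀ (γ : ℕ → ℝ) (c d : ℕ → ℕ → ℂ), (∀ p, 0 ≤ γ p) → (∀ p, γ p ^ 2 ≤ b ^ 2 / p) →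
      (∀ l p, ‖c l p‖ ≤ γ p) → (∀ l p, ‖d l p‖ ≤ b / p) → ∀ L : ℕ, (L = 0 ∨ ((24 * H + 2 : ℕ):ℝ) * 2 ^ L ≤ Real.log q) →
      ∀ (Y : Finset (DirichletCharacter ℂ q)) (X : DirichletCharacter ℂ q → ℝ),
      (∀ χ ∈ Y, ∀ l ≤ L, X χ ≤ Real.exp (2 * (∑ i ∈ range l, ev χ (PP c d i l)).re + C1 * 2 ^ (L - l))) →
      ∑ χ ∈ Y, X χ ≤ C2 * Nat.totient q * Real.exp (∑ p ∈ PS L, γ p ^ 2) := by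
  set K := 2 * (b + 4 * b ^ 2 * Real.exp (2 * b)) ^ 2 with hK
  set D := Real.exp C1 * Real.exp (4 * b ^ 2) with hD
  have hD0 : 0 ≤ D := by positivity
  have hT : 0 ≤ ∑' N, gT D N := tsum_nonneg (gT_nonneg hD0)
  refine ⟨Real.exp K * (Real.exp (C1 + 2) + Real.exp 2 * ∑' N, gT D N), by positivity, ?_⟩
  intro q _ hq γ c d hγ hγb hc hd L hL Y X hX
  set W := ∑ p ∈ PS L, γ p ^ 2
  have hA := AA_mean hb hγ hγb hc hd hH L L le_rfl hq hL
  have hF := fun l l' hl => fail_mean hb hγ hγb hc hd hH L l l' hl hq hL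
  set φ : ℝ := (Nat.totient q : ℝ)
  have hφ : 0 ≤ φ := by positivity
  set B : DirichletCharacter ℂ q → ℝ := fun χ => Real.exp (C1 + 2) * ‖ev χ (AA H L c d L)‖ ^ 2 + ∑ l ∈ range L, ∑ l' ∈ Ioc l L,
      Real.exp (C1 * 2 ^ (L - l) + 2) * ((4 / 9 : ℝ) ^ (L - l)) ^ (2 ^ (L - l)) * ‖ev χ (AA H L c d l * P1 c l l' ^ (2 ^ (L - l)))‖ ^ 2 with hB
  have hB0 : ∀ χ, 0 ≤ B χ := fun χ => add_nonneg (by positivity) (sum_nonneg fun l _ => sum_nonneg fun l' _ => by positivity)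
  have hterm : ∀ l ∈ range L, ∑ l' ∈ Ioc l L,
      Real.exp (C1 * 2 ^ (L - l) + 2) * ((4 / 9 : ℝ) ^ (L - l)) ^ (2 ^ (L - l)) * (∑ χ : DirichletCharacter ℂ q, ‖ev χ (AA H L c d l * P1 c l l' ^ (2 ^ (L - l)))‖ ^ 2)
      ≤ φ * Real.exp (W + K) * Real.exp 2 * gT D (L - 1 - l + 1) := by
    intro l hl
    have hl := mem_range.1 hl
    have e0 : L - 1 - l + 1 = L - l := by omega
    rw [e0]
    set N := L - l with hN
    calc _ ≤ ∑ l' ∈ Ioc l L, Real.exp (C1 * 2 ^ N + 2) * ((4 / 9 : ℝ) ^ N) ^ (2 ^ N) * (φ * (Real.exp (W + K) *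
        ((2:ℝ) ^ N * Real.exp (4 * b ^ 2)) ^ (2 ^ N))) := by
          apply sum_le_sum; intro l' _
          exact mul_le_mul_of_nonneg_left (hF l l' hl) (by positivity)
      _ = N * (Real.exp (C1 * 2 ^ N + 2) * ((4 / 9 : ℝ) ^ N) ^ (2 ^ N) * (φ * (Real.exp (W + K) *
        ((2:ℝ) ^ N * Real.exp (4 * b ^ 2)) ^ (2 ^ N)))) := by
          rw [sum_const, Nat.card_Ioc, nsmul_eq_mul]
      _ = φ * Real.exp (W + K) * Real.exp 2 * gT D N := by
          rw [gT, hD, Real.exp_add]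
          have e1 : Real.exp (C1 * 2 ^ N) = Real.exp C1 ^ (2 ^ N) := by
            rw [← Real.exp_nat_mul]; congr 1; push_cast; ring
          have e2 : (8 / 9 : ℝ) ^ N = (4 / 9) ^ N * 2 ^ N := by rw [← mul_pow]; norm_num
          rw [e1, e2]
          simp only [mul_pow]
          ring
      _ ≤ _ := le_rfl
  calc ∑ χ ∈ Y, X χ ≤ ∑ χ ∈ Y, B χ := sum_le_sum fun χ hχ => pointwise hb hd hH hHb χ L (X χ) (hX χ hχ)
    _ ≤ ∑ χ, B χ := sum_le_sum_of_subset_of_nonneg (subset_univ _) (fun χ _ _ => hB0 χ)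
    _ = Real.exp (C1 + 2) * (∑ χ : DirichletCharacter ℂ q, ‖ev χ (AA H L c d L)‖ ^ 2) + ∑ l ∈ range L, ∑ l' ∈ Ioc l L,
      Real.exp (C1 * 2 ^ (L - l) + 2) * ((4 / 9 : ℝ) ^ (L - l)) ^ (2 ^ (L - l)) * (∑ χ : DirichletCharacter ℂ q, ‖ev χ (AA H L c d l * P1 c l l' ^ (2 ^ (L - l)))‖ ^ 2) := by
        simp only [hB]
        rw [sum_add_distrib, ← mul_sum]
        congr 1
        rw [sum_comm]
        apply sum_congr rfl; intro l _
        rw [sum_comm]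
        apply sum_congr rfl; intro l' _
        rw [← mul_sum]
    _ ≤ Real.exp (C1 + 2) * (φ * Real.exp (W + K)) + ∑ l ∈ range L, φ * Real.exp (W + K) * Real.exp 2 * gT D (L - 1 - l + 1) := by
        apply add_le_add
        · exact mul_le_mul_of_nonneg_left hA (Real.exp_pos _).le
        · exact sum_le_sum hterm
    _ = Real.exp (C1 + 2) * (φ * Real.exp (W + K)) + φ * Real.exp (W + K) * Real.exp 2 * ∑ l ∈ range L, gT D (l + 1) := by
        rw [← mul_sum, sum_range_reflect (fun j => gT D (j + 1)) L]
    _ ≤ Real.exp (C1 + 2) * (φ * Real.exp (W + K)) + φ * Real.exp (W + K) * Real.exp 2 * ∑' N, gT D N := by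
        gcongr
        have h1 : ∑ l ∈ range L, gT D (l + 1) ≤ ∑ l ∈ range (L + 1), gT D l := by
          rw [sum_range_succ']; exact le_add_of_nonneg_right (gT_nonneg hD0 0)
        exact h1.trans ((gT_summable hD0).sum_le_tsum _ (fun i _ => gT_nonneg hD0 i))
    _ = _ := by rw [Real.exp_add W K]; ring

end Stmt13

namespace Stmt13

open MeasureTheory Filter Topology

lemma pp_sum_bound : ∃ E : ℝ, 0 < E ∧ ∀ N : ℕ, ∑ x ∈ (range N).filter Nat.Prime ×ˢ Ico 3 N, (√(x.1:ℝ))⁻¹ ^ x.2 ≤ E := by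
  have hs : Summable (fun n : ℕ => 1 / (n:ℝ) ^ (3 / 2 : ℝ)) := Real.summable_one_div_nat_rpow.2 (by norm_num)
  have h0 : 0 ≤ ∑' n : ℕ, 1 / (n:ℝ) ^ (3 / 2 : ℝ) := tsum_nonneg fun n => by positivity
  refine ⟨4 * ∑' n : ℕ, 1 / (n:ℝ) ^ (3 / 2 : ℝ) + 1, by positivity, fun N => ?_⟩
  rw [sum_product]
  calc ∑ p ∈ (range N).filter Nat.Prime, ∑ k ∈ Ico 3 N, (√(p:ℝ))⁻¹ ^ k ≤ ∑ p ∈ (range N).filter Nat.Prime, 4 * (1 / (p:ℝ) ^ (3 / 2 : ℝ)) := by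
        apply sum_le_sum; intro p hp
        have hp2 : (2:ℝ) ≤ p := by exact_mod_cast (mem_filter.1 hp).2.two_le
        set r := (√(p:ℝ))⁻¹ with hr
        have hr0 : 0 ≤ r := by positivity
        have hsq : (4 / 3 : ℝ) ≤ √(p:ℝ) := by
          apply Real.le_sqrt_of_sq_le; norm_num; linarith
        have hr1 : r ≤ 3 / 4 := by
          rw [hr, inv_le_comm₀ (by positivity) (by norm_num)]; norm_num at hsq ⊢; exact hsq
        have h3 : r ^ 3 = 1 / (p:ℝ) ^ (3 / 2 : ℝ) := by
          rw [hr, Real.sqrt_eq_rpow, inv_pow, ← Real.rpow_natCast, ← Real.rpow_mul (by positivity)]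
          norm_num
        rw [← h3, sum_Ico_eq_sum_range]
        have h4 : ∑ k ∈ range (N - 3), r ^ k ≤ 4 := by
          have hsum : Summable (fun k : ℕ => r ^ k) := summable_geometric_of_lt_one hr0 (by linarith)
          refine (hsum.sum_le_tsum _ (fun _ _ => by positivity)).trans ?_
          rw [tsum_geometric_of_lt_one hr0 (by linarith), inv_le_comm₀ (by linarith) (by norm_num)]
          linarith
        simp only [pow_add]
        rw [← mul_sum]
        nlinarith [pow_nonneg hr0 3]
    _ = 4 * ∑ p ∈ (range N).filter Nat.Prime, (1 / (p:ℝ) ^ (3 / 2 : ℝ)) := by rw [mul_sum]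
    _ ≤ 4 * ∑' n : ℕ, 1 / (n:ℝ) ^ (3 / 2 : ℝ) := by
        gcongr
        exact hs.sum_le_tsum _ (fun _ _ => by positivity)
    _ ≤ _ := by linarith

lemma pp_split : ∃ E : ℝ, 0 < E ∧ ∀ (B : ℝ) (N : ℕ) (u : ℕ → ℂ), 0 ≤ B → (∀ n, ¬ IsPrimePow n → u n = 0) →
    (∀ n, 1 ≤ n → ‖u n‖ ≤ B * (√(n:ℝ))⁻¹) →
    ‖∑ n ∈ range N, u n - ∑ p ∈ (range N).filter Nat.Prime, (u p + if p ^ 2 < N then u (p ^ 2) else 0)‖ ≤ B * E := by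
  classical
  obtain ⟨E, hE, hEb⟩ := pp_sum_bound
  refine ⟨E, hE, fun B N u hB hu0 hub => ?_⟩
  set S := (range N).filter Nat.Prime with hS
  set T := (range N).filter (fun n => ¬ n.Prime) with hT
  set Q := (S.filter (fun p => p ^ 2 < N)).image (fun p => p ^ 2) with hQ
  have hQT : Q ⊆ T := by
    intro n hn
    obtain ⟨p, hp, rfl⟩ := mem_image.1 hn
    have := (mem_filter.1 hp).2
    exact mem_filter.2 ⟨mem_range.2 this, Nat.Prime.not_prime_pow le_rfl⟩
  have e1 : ∑ n ∈ range N, u n = ∑ p ∈ S, u p + ∑ n ∈ T, u n := (sum_filter_add_sum_filter_not _ _ _).symm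
  have e2 : ∑ n ∈ T, u n = ∑ n ∈ T \ Q, u n + ∑ n ∈ Q, u n := (sum_sdiff hQT).symm
  have e3 : ∑ n ∈ Q, u n = ∑ p ∈ S, if p ^ 2 < N then u (p ^ 2) else 0 := by
    rw [hQ, sum_image, sum_filter]
    intro x _ y _ h
    exact Nat.pow_left_injective (by norm_num) h
  have e4 : ∑ n ∈ range N, u n - ∑ p ∈ S, (u p + if p ^ 2 < N then u (p ^ 2) else 0) = ∑ n ∈ T \ Q, u n := by
    rw [e1, e2, e3, sum_add_distrib]; ring
  rw [e4]
  have e5 : ∑ n ∈ T \ Q, u n = ∑ n ∈ (T \ Q).filter IsPrimePow, u n := by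
    rw [sum_filter]; apply sum_congr rfl; intro n _
    split_ifs with h
    · rfl
    · exact hu0 n h
  rw [e5]
  have hsub : (T \ Q).filter IsPrimePow ⊆ (S ×ˢ Ico 3 N).image (fun x => x.1 ^ x.2) := by
    intro n hn
    obtain ⟨h1, h2⟩ := mem_filter.1 hn
    obtain ⟨h3, h4⟩ := mem_sdiff.1 h1
    obtain ⟨h5, h6⟩ := mem_filter.1 h3
    have hnN := mem_range.1 h5
    obtain ⟨p, k, hp, hk, rfl⟩ := (isPrimePow_nat_iff _).1 h2
    have hpn : p ≤ p ^ k := Nat.le_self_pow (by omega) p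
    have hkn : k < p ^ k := Nat.lt_pow_self hp.one_lt
    have hpS : p ∈ S := mem_filter.2 ⟨mem_range.2 (by omega), hp⟩
    refine mem_image.2 ⟨(p, k), mem_product.2 ⟨hpS, mem_Ico.2 ⟨?_, by simp only; omega⟩⟩, rfl⟩
    by_contra hlt
    have : k = 1 ∨ k = 2 := by simp only at hlt; omega
    rcases this with rfl | rfl
    · rw [pow_one] at h6; exact h6 hp
    · exact h4 (mem_image.2 ⟨p, mem_filter.2 ⟨hpS, hnN⟩, rfl⟩)
  calc ‖∑ n ∈ (T \ Q).filter IsPrimePow, u n‖ ≤ ∑ n ∈ (T \ Q).filter IsPrimePow, ‖u n‖ := norm_sum_le _ _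
    _ ≤ ∑ n ∈ (S ×ˢ Ico 3 N).image (fun x => x.1 ^ x.2), ‖u n‖ := sum_le_sum_of_subset_of_nonneg hsub (fun _ _ _ => norm_nonneg _)
    _ = ∑ x ∈ S ×ˢ Ico 3 N, ‖u (x.1 ^ x.2)‖ := by
        rw [sum_image]
        rintro ⟨p, k⟩ hx ⟨p', k'⟩ hx' h
        simp only [coe_product, Set.mem_prod, mem_coe, mem_Ico] at hx hx'
        have hp := (mem_filter.1 hx.1).2
        have hp' := (mem_filter.1 hx'.1).2
        obtain ⟨j, rfl⟩ : ∃ j, k = j + 1 := ⟨k - 1, by omega⟩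
        obtain ⟨j', rfl⟩ : ∃ j, k' = j + 1 := ⟨k' - 1, by omega⟩
        obtain ⟨h1, h2⟩ := Nat.Prime.pow_inj hp hp' h
        rw [h1, h2]
    _ ≤ ∑ x ∈ S ×ˢ Ico 3 N, B * (√(x.1:ℝ))⁻¹ ^ x.2 := by
        apply sum_le_sum; intro x hx
        have hp := (mem_filter.1 (mem_product.1 hx).1).2
        refine (hub _ (Nat.one_le_pow _ _ hp.pos)).trans (le_of_eq ?_)
        congr 1
        push_cast
        rw [inv_pow, Real.sqrt_eq_rpow, Real.sqrt_eq_rpow, ← Real.rpow_natCast, ← Real.rpow_natCast, ← Real.rpow_mul (by positivity), ← Real.rpow_mul (by positivity), mul_comm]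
    _ = B * ∑ x ∈ S ×ˢ Ico 3 N, (√(x.1:ℝ))⁻¹ ^ x.2 := by rw [mul_sum]
    _ ≤ B * E := by gcongr; exact hEb N

lemma exists_L (κ x : ℝ) (hκ : 0 < κ) : ∃ L : ℕ, x ≤ κ * 2 ^ (L + 1) ∧ (L = 0 ∨ κ * 2 ^ L ≤ x) := by
  rcases le_total (x / κ) 1 with h | h
  · refine ⟨0, ?_, Or.inl rfl⟩
    rw [div_le_one hκ] at h; norm_num; linarith
  · obtain ⟨n, h1, h2⟩ := exists_nat_pow_near h (show (1:ℝ) < 2 by norm_num)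
    refine ⟨n, ?_, Or.inr ?_⟩
    · rw [div_lt_iff₀ hκ] at h2; linarith
    · rw [le_div_iff₀ hκ] at h1; linarith

lemma ncpow_norm {n : ℕ} (hn : 1 ≤ n) {s : ℂ} (hs : 1 / 2 ≤ s.re) : ‖(n:ℂ) ^ (-s)‖ ≤ (√(n:ℝ))⁻¹ := by
  have hn' : (1:ℝ) ≤ n := by exact_mod_cast hn
  rw [Complex.norm_natCast_cpow_of_pos (by omega), Complex.neg_re, Real.sqrt_eq_rpow, ← Real.rpow_neg (by positivity)]
  exact Real.rpow_le_rpow_of_exponent_le hn' (by linarith)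

lemma size_bound {A : ℝ} (hA : 0 < A) {q : ℕ} (hq : 1 < q) {y : ℝ} (hy : 2 ≤ y) {t : ℝ} (ht : |t| ≤ (q:ℝ) ^ A) :
    Real.log (q * (2 + ‖(1 / 2 + 1 / Real.log y + t * Complex.I : ℂ)‖)) ≤ (A + 5) * Real.log q := by
  have hq2 : (2:ℝ) ≤ q := by exact_mod_cast hq
  have hl := log_y_ge y hy
  have h1 : ‖(1 / 2 + 1 / Real.log y + t * Complex.I : ℂ)‖ ≤ 1 / 2 + 2 + (q:ℝ) ^ A := by
    refine (norm_add_le _ _).trans (add_le_add ((norm_add_le _ _).trans (add_le_add ?_ ?_)) ?_)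
    · norm_num
    · rw [norm_div, norm_one, Complex.norm_real, Real.norm_of_nonneg (by linarith), div_le_iff₀ (by linarith)]; linarith
    · rw [norm_mul, Complex.norm_I, mul_one, Complex.norm_real]; exact ht
  have hA3 : (q:ℝ) ^ (3:ℝ) ≤ (q:ℝ) ^ (A + 3) := Real.rpow_le_rpow_of_exponent_le (by linarith) (by linarith)
  have hA4 : (q:ℝ) ^ A ≤ (q:ℝ) ^ (A + 3) := Real.rpow_le_rpow_of_exponent_le (by linarith) (by linarith)
  have h8 : (8:ℝ) ≤ (q:ℝ) ^ (3:ℝ) := by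
    have : (q:ℝ) ^ (3:ℝ) = (q:ℝ) ^ (3:ℕ) := by rw [← Real.rpow_natCast]; norm_num
    rw [this]
    calc (8:ℝ) = 2 ^ 3 := by norm_num
      _ ≤ _ := pow_le_pow_left₀ (by norm_num) hq2 3
  have h2 : (q:ℝ) * (2 + ‖(1 / 2 + 1 / Real.log y + t * Complex.I : ℂ)‖) ≤ (q:ℝ) ^ (A + 5) := by
    have e : (q:ℝ) ^ (A + 5) = q * (q * (q:ℝ) ^ (A + 3)) := by
      have : A + 5 = (A + 3) + 1 + 1 := by ring
      rw [this, Real.rpow_add_one (by positivity), Real.rpow_add_one (by positivity)]; ring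
    rw [e]
    gcongr
    nlinarith
  rw [← Real.log_rpow (by positivity)]
  exact Real.log_le_log (by positivity) h2

end Stmt13

namespace Stmt13

open MeasureTheory Filter Topology

/-- the combined Dirichlet coefficient -/
noncomputable def VV {m : ℕ} (a : Fin m → ℝ) (s : Fin m → ℂ) (n : ℕ) : ℂ := ∑ j, (a j : ℂ) * (n:ℂ) ^ (-s j)
/-- prime coefficients -/
noncomputable def cc {m : ℕ} (F : ℕ → ℕ → ℂ) (a : Fin m → ℝ) (s : Fin m → ℂ) (l p : ℕ) : ℂ :=
  if p.Prime then (1 / 2) * (F (2 ^ 2 ^ l) p * VV a s p) else 0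
/-- prime square coefficients -/
noncomputable def dd {m : ℕ} (F : ℕ → ℕ → ℂ) (a : Fin m → ℝ) (s : Fin m → ℂ) (l p : ℕ) : ℂ :=
  if p.Prime then (if p ^ 2 < 2 ^ 2 ^ l then (1 / 4) * (F (2 ^ 2 ^ l) (p ^ 2) * VV a s (p ^ 2)) else 0) else 0
/-- size of prime coefficients -/
noncomputable def gg {m : ℕ} (a : Fin m → ℝ) (s : Fin m → ℂ) (p : ℕ) : ℝ := if p.Prime then ‖VV a s p‖ / 2 else 0

lemma VV_norm {m : ℕ} {a : Fin m → ℝ} (ha : ∀ j, 0 ≤ a j) {s : Fin m → ℂ} (hs : ∀ j, 1 / 2 ≤ (s j).re) {n : ℕ} (hn : 1 ≤ n) :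
    ‖VV a s n‖ ≤ (∑ j, a j) * (√(n:ℝ))⁻¹ := by
  rw [sum_mul]
  refine norm_sum_le_of_le _ (fun j _ => ?_)
  rw [norm_mul, Complex.norm_real, Real.norm_of_nonneg (ha j)]
  exact mul_le_mul_of_nonneg_left (ncpow_norm hn (hs j)) (ha j)

lemma gg_nonneg {m : ℕ} (a : Fin m → ℝ) (s : Fin m → ℂ) (p : ℕ) : 0 ≤ gg a s p := by
  rw [gg]; split_ifs <;> positivity

lemma gg_sq {m : ℕ} {a : Fin m → ℝ} (ha : ∀ j, 0 ≤ a j) {s : Fin m → ℂ} (hs : ∀ j, 1 / 2 ≤ (s j).re) (p : ℕ) :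
    gg a s p ^ 2 ≤ (∑ j, a j) ^ 2 / p := by
  have hb : 0 ≤ ∑ j, a j := sum_nonneg fun j _ => ha j
  rw [gg]
  split_ifs with hp
  · have h1 := VV_norm ha hs hp.one_le
    have h2 : ‖VV a s p‖ / 2 ≤ (∑ j, a j) * (√(p:ℝ))⁻¹ := by linarith [norm_nonneg (VV a s p)]
    calc _ ≤ ((∑ j, a j) * (√(p:ℝ))⁻¹) ^ 2 := pow_le_pow_left₀ (by positivity) h2 2
      _ = _ := by rw [mul_pow, inv_pow, Real.sq_sqrt (by positivity), div_eq_mul_inv]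
  · rw [zero_pow (by norm_num)]; positivity

lemma cc_norm {m : ℕ} {F : ℕ → ℕ → ℂ} (hF : ∀ N n, ‖F N n‖ ≤ 1) (a : Fin m → ℝ) (s : Fin m → ℂ) (l p : ℕ) :
    ‖cc F a s l p‖ ≤ gg a s p := by
  rw [cc, gg]
  split_ifs with hp
  · rw [norm_mul, norm_mul]
    have h1 := hF (2 ^ 2 ^ l) p
    have h2 := norm_nonneg (VV a s p)
    have h3 : ‖(1 / 2 : ℂ)‖ = 1 / 2 := by norm_num
    rw [h3]
    nlinarith
  · simp

lemma dd_norm {m : ℕ} {F : ℕ → ℕ → ℂ} (hF : ∀ N n, ‖F N n‖ ≤ 1) {a : Fin m → ℝ} (ha : ∀ j, 0 ≤ a j) {s : Fin m → ℂ} (hs : ∀ j, 1 / 2 ≤ (s j).re) (l p : ℕ) :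
    ‖dd F a s l p‖ ≤ (∑ j, a j) / p := by
  have hb : 0 ≤ ∑ j, a j := sum_nonneg fun j _ => ha j
  have h0 : 0 ≤ (∑ j, a j) / p := by positivity
  rw [dd]
  split_ifs with hp h
  · rw [norm_mul, norm_mul]
    have h1 := hF (2 ^ 2 ^ l) (p ^ 2)
    have h2 := norm_nonneg (VV a s (p ^ 2))
    have h3 : ‖(1 / 4 : ℂ)‖ = 1 / 4 := by norm_num
    have h4 := VV_norm ha hs (n := p ^ 2) (Nat.one_le_pow _ _ hp.pos)
    have h5 : √((p ^ 2 : ℕ):ℝ) = p := by push_cast; exact Real.sqrt_sq (by positivity)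
    rw [h5, ← div_eq_mul_inv] at h4
    rw [h3]
    generalize 2 ^ 2 ^ l = NN' at *
    nlinarith
  · simpa using h0
  · simpa using h0

/-- the summand -/
noncomputable def uu {m : ℕ} (F : ℕ → ℂ) (a : Fin m → ℝ) (s : Fin m → ℂ) {q : ℕ} (χ : DirichletCharacter ℂ q) (n : ℕ) : ℂ :=
  F n * (cL χ n * VV a s n)

lemma cL_zero' {q : ℕ} (χ : DirichletCharacter ℂ q) : cL χ 0 = 0 := by simp [cL]

lemma uu_eq {m : ℕ} (F : ℕ → ℂ) (a : Fin m → ℝ) (s : Fin m → ℂ) {q : ℕ} (χ : DirichletCharacter ℂ q) (N : ℕ) :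
    ∑ n ∈ range N, uu F a s χ n = ∑ j, (a j : ℂ) * ∑ n ∈ range N, F n * LSeries.term (cL χ) (s j) n := by
  simp only [mul_sum]
  rw [sum_comm]
  apply sum_congr rfl; intro n _
  rw [uu, VV, mul_sum, mul_sum]
  apply sum_congr rfl; intro j _
  rw [LSeries.term_def₀ (cL_zero' χ)]; ring

lemma uu_pp {m : ℕ} (F : ℕ → ℂ) (a : Fin m → ℝ) (s : Fin m → ℂ) {q : ℕ} (χ : DirichletCharacter ℂ q) (n : ℕ) (hn : ¬ IsPrimePow n) :
    uu F a s χ n = 0 := by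
  rw [uu, cL, ArithmeticFunction.vonMangoldt_eq_zero_iff.2 hn]; simp

lemma uu_norm {m : ℕ} {F : ℕ → ℂ} (hF : ∀ n, ‖F n‖ ≤ 1) {a : Fin m → ℝ} (ha : ∀ j, 0 ≤ a j) {s : Fin m → ℂ} (hs : ∀ j, 1 / 2 ≤ (s j).re)
    {q : ℕ} (χ : DirichletCharacter ℂ q) (n : ℕ) (hn : 1 ≤ n) : ‖uu F a s χ n‖ ≤ (∑ j, a j) * (√(n:ℝ))⁻¹ := by
  rw [uu, norm_mul, norm_mul]
  have h1 := VV_norm ha hs hn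
  have h2 := cL_norm χ n
  have h4 : ‖cL χ n‖ * ‖VV a s n‖ ≤ ‖VV a s n‖ := mul_le_of_le_one_left (norm_nonneg _) h2
  exact (mul_le_of_le_one_left (by positivity) (hF n)).trans (h4.trans h1)

lemma cL_prime {q : ℕ} (χ : DirichletCharacter ℂ q) {p : ℕ} (hp : p.Prime) : cL χ p = χ (p : ZMod q) := by
  have : Real.log p ≠ 0 := (Real.log_pos (by exact_mod_cast hp.one_lt)).ne'
  rw [cL, ArithmeticFunction.vonMangoldt_apply_prime hp, div_self this]; simp

lemma cL_prime_sq {q : ℕ} (χ : DirichletCharacter ℂ q) {p : ℕ} (hp : p.Prime) : cL χ (p ^ 2) = χ ((p ^ 2 : ℕ) : ZMod q) * (1 / 2) := by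
  have : Real.log p ≠ 0 := (Real.log_pos (by exact_mod_cast hp.one_lt)).ne'
  rw [cL, ArithmeticFunction.vonMangoldt_apply_pow (by norm_num), ArithmeticFunction.vonMangoldt_apply_prime hp]
  congr 1
  have e : Real.log p / Real.log ((p ^ 2 : ℕ) : ℝ) = 1 / 2 := by
    rw [Nat.cast_pow, Real.log_pow]; push_cast; field_simp
  rw [e]; push_cast; ring

lemma uu_PP {m : ℕ} (F : ℕ → ℕ → ℂ) (a : Fin m → ℝ) (s : Fin m → ℂ) {q : ℕ} (χ : DirichletCharacter ℂ q) (l : ℕ) :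
    ∑ p ∈ (range (2 ^ 2 ^ l)).filter Nat.Prime, (uu (F (2 ^ 2 ^ l)) a s χ p + if p ^ 2 < 2 ^ 2 ^ l then uu (F (2 ^ 2 ^ l)) a s χ (p ^ 2) else 0)
      = 2 * ∑ i ∈ range l, ev χ (PP (cc F a s) (dd F a s) i l) := by
  have h1 := PS_sum l (fun p => ev χ (MonoidAlgebra.single p (cc F a s l p) + MonoidAlgebra.single (p ^ 2) (dd F a s l p)))
  have h2 : ∑ i ∈ range l, ev χ (PP (cc F a s) (dd F a s) i l) =
      ∑ p ∈ PS l, ev χ (MonoidAlgebra.single p (cc F a s l p) + MonoidAlgebra.single (p ^ 2) (dd F a s l p)) := by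
    rw [h1]; apply sum_congr rfl; intro i _; rw [PP, map_sum]
  rw [h2, mul_sum]
  change ∑ p ∈ PS l, _ = _
  apply sum_congr rfl
  intro p hp
  have hp := PS_prime hp
  rw [map_add, ev_single, ev_single, cc, dd, if_pos hp, if_pos hp, uu, cL_prime χ hp]
  generalize 2 ^ 2 ^ l = N
  split_ifs
  · rw [uu, cL_prime_sq χ hp]; ring
  · ring

lemma L_prod {m : ℕ} {a : Fin m → ℝ} (ha : ∀ j, 0 ≤ a j) {s : Fin m → ℂ} (hs : ∀ j, 1 / 2 ≤ (s j).re)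
    {F : ℕ → ℕ → ℂ} (hF : ∀ N n, ‖F N n‖ ≤ 1) {q : ℕ} (χ : DirichletCharacter ℂ q) {f : ℂ → ℂ} {R E : ℝ} (l : ℕ)
    (hE : ∀ (B : ℝ) (N : ℕ) (u : ℕ → ℂ), 0 ≤ B → (∀ n, ¬ IsPrimePow n → u n = 0) →
      (∀ n, 1 ≤ n → ‖u n‖ ≤ B * (√(n:ℝ))⁻¹) →
      ‖∑ n ∈ range N, u n - ∑ p ∈ (range N).filter Nat.Prime, (u p + if p ^ 2 < N then u (p ^ 2) else 0)‖ ≤ B * E)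
    (hf : ∀ j, ‖f (s j)‖ ≤ Real.exp ((∑ n ∈ range (2 ^ 2 ^ l), F (2 ^ 2 ^ l) n * LSeries.term (cL χ) (s j) n).re + R)) :
    ∏ j, ‖f (s j)‖ ^ (a j) ≤ Real.exp (2 * (∑ i ∈ range l, ev χ (PP (cc F a s) (dd F a s) i l)).re + (∑ j, a j) * (E + R)) := by
  have hb : 0 ≤ ∑ j, a j := sum_nonneg fun j _ => ha j
  have h1 := hE (∑ j, a j) (2 ^ 2 ^ l) (uu (F (2 ^ 2 ^ l)) a s χ) hb (uu_pp _ a s χ) (uu_norm (hF _) ha hs χ)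
  rw [uu_PP, uu_eq] at h1
  calc ∏ j, ‖f (s j)‖ ^ (a j) ≤ ∏ j, Real.exp (a j * ((∑ n ∈ range (2 ^ 2 ^ l), F (2 ^ 2 ^ l) n * LSeries.term (cL χ) (s j) n).re + R)) := by
        apply prod_le_prod (fun j _ => by positivity)
        intro j _
        rw [mul_comm, Real.exp_mul]
        exact Real.rpow_le_rpow (norm_nonneg _) (hf j) (ha j)
    _ = Real.exp ((∑ j, (a j : ℂ) * ∑ n ∈ range (2 ^ 2 ^ l), F (2 ^ 2 ^ l) n * LSeries.term (cL χ) (s j) n).re + (∑ j, a j) * R) := by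
        rw [← Real.exp_sum, re_sum, sum_mul, ← sum_add_distrib]
        congr 1
        apply sum_congr rfl; intro j _
        rw [Complex.re_ofReal_mul]; ring
    _ ≤ _ := by
        apply Real.exp_le_exp.2
        have h2 := (Complex.re_le_norm _).trans h1
        rw [Complex.sub_re] at h2
        have h3 : (2 * ∑ i ∈ range l, ev χ (PP (cc F a s) (dd F a s) i l)).re = 2 * (∑ i ∈ range l, ev χ (PP (cc F a s) (dd F a s) i l)).re := by
          rw [show (2:ℂ) = ((2:ℝ):ℂ) by norm_num, Complex.re_ofReal_mul]
        rw [h3] at h2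
        linarith

open Classical in
theorem main {m : ℕ} (a : Fin m → ℝ) (A : ℝ) (ha : ∀ j, 0 < a j) (hA : 0 < A) :
    ∃ C : ℝ, 0 < C ∧ ∀ (q : ℕ) [NeZero q], 1 < q →
      (∀ χ : DirichletCharacter ℂ q, dirichletRH χ) →
      ∀ y : ℝ, 2 ≤ y → y ≤ (q : ℝ) →
      ∀ t : Fin m → ℝ, (∀ j, |t j| ≤ (q : ℝ) ^ A) →
      ∑ χ ∈ Finset.univ.filter (fun χ : DirichletCharacter ℂ q => χ.IsPrimitive),
        ∏ j, ‖DirichletCharacter.LFunction χ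
          (1 / 2 + 1 / Real.log y + (t j) * Complex.I)‖ ^ (a j)
      ≤ C * (Nat.totient q) * Real.log y ^ ((∑ j, (a j) ^ 2) / 4) *
        ∏ i, ∏ j, if i < j then gstar y |t i - t j| ^ (a i * a j / 2) else 1 := by
  have ha' : ∀ j, 0 ≤ a j := fun j => (ha j).le
  obtain ⟨K, hK, F, hF, key⟩ := key_ineq
  obtain ⟨E, hE, hEs⟩ := pp_split
  obtain ⟨CW, hCW, hW⟩ := W_bound a ha'
  set b := ∑ j, a j with hbdef
  have hb : 0 ≤ b := sum_nonneg fun j _ => ha' j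
  obtain ⟨H, hH, hHb⟩ : ∃ H : ℕ, 4 ≤ H ∧ 21 * (1 + 4 * b) ≤ H :=
    ⟨max 4 ⌈21 * (1 + 4 * b)⌉₊, le_max_left _ _, (Nat.le_ceil _).trans (by exact_mod_cast le_max_right _ _)⟩
  set κ : ℝ := ((24 * H + 2 : ℕ):ℝ) with hκ
  have hκ0 : 0 < κ := by rw [hκ]; positivity
  have hl2 : 0 < Real.log 2 := Real.log_pos (by norm_num)
  set M := K * (A + 5) * (2 * κ / Real.log 2) with hM
  have hM0 : 0 ≤ M := by positivity
  obtain ⟨C2, hC2, harp⟩ := harper b (b * (E + M)) hb hH hHb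
  refine ⟨C2 * CW, by positivity, ?_⟩
  intro q _ hq hRH y hy hyq t ht
  set s : Fin m → ℂ := fun j => (1 / 2 + 1 / Real.log y + (t j) * Complex.I : ℂ) with hs
  have hly := log_y_ge y hy
  have hsre : ∀ j, 1 / 2 ≤ (s j).re := by
    intro j
    have e : (s j).re = 1 / 2 + 1 / Real.log y := by
      have : s j = ((1 / 2 + 1 / Real.log y : ℝ) : ℂ) + (t j) * Complex.I := by simp only [hs]; push_cast; ring
      rw [this]; simp
    rw [e]
    have : 0 < 1 / Real.log y := by positivity
    linarith
  obtain ⟨L, hL1, hL2⟩ := exists_L κ (Real.log q) hκ0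
  have hpt : ∀ χ ∈ Finset.univ.filter (fun χ : DirichletCharacter ℂ q => χ.IsPrimitive), ∀ l ≤ L,
      ∏ j, ‖DirichletCharacter.LFunction χ (s j)‖ ^ (a j) ≤
        Real.exp (2 * (∑ i ∈ range l, ev χ (PP (cc F a s) (dd F a s) i l)).re + b * (E + M) * 2 ^ (L - l)) := by
    intro χ hχ l hl
    have hprim := (mem_filter.1 hχ).2
    have hKH := KH_L hq χ hprim (hRH χ)
    have hone : (1:ℝ) ≤ 2 ^ (L - l) := one_le_pow₀ (by norm_num)
    have h1 := L_prod (R := M * 2 ^ (L - l)) ha' hsre hF χ l hEs (f := DirichletCharacter.LFunction χ) ?_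
    · refine h1.trans (Real.exp_le_exp.2 ?_)
      have : b * (E + M * 2 ^ (L - l)) ≤ b * (E + M) * 2 ^ (L - l) := by
        rw [mul_assoc b (E + M)]; apply mul_le_mul_of_nonneg_left _ hb; nlinarith
      linarith
    · intro j
      have hN2 : 2 ≤ 2 ^ 2 ^ l := Nat.le_self_pow (by positivity) 2
      refine (key _ _ _ hKH (2 ^ 2 ^ l) hN2 (s j) (hsre j)).trans (Real.exp_le_exp.2 ?_)
      apply add_le_add_right
      have h2 : Real.log ((q:ℝ) * (2 + ‖s j‖)) ≤ (A + 5) * Real.log q := size_bound hA hq hy (ht j)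
      have e1 : Real.log ((2 ^ 2 ^ l : ℕ) : ℝ) = 2 ^ l * Real.log 2 := by
        push_cast; rw [Real.log_pow]; push_cast; rfl
      rw [e1]
      have e2 : (2:ℝ) ^ (L + 1) = 2 * (2 ^ l * 2 ^ (L - l)) := by rw [← pow_add, ← pow_succ']; congr 1; omega
      have h3 : Real.log ((q:ℝ) * (2 + ‖s j‖)) ≤ (A + 5) * (κ * (2 * (2 ^ l * 2 ^ (L - l)))) := by
        rw [← e2]
        exact h2.trans (mul_le_mul_of_nonneg_left hL1 (by linarith))
      calc K * (Real.log ((q:ℝ) * (2 + ‖s j‖)) / (2 ^ l * Real.log 2)) ≤ K * ((A + 5) * (κ * (2 * (2 ^ l * 2 ^ (L - l)))) / (2 ^ l * Real.log 2)) := by gcongr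
        _ = M * 2 ^ (L - l) := by rw [hM]; field_simp
  have hfin := harp q hq (gg a s) (cc F a s) (dd F a s) (gg_nonneg a s) (gg_sq ha' hsre) (cc_norm hF a s) (dd_norm hF ha' hsre)
    L hL2 _ (fun χ => ∏ j, ‖DirichletCharacter.LFunction χ (s j)‖ ^ (a j)) hpt
  have hsum : ∑ p ∈ PS L, gg a s p ^ 2 = (∑ p ∈ PS L, wt a y t p) / 4 := by
    rw [sum_div]; apply sum_congr rfl; intro p hp
    rw [gg, if_pos (PS_prime hp), wt, VV]
    ring
  rw [hsum] at hfin
  have hWf := hW (fun z hz => zf_ne_zero (hRH 1) z hz) y hy t (PS L) (fun p hp => PS_prime hp)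
  refine hfin.trans ?_
  calc _ ≤ C2 * Nat.totient q * (CW * Real.log y ^ ((∑ j, (a j) ^ 2) / 4) *
        ∏ i, ∏ j, if i < j then gstar y |t i - t j| ^ (a i * a j / 2) else 1) := by gcongr
    _ = _ := by ring

end Stmt13

open Classical in
theorem stmt13 (k : ℕ) (hk : 0 < k) (a : Fin (2 * k) → ℝ) (A : ℝ)
    (ha : ∀ j, 0 < a j) (hA : 0 < A) :
    ∃ C : ℝ, 0 < C ∧ ∀ (q : ℕ) [NeZero q], 1 < q →
      (∀ χ : DirichletCharacter ℂ q, dirichletRH χ) →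
      ∀ y : ℝ, 2 ≤ y → y ≤ (q : ℝ) →
      ∀ t : Fin (2 * k) → ℝ, (∀ j, |t j| ≤ (q : ℝ) ^ A) →
      ∑ χ ∈ Finset.univ.filter (fun χ : DirichletCharacter ℂ q => χ.IsPrimitive),
        ∏ j, ‖DirichletCharacter.LFunction χ
          (1 / 2 + 1 / Real.log y + (t j) * Complex.I)‖ ^ (a j)
      ≤ C * (Nat.totient q) * Real.log y ^ ((∑ j, (a j) ^ 2) / 4) *
        ∏ i, ∏ j, if i < j then gstar y |t i - t j| ^ (a i * a j / 2) else 1 := by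
  exact Stmt13.main a A ha hA
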